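/- Let A and B be C*-algebras, and let I ⊆ A ⊗̂ B be a closed prime two-sided ideal. Define J = {a ∈ A : a ⊙ B ⊆ I} and K = {b ∈ B : A ⊙ b ⊆ I}. Then J ⊆ A and K ⊆ B are closed prime two-sided ideals, and I = (J ⊗̂ B) + (A ⊗̂ K) inside A ⊗̂ B. Conversely, if J ⊆ A and K ⊆ B are closed prime two-sided ideals, then (J ⊗̂ B) + (A ⊗̂ K) is a closed prime two-sided ideal in A ⊗̂ B. -/

import Mathlib

open Pointwise

universe u

/-- The Banach `*`-algebra projective tensor product `A ⊗̂ B` of two C*-algebras, presented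
by its characteristic properties: a Banach `*`-algebra `T` with a bilinear map
`tmul : A × B → T` which is multiplicative and `*`-preserving on elementary tensors, has
dense linear span, satisfies `‖a ⊗ b‖ = ‖a‖‖b‖`, and enjoys the universal property of the
projective tensor norm: every bounded bilinear map into a Banach space extends to a bounded
linear map on `T` without increase of norm. -/
structure CStarProjTensor (A B : Type u)
    [NonUnitalCStarAlgebra A] [NonUnitalCStarAlgebra B] : Type (u + 1) where
  /-- The underlying Banach `*`-algebra `A ⊗̂ B`. -/
  T : Type u
  [ring : NonUnitalNormedRing T]
  [starT : StarRing T]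
  [nsg : NormedStarGroup T]
  [mod : NormedSpace ℂ T]
  [tower : IsScalarTower ℂ T T]
  [scomm : SMulCommClass ℂ T T]
  [complete : CompleteSpace T]
  /-- The canonical bilinear map `(a, b) ↦ a ⊗ b`. -/
  tmul : A →ₗ[ℂ] B →ₗ[ℂ] T
  tmul_mul : ∀ a₁ a₂ b₁ b₂, tmul a₁ b₁ * tmul a₂ b₂ = tmul (a₁ * a₂) (b₁ * b₂)
  tmul_star : ∀ a b, star (tmul a b) = tmul (star a) (star b)
  norm_tmul : ∀ a b, ‖tmul a b‖ = ‖a‖ * ‖b‖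
  span_dense : closure (Submodule.span ℂ {t : T | ∃ a b, t = tmul a b} : Set T) = Set.univ
  lift : ∀ (X : Type u) [NormedAddCommGroup X] [NormedSpace ℂ X] [CompleteSpace X]
      (β : A →L[ℂ] B →L[ℂ] X),
    ∃ L : T →L[ℂ] X, (∀ a b, L (tmul a b) = β a b) ∧ ‖L‖ ≤ ‖β‖

attribute [instance] CStarProjTensor.ring CStarProjTensor.starT CStarProjTensor.nsg
  CStarProjTensor.mod CStarProjTensor.tower CStarProjTensor.scomm CStarProjTensor.complete

/-- A two-sided (ring-theoretic) ideal is prime if whenever a product of two two-sided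
ideals is contained in it, one of them is contained in it. -/
def TwoSidedIdeal.IsPrimeTS {R : Type*} [NonUnitalNonAssocRing R]
    (P : TwoSidedIdeal R) : Prop :=
  ∀ I₁ I₂ : TwoSidedIdeal R, (∀ x ∈ I₁, ∀ y ∈ I₂, x * y ∈ P) → I₁ ≤ P ∨ I₂ ≤ P

section

variable {A B : Type u} [NonUnitalCStarAlgebra A] [NonUnitalCStarAlgebra B]
  (P : CStarProjTensor A B)

/-- The image of `J ⊗̂ B` in `A ⊗̂ B`, for a subset `J ⊆ A`: the closed linear span of the
elementary tensors `a ⊗ b` with `a ∈ J`. -/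
def leftTensorIdeal (J : Set A) : Set P.T :=
  closure (Submodule.span ℂ {t : P.T | ∃ a ∈ J, ∃ b : B, t = P.tmul a b} : Set P.T)

/-- The image of `A ⊗̂ K` in `A ⊗̂ B`, for a subset `K ⊆ B`: the closed linear span of the
elementary tensors `a ⊗ b` with `b ∈ K`. -/
def rightTensorIdeal (K : Set B) : Set P.T :=
  closure (Submodule.span ℂ {t : P.T | ∃ a : A, ∃ b ∈ K, t = P.tmul a b} : Set P.T)

end

set_option linter.unusedSectionVars false

section Grothendieck

variable {A B : Type*} [CStarAlgebra A] [PartialOrder A] [StarOrderedRing A]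
  [CStarAlgebra B] [PartialOrder B] [StarOrderedRing B]

/-- The real part `√(1 - k²)` of the unitary `√(1 - k²) + i k`. -/
noncomputable def cosPart (k : A) : A := cfc (fun x : ℝ => √(1 - x ^ 2)) k

lemma cosPart_isSelfAdjoint (k : A) : IsSelfAdjoint (cosPart k) := by
  unfold cosPart; cfc_tac

lemma mem_spectrum_sq_le_one {k : A} (hk1 : ‖k‖ ≤ 1) {x : ℝ}
    (hx : x ∈ spectrum ℝ k) : x ^ 2 ≤ 1 := by
  rcases subsingleton_or_nontrivial A with h | h
  · rw [spectrum.of_subsingleton] at hx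
    exact absurd hx (Set.notMem_empty x)
  have := spectrum.norm_le_norm_of_mem hx
  rw [Real.norm_eq_abs] at this
  rw [← sq_abs]
  nlinarith [abs_nonneg x]

lemma cosPart_add_mem_unitary {k : A} (hk : IsSelfAdjoint k) (hk1 : ‖k‖ ≤ 1) :
    cosPart k + Complex.I • k ∈ unitary A := by
  have hc : Continuous fun x : ℝ => √(1 - x ^ 2) := by fun_prop
  have hsq : cosPart k * cosPart k = 1 - k * k := by
    have h1 : cfc (fun x : ℝ => 1 - x * x) k = 1 - k * k := by
      rw [cfc_sub _ _ k, cfc_const_one ℝ k, cfc_mul _ _ k, cfc_id' ℝ k]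
    rw [← h1, cosPart, ← cfc_mul _ _ k]
    refine cfc_congr fun x hx => ?_
    have := mem_spectrum_sq_le_one hk1 hx
    rw [Real.mul_self_sqrt (by linarith)]; ring
  have hcomm : cosPart k * k = k * cosPart k := by
    have h := cfc_commute_cfc (fun x : ℝ => √(1 - x ^ 2)) id k
    rw [cfc_id ℝ k] at h
    exact h
  have hs := (cosPart_isSelfAdjoint k).star_eq
  rw [Unitary.mem_iff]
  constructor <;>
  · simp only [star_add, star_smul, hs, hk.star_eq, add_mul, mul_add, smul_mul_assoc,
      mul_smul_comm, hsq, hcomm, RCLike.star_def, Complex.conj_I]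
    simp [smul_smul, Complex.I_mul_I]

lemma one_sub_cosPart_nonneg {k : A} (hk : IsSelfAdjoint k) : 0 ≤ 1 - cosPart k := by
  have : 1 - cosPart k = cfc (fun x : ℝ => 1 - √(1 - x ^ 2)) k := by
    rw [cfc_sub _ _ k, cfc_const_one ℝ k, cosPart]
  rw [this]
  refine cfc_nonneg fun x hx => ?_
  have : √(1 - x ^ 2) ≤ 1 := by
    rw [Real.sqrt_le_left (by norm_num)]; nlinarith [sq_nonneg x]
  simpa using this

lemma one_sub_cosPart_le {k : A} (hk : IsSelfAdjoint k) (hk1 : ‖k‖ ≤ 1) :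
    1 - cosPart k ≤ k ^ 2 := by
  have h1 : 1 - cosPart k = cfc (fun x : ℝ => 1 - √(1 - x ^ 2)) k := by
    rw [cfc_sub _ _ k, cfc_const_one ℝ k, cosPart]
  have h2 : k ^ 2 = cfc (fun x : ℝ => x ^ 2) k := by
    rw [cfc_pow _ _ k, cfc_id' ℝ k]
  rw [h1, h2]
  refine cfc_mono fun x hx => ?_
  have := mem_spectrum_sq_le_one hk1 hx
  have h3 : 1 - x ^ 2 ≤ √(1 - x ^ 2) := by
    refine Real.le_sqrt_of_sq_le ?_
    nlinarith [sq_nonneg x]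
  linarith

lemma norm_le_of_nonneg_of_le_one {p : A} (hp : 0 ≤ p) (hp1 : p ≤ 1) : ‖p‖ ≤ 1 :=
  (CStarAlgebra.norm_le_one_iff_of_nonneg p hp).2 hp1

lemma norm_one_sub_le {p : A} (hp : 0 ≤ p) (hp1 : p ≤ 1) : ‖1 - p‖ ≤ 1 :=
  norm_le_of_nonneg_of_le_one (sub_nonneg.2 hp1) (by simpa using hp)

lemma sq_le_self_of_le_one {p : A} (hp : 0 ≤ p) (hp1 : p ≤ 1) : p ^ 2 ≤ p := by
  simpa using CStarAlgebra.pow_antitone hp hp1 one_le_two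

lemma cosPart_neg {k : A} (hk : IsSelfAdjoint k) : cosPart (-k) = cosPart k := by
  have := cfc_comp_neg (fun x : ℝ => √(1 - x ^ 2)) k
  simp only [neg_sq] at this
  rw [cosPart, ← this, cosPart]

lemma cosPart_sub_mem_unitary {k : A} (hk : IsSelfAdjoint k) (hk1 : ‖k‖ ≤ 1) :
    cosPart k - Complex.I • k ∈ unitary A := by
  have := cosPart_add_mem_unitary hk.neg (by simpa using hk1)
  rwa [cosPart_neg hk, smul_neg, ← sub_eq_add_neg] at this

lemma I_smul_mem_unitary {u : A} (hu : u ∈ unitary A) : Complex.I • u ∈ unitary A := by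
  rw [Unitary.mem_iff] at hu ⊢
  simp [smul_smul, hu.1, hu.2, Complex.I_mul_I]

lemma mem_hull_of_norm_le {h : A} (hh : IsSelfAdjoint h) (h1 : ‖h‖ ≤ 1) :
    h ∈ convexHull ℝ (unitary A : Set A) := by
  have hu := I_smul_mem_unitary (cosPart_sub_mem_unitary hh h1)
  have hv := I_smul_mem_unitary (cosPart_sub_mem_unitary hh.neg (by simpa using h1))
  rw [cosPart_neg hh] at hv
  have hv' : -(Complex.I • (cosPart h - Complex.I • -h)) ∈ unitary A := by
    rw [Unitary.mem_iff] at hv ⊢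
    simpa only [star_neg, neg_mul_neg] using hv
  have := (convex_convexHull ℝ (unitary A : Set A)) (subset_convexHull ℝ _ hu)
    (subset_convexHull ℝ _ hv') (a := 1 / 2) (b := 1 / 2) (by norm_num) (by norm_num) (by norm_num)
  convert this using 1
  rw [← smul_add]
  simp only [smul_sub, smul_neg, smul_smul, Complex.I_mul_I, neg_smul, one_smul]
  rw [show Complex.I • cosPart h - -h + -(Complex.I • cosPart h - - -h) = (2 : ℝ) • h by
    rw [two_smul]; abel]
  rw [smul_smul]; norm_num

end Grothendieck

section Grothendieck

variable {A B : Type*} [CStarAlgebra A] [PartialOrder A] [StarOrderedRing A]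
  [CStarAlgebra B] [PartialOrder B] [StarOrderedRing B]

/-- A bilinear form which is contractive on pairs of unitaries and attains the value one
at the pair of units. -/
structure IsNormalizedForm (V : A →ₗ[ℂ] B →ₗ[ℂ] ℂ) : Prop where
  norm_le : ∀ u ∈ unitary A, ∀ v ∈ unitary B, ‖V u v‖ ≤ 1
  map_one : V 1 1 = 1

namespace IsNormalizedForm

variable {V : A →ₗ[ℂ] B →ₗ[ℂ] ℂ}

lemma flip (hV : IsNormalizedForm V) : IsNormalizedForm V.flip :=
  ⟨fun u hu v hv => hV.norm_le v hv u hu, hV.map_one⟩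

lemma norm_le_of_mem_hull (hV : IsNormalizedForm V) {a : A} {b : B}
    (ha : a ∈ convexHull ℝ (unitary A : Set A)) (hb : b ∈ convexHull ℝ (unitary B : Set B)) :
    ‖V a b‖ ≤ 1 := by
  have h1 : ∀ v ∈ unitary B, ‖V a v‖ ≤ 1 := by
    intro v hv
    have : convexHull ℝ (unitary A : Set A) ⊆
        ((V.flip v).restrictScalars ℝ) ⁻¹' Metric.closedBall (0 : ℂ) 1 := by
      refine convexHull_min (fun u hu => ?_)
        ((convex_closedBall (0 : ℂ) 1).linear_preimage _)
      simpa using hV.norm_le u hu v hv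
    simpa using this ha
  have : convexHull ℝ (unitary B : Set B) ⊆
      ((V a).restrictScalars ℝ) ⁻¹' Metric.closedBall (0 : ℂ) 1 := by
    refine convexHull_min (fun u hu => ?_) ((convex_closedBall (0 : ℂ) 1).linear_preimage _)
    simpa using h1 u hu
  simpa using this hb

lemma map_real_smul (c : ℝ) (a : A) (b : B) : V (c • a) b = c * V a b := by
  rw [← Complex.coe_smul]; simp

lemma map_real_smul_right (c : ℝ) (a : A) (b : B) : V a (c • b) = c * V a b := by
  rw [← Complex.coe_smul]; simp

lemma norm_le_mul (hV : IsNormalizedForm V) {h : A} {k : B} (hh : IsSelfAdjoint h)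
    (hk : IsSelfAdjoint k) : ‖V h k‖ ≤ ‖h‖ * ‖k‖ := by
  rcases eq_or_ne h 0 with rfl | h0
  · simp
  rcases eq_or_ne k 0 with rfl | k0
  · simp
  have hn := norm_pos_iff.2 h0
  have kn := norm_pos_iff.2 k0
  have h1 : ‖‖h‖⁻¹ • h‖ ≤ 1 := by
    rw [norm_smul, norm_inv, norm_norm, inv_mul_cancel₀ hn.ne']
  have k1 : ‖‖k‖⁻¹ • k‖ ≤ 1 := by
    rw [norm_smul, norm_inv, norm_norm, inv_mul_cancel₀ kn.ne']
  have := hV.norm_le_of_mem_hull (mem_hull_of_norm_le ((IsSelfAdjoint.all _).smul hh) h1)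
    (mem_hull_of_norm_le ((IsSelfAdjoint.all _).smul hk) k1)
  rw [map_real_smul, map_real_smul_right, norm_mul, norm_mul] at this
  simp only [Complex.ofReal_inv, norm_inv, Complex.norm_real, norm_norm] at this
  have e : ‖V h k‖ = ‖h‖ * ‖k‖ * (‖h‖⁻¹ * (‖k‖⁻¹ * ‖V h k‖)) := by field_simp
  rw [e]
  exact mul_le_of_le_one_right (by positivity) this

lemma re_nonneg_of_le_one (hV : IsNormalizedForm V) {p : A} (hp : 0 ≤ p) (hp1 : p ≤ 1) :
    0 ≤ (V p 1).re := by
  have h1 := hV.norm_le_of_mem_hull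
    (mem_hull_of_norm_le (IsSelfAdjoint.of_nonneg (sub_nonneg.2 hp1)) (norm_one_sub_le hp hp1))
    (subset_convexHull ℝ _ (one_mem (unitary B)))
  have h2 := (Complex.re_le_norm _).trans h1
  simp only [map_sub, LinearMap.sub_apply, hV.map_one, Complex.sub_re, Complex.one_re] at h2
  linarith

lemma exists_pos_smul_le_one {p : A} (hp : 0 ≤ p) : ∃ c : ℝ, 0 < c ∧ 0 ≤ c • p ∧ c • p ≤ 1 := by
  refine ⟨(‖p‖ + 1)⁻¹, by positivity, smul_nonneg (by positivity) hp, ?_⟩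
  rw [← CStarAlgebra.norm_le_one_iff_of_nonneg _ (smul_nonneg (by positivity) hp), norm_smul,
    norm_inv, Real.norm_of_nonneg (by positivity), inv_mul_le_iff₀ (by positivity)]
  linarith

lemma re_nonneg (hV : IsNormalizedForm V) {p : A} (hp : 0 ≤ p) : 0 ≤ (V p 1).re := by
  obtain ⟨c, hc, h0, h1⟩ := exists_pos_smul_le_one hp
  have := hV.re_nonneg_of_le_one h0 h1
  rw [map_real_smul, Complex.re_ofReal_mul] at this
  exact nonneg_of_mul_nonneg_right this hc

lemma re_mono (hV : IsNormalizedForm V) {p q : A} (h : p ≤ q) : (V p 1).re ≤ (V q 1).re := by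
  have := hV.re_nonneg (sub_nonneg.2 h)
  simp only [map_sub, LinearMap.sub_apply, Complex.sub_re] at this
  linarith

lemma re_mono_right (hV : IsNormalizedForm V) {p q : B} (h : p ≤ q) :
    (V 1 p).re ≤ (V 1 q).re := hV.flip.re_mono h

lemma neg_re_le_of_norm_le_one (hV : IsNormalizedForm V) {h : A} {k : B} (hh : IsSelfAdjoint h)
    (hk : IsSelfAdjoint k) (h1 : ‖h‖ ≤ 1) (k1 : ‖k‖ ≤ 1) :
    -(V h k).re ≤ (V (h ^ 2) 1).re + (V 1 (k ^ 2)).re + ‖h‖ ^ 2 * ‖k‖ ^ 2 := by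
  obtain ⟨C, hC⟩ : ∃ C, C = 1 - cosPart h := ⟨_, rfl⟩
  obtain ⟨D, hD⟩ : ∃ D, D = 1 - cosPart k := ⟨_, rfl⟩
  have hw : cosPart h = 1 - C := by rw [hC]; abel
  have hw' : cosPart k = 1 - D := by rw [hD]; abel
  have e1 := (Complex.re_le_norm _).trans (hV.norm_le _ (cosPart_add_mem_unitary hh h1) _
    (cosPart_add_mem_unitary hk k1))
  have e2 := (Complex.re_le_norm _).trans (hV.norm_le _ (cosPart_sub_mem_unitary hh h1) _
    (cosPart_sub_mem_unitary hk k1))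
  rw [hw, hw'] at e1 e2
  simp only [map_sub, map_add, map_smul, LinearMap.sub_apply, LinearMap.add_apply,
    LinearMap.smul_apply, hV.map_one, smul_eq_mul, Complex.sub_re, Complex.add_re, Complex.mul_re,
    Complex.I_re, Complex.I_im, Complex.one_re, Complex.mul_im, Complex.sub_im, Complex.add_im]
    at e1 e2
  have hC0 : 0 ≤ C := hC ▸ one_sub_cosPart_nonneg hh
  have hD0 : 0 ≤ D := hD ▸ one_sub_cosPart_nonneg hk
  have hCle : C ≤ h ^ 2 := hC ▸ one_sub_cosPart_le hh h1
  have hDle : D ≤ k ^ 2 := hD ▸ one_sub_cosPart_le hk k1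
  have hCn : ‖C‖ ≤ ‖h‖ ^ 2 := (CStarAlgebra.norm_le_norm_of_nonneg_of_le hC0 hCle).trans
    (norm_pow_le' _ two_pos)
  have hDn : ‖D‖ ≤ ‖k‖ ^ 2 := (CStarAlgebra.norm_le_norm_of_nonneg_of_le hD0 hDle).trans
    (norm_pow_le' _ two_pos)
  have m1 := hV.re_mono hCle
  have m2 := hV.re_mono_right hDle
  have m3 := (hV.norm_le_mul (IsSelfAdjoint.of_nonneg hC0) (IsSelfAdjoint.of_nonneg hD0)).trans
    (mul_le_mul hCn hDn (norm_nonneg _) (by positivity))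
  have m4 := (Complex.abs_re_le_norm _).trans m3
  have m5 := neg_abs_le (V C D).re
  linarith

lemma neg_re_le (hV : IsNormalizedForm V) {h : A} {k : B} (hh : IsSelfAdjoint h)
    (hk : IsSelfAdjoint k) : -(V h k).re ≤ (V (h ^ 2) 1).re + (V 1 (k ^ 2)).re := by
  have key : ∀ n : ℕ, -(V h k).re ≤ (V (h ^ 2) 1).re + (V 1 (k ^ 2)).re +
      ‖h‖ ^ 2 * ‖k‖ ^ 2 * (1 / ((n : ℝ) + 1)) := by
    intro n
    obtain ⟨d, hd⟩ : ∃ d : ℝ, d = 1 / ((n : ℝ) + 1 + ‖h‖ + ‖k‖) := ⟨_, rfl⟩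
    have hd0 : 0 < d := by rw [hd]; positivity
    have hs : ‖d • h‖ ≤ 1 := by
      rw [norm_smul, Real.norm_of_nonneg hd0.le, hd, one_div, inv_mul_le_iff₀ (by positivity)]
      nlinarith [norm_nonneg k, (Nat.cast_nonneg n : (0 : ℝ) ≤ n)]
    have ks : ‖d • k‖ ≤ 1 := by
      rw [norm_smul, Real.norm_of_nonneg hd0.le, hd, one_div, inv_mul_le_iff₀ (by positivity)]
      nlinarith [norm_nonneg h, (Nat.cast_nonneg n : (0 : ℝ) ≤ n)]
    have hdn : d ^ 2 ≤ 1 / ((n : ℝ) + 1) := by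
      have h1 : d ≤ 1 / ((n : ℝ) + 1) := by
        rw [hd]
        exact one_div_le_one_div_of_le (by positivity) (by linarith [norm_nonneg h, norm_nonneg k])
      have h2 : 1 / ((n : ℝ) + 1) ≤ 1 := by
        rw [div_le_one (by positivity)]; linarith [(Nat.cast_nonneg n : (0 : ℝ) ≤ n)]
      nlinarith
    have := hV.neg_re_le_of_norm_le_one ((IsSelfAdjoint.all d).smul hh)
      ((IsSelfAdjoint.all d).smul hk) hs ks
    simp only [smul_pow, map_real_smul, map_real_smul_right, Complex.re_ofReal_mul, norm_smul,
      mul_pow, Real.norm_eq_abs, sq_abs] at this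
    have h3 : d ^ 2 * (-(V h k).re) ≤ d ^ 2 * ((V (h ^ 2) 1).re + (V 1 (k ^ 2)).re +
        ‖h‖ ^ 2 * ‖k‖ ^ 2 * d ^ 2) := by linarith
    have h4 := le_of_mul_le_mul_left h3 (by positivity)
    have h5 : ‖h‖ ^ 2 * ‖k‖ ^ 2 * d ^ 2 ≤ ‖h‖ ^ 2 * ‖k‖ ^ 2 * (1 / ((n : ℝ) + 1)) := by gcongr
    linarith
  have hlim : Filter.Tendsto (fun n : ℕ => (V (h ^ 2) 1).re + (V 1 (k ^ 2)).re +
      ‖h‖ ^ 2 * ‖k‖ ^ 2 * (1 / ((n : ℝ) + 1))) Filter.atTop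
      (nhds ((V (h ^ 2) 1).re + (V 1 (k ^ 2)).re + ‖h‖ ^ 2 * ‖k‖ ^ 2 * 0)) :=
    tendsto_const_nhds.add (tendsto_one_div_add_atTop_nhds_zero_nat.const_mul _)
  simpa using ge_of_tendsto' hlim key

lemma abs_re_le (hV : IsNormalizedForm V) {h : A} {k : B} (hh : IsSelfAdjoint h)
    (hk : IsSelfAdjoint k) : |(V h k).re| ≤ (V (h ^ 2) 1).re + (V 1 (k ^ 2)).re := by
  have h1 := hV.neg_re_le hh hk
  have h2 := hV.neg_re_le hh.neg hk
  simp only [map_neg, LinearMap.neg_apply, Complex.neg_re, neg_sq] at h2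
  rw [abs_le]; constructor <;> linarith

lemma im_le_of_norm_le_one (hV : IsNormalizedForm V) {p : A} {k : B} (hp : 0 ≤ p) (hp1 : p ≤ 1)
    (hk : IsSelfAdjoint k) (k1 : ‖k‖ ≤ 1) :
    (V p k).im ≤ 2 * (V p 1).re + 3 * (V 1 (k ^ 2)).re := by
  obtain ⟨D, hD⟩ : ∃ D, D = 1 - cosPart k := ⟨_, rfl⟩
  have hw : cosPart k = 1 - D := by rw [hD]; abel
  have hD0 : 0 ≤ D := hD ▸ one_sub_cosPart_nonneg hk
  have hDle : D ≤ k ^ 2 := hD ▸ one_sub_cosPart_le hk k1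
  have e1 := (Complex.re_le_norm _).trans (hV.norm_le_of_mem_hull
    (mem_hull_of_norm_le (IsSelfAdjoint.of_nonneg (sub_nonneg.2 hp1)) (norm_one_sub_le hp hp1))
    (subset_convexHull ℝ _ (cosPart_add_mem_unitary hk k1)))
  have e2 := (Complex.re_le_norm _).trans (hV.norm_le _ (one_mem _) _
    (cosPart_sub_mem_unitary hk k1))
  rw [hw] at e1 e2
  simp only [map_sub, map_add, map_smul, LinearMap.sub_apply, LinearMap.add_apply,
    LinearMap.smul_apply, hV.map_one, smul_eq_mul, Complex.sub_re, Complex.add_re, Complex.mul_re,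
    Complex.I_re, Complex.I_im, Complex.one_re, Complex.mul_im, Complex.sub_im, Complex.add_im]
    at e1 e2
  have m1 := hV.abs_re_le (IsSelfAdjoint.of_nonneg hp) (IsSelfAdjoint.of_nonneg hD0)
  have m2 := hV.re_mono (sq_le_self_of_le_one hp hp1)
  have hD1 : D ≤ 1 := by
    rw [← CStarAlgebra.norm_le_one_iff_of_nonneg D hD0]
    exact (CStarAlgebra.norm_le_norm_of_nonneg_of_le hD0 hDle).trans
      ((norm_pow_le' _ two_pos).trans (pow_le_one₀ (norm_nonneg _) k1))
  have m3 := hV.re_mono_right (sq_le_self_of_le_one hD0 hD1)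
  have m4 := hV.re_mono_right hDle
  have m5 := neg_abs_le (V p D).re
  linarith

lemma im_le (hV : IsNormalizedForm V) {p : A} {k : B} {P K : ℝ} (hP : 0 < P) (hK : 0 < K)
    (hp : 0 ≤ p) (hp1 : p ≤ P • (1 : A)) (hk : IsSelfAdjoint k) (k1 : ‖k‖ ≤ K) :
    (V p k).im ≤ 2 * K * (V p 1).re + 3 * (P / K) * (V 1 (k ^ 2)).re := by
  have hp2 : P⁻¹ • p ≤ 1 := by
    have := smul_le_smul_of_nonneg_left hp1 (inv_nonneg.2 hP.le)
    rwa [smul_smul, inv_mul_cancel₀ hP.ne', one_smul] at this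
  have hk2 : ‖K⁻¹ • k‖ ≤ 1 := by
    rw [norm_smul, norm_inv, Real.norm_of_nonneg hK.le, inv_mul_le_iff₀ hK]; linarith
  have := hV.im_le_of_norm_le_one (smul_nonneg (inv_nonneg.2 hP.le) hp) hp2
    ((IsSelfAdjoint.all K⁻¹).smul hk) hk2
  simp only [smul_pow, map_real_smul, map_real_smul_right, Complex.re_ofReal_mul,
    Complex.im_ofReal_mul] at this
  have e : (V p k).im = P * K * (P⁻¹ * (K⁻¹ * (V p k).im)) := by field_simp
  have e2 : 2 * K * (V p 1).re + 3 * (P / K) * (V 1 (k ^ 2)).re =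
      P * K * (2 * (P⁻¹ * (V p 1).re) + 3 * ((K⁻¹) ^ 2 * (V 1 (k ^ 2)).re)) := by field_simp
  rw [e, e2]
  refine mul_le_mul_of_nonneg_left ?_ (by positivity)
  linarith

lemma abs_im_le (hV : IsNormalizedForm V) {p : A} {k : B} {P K : ℝ} (hP : 0 < P) (hK : 0 < K)
    (hp : 0 ≤ p) (hp1 : p ≤ P • (1 : A)) (hk : IsSelfAdjoint k) (k1 : ‖k‖ ≤ K) :
    |(V p k).im| ≤ 2 * K * (V p 1).re + 3 * (P / K) * (V 1 (k ^ 2)).re := by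
  have h1 := hV.im_le hP hK hp hp1 hk k1
  have h2 := hV.im_le hP hK hp hp1 hk.neg (by simpa using k1)
  simp only [map_neg, Complex.neg_im, neg_sq] at h2
  rw [abs_le]; constructor <;> linarith

end IsNormalizedForm

end Grothendieck

section Grothendieck

variable {A B : Type*} [CStarAlgebra A] [PartialOrder A] [StarOrderedRing A]
  [CStarAlgebra B] [PartialOrder B] [StarOrderedRing B]

lemma add_pow_four_add_sub_pow_four_le {X x : A} (hX : IsSelfAdjoint X) (hx : IsSelfAdjoint x) :
    (X + x) ^ 4 + (X - x) ^ 4 ≤ 2 • X ^ 4 + 2 • (X ^ 2 * x ^ 2 + x ^ 2 * X ^ 2 + x ^ 4) +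
      4 • (X * x ^ 2 * X + x * X ^ 2 * x) := by
  have hw : star (X * x - x * X) = -(X * x - x * X) := by
    simp [hX.star_eq, hx.star_eq]
  have h0 := star_mul_self_nonneg (X * x - x * X)
  rw [hw] at h0
  rw [← sub_nonneg]
  refine (add_nonneg h0 h0).trans_eq ?_
  noncomm_ring

lemma sum_add_pow_four_le {ι : Type*} {x : ι → A} (hx : ∀ i, IsSelfAdjoint (x i)) {Ω : Type}
    [Fintype Ω] [DecidableEq ι] {X : Ω → A} (hX : ∀ ω, IsSelfAdjoint (X ω)) {s : Finset ι} {a : ι}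
    (ha : a ∉ s) (hc : ∀ c, ∑ ω, X ω * c * X ω = Fintype.card Ω • ∑ i ∈ s, x i * c * x i)
    (h4 : ∑ ω, X ω ^ 4 ≤ Fintype.card Ω • ((∑ i ∈ s, x i ^ 2) ^ 2 +
      2 • ∑ i ∈ s, x i * (∑ j ∈ s, x j ^ 2) * x i)) :
    ∑ ω, (X ω + x a) ^ 4 + ∑ ω, (X ω - x a) ^ 4 ≤
      (Fintype.card Ω + Fintype.card Ω) • ((∑ i ∈ insert a s, x i ^ 2) ^ 2 +
      2 • ∑ i ∈ insert a s, x i * (∑ j ∈ insert a s, x j ^ 2) * x i) := by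
  have hsq : ∑ ω, X ω ^ 2 = Fintype.card Ω • ∑ i ∈ s, x i ^ 2 := by
    simpa [pow_two] using hc 1
  have hxx := hc (x a ^ 2)
  obtain ⟨S, hS⟩ : ∃ S, S = ∑ i ∈ s, x i ^ 2 := ⟨_, rfl⟩
  rw [← hS] at hsq h4
  simp only [Finset.sum_insert ha, ← hS, mul_add, add_mul, Finset.sum_add_distrib]
  obtain ⟨T, hT⟩ : ∃ T, T = ∑ i ∈ s, x i * x a ^ 2 * x i := ⟨_, rfl⟩
  obtain ⟨U, hU⟩ : ∃ U, U = ∑ i ∈ s, x i * S * x i := ⟨_, rfl⟩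
  rw [← hT] at hxx ⊢
  rw [← hU] at h4 ⊢
  calc ∑ ω, (X ω + x a) ^ 4 + ∑ ω, (X ω - x a) ^ 4
      ≤ ∑ ω, (2 • X ω ^ 4 + 2 • (X ω ^ 2 * x a ^ 2 + x a ^ 2 * X ω ^ 2 + x a ^ 4) +
        4 • (X ω * x a ^ 2 * X ω + x a * X ω ^ 2 * x a)) := by
        rw [← Finset.sum_add_distrib]
        exact Finset.sum_le_sum fun ω _ => add_pow_four_add_sub_pow_four_le (hX ω) (hx a)
    _ = 2 • ∑ ω, X ω ^ 4 + (2 • ((∑ ω, X ω ^ 2) * x a ^ 2 + x a ^ 2 * (∑ ω, X ω ^ 2) +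
        Fintype.card Ω • x a ^ 4) +
        4 • (∑ ω, X ω * x a ^ 2 * X ω + x a * (∑ ω, X ω ^ 2) * x a)) := by
        simp only [Finset.sum_add_distrib, ← Finset.smul_sum, ← Finset.sum_mul,
          ← Finset.mul_sum, Finset.sum_const, Finset.card_univ, add_assoc]
    _ ≤ 2 • (Fintype.card Ω • (S ^ 2 + 2 • U)) + (2 • ((∑ ω, X ω ^ 2) * x a ^ 2 +
        x a ^ 2 * (∑ ω, X ω ^ 2) + Fintype.card Ω • x a ^ 4) +
        4 • (∑ ω, X ω * x a ^ 2 * X ω + x a * (∑ ω, X ω ^ 2) * x a)) := by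
        gcongr
    _ ≤ 2 • (Fintype.card Ω • (S ^ 2 + 2 • U)) + (2 • ((∑ ω, X ω ^ 2) * x a ^ 2 +
        x a ^ 2 * (∑ ω, X ω ^ 2) + Fintype.card Ω • x a ^ 4) +
        4 • (∑ ω, X ω * x a ^ 2 * X ω + x a * (∑ ω, X ω ^ 2) * x a)) +
        4 • Fintype.card Ω • x a ^ 4 := by
        refine le_add_of_nonneg_right (nsmul_nonneg (nsmul_nonneg ?_ _) _)
        have := ((hx a).pow 2).mul_self_nonneg
        rwa [← pow_add] at this
    _ = _ := by
        rw [hsq, hxx]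
        simp only [smul_mul_assoc, mul_smul_comm, smul_add, add_smul, two_smul, mul_add,
          add_mul, show (4 : ℕ) = 2 + 2 from rfl, pow_succ, pow_zero, one_mul, mul_assoc]
        abel

lemma exists_signs {ι : Type*} (x : ι → A) (y : ι → B) (hx : ∀ i, IsSelfAdjoint (x i))
    (hy : ∀ i, IsSelfAdjoint (y i)) (s : Finset ι) :
    ∃ (Ω : Type) (_ : Fintype Ω) (_ : Nonempty Ω) (X : Ω → A) (Y : Ω → B),
      (∀ ω, IsSelfAdjoint (X ω)) ∧ (∀ ω, IsSelfAdjoint (Y ω)) ∧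
      (∀ V : A →ₗ[ℂ] B →ₗ[ℂ] ℂ,
        ∑ ω, V (X ω) (Y ω) = Fintype.card Ω • ∑ i ∈ s, V (x i) (y i)) ∧
      (∀ c, ∑ ω, X ω * c * X ω = Fintype.card Ω • ∑ i ∈ s, x i * c * x i) ∧
      (∀ c, ∑ ω, Y ω * c * Y ω = Fintype.card Ω • ∑ i ∈ s, y i * c * y i) ∧
      (∑ ω, X ω ^ 4 ≤ Fintype.card Ω • ((∑ i ∈ s, x i ^ 2) ^ 2 +
        2 • ∑ i ∈ s, x i * (∑ j ∈ s, x j ^ 2) * x i)) ∧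
      (∑ ω, Y ω ^ 4 ≤ Fintype.card Ω • ((∑ i ∈ s, y i ^ 2) ^ 2 +
        2 • ∑ i ∈ s, y i * (∑ j ∈ s, y j ^ 2) * y i)) := by
  classical
  induction s using Finset.induction_on with
  | empty =>
    refine ⟨Unit, inferInstance, inferInstance, fun _ => 0, fun _ => 0, ?_⟩
    simp [IsSelfAdjoint.zero]
  | insert a s ha ih =>
    obtain ⟨Ω, iF, iN, X, Y, hX, hY, hV, hXc, hYc, hX4, hY4⟩ := ih
    refine ⟨Ω ⊕ Ω, inferInstance, inferInstance, Sum.elim (fun ω => X ω + x a) fun ω => X ω - x a,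
      Sum.elim (fun ω => Y ω + y a) fun ω => Y ω - y a, ?_, ?_, ?_, ?_, ?_, ?_, ?_⟩
    · rintro (ω | ω)
      exacts [(hX ω).add (hx a), (hX ω).sub (hx a)]
    · rintro (ω | ω)
      exacts [(hY ω).add (hy a), (hY ω).sub (hy a)]
    · intro V
      simp only [Fintype.sum_sum_type, Sum.elim_inl, Sum.elim_inr, Fintype.card_sum,
        Finset.sum_insert ha]
      rw [← Finset.sum_add_distrib, add_smul, smul_add, ← hV]
      simp only [map_add, map_sub, LinearMap.add_apply, LinearMap.sub_apply]
      rw [show Fintype.card Ω • V (x a) (y a) = ∑ _ω : Ω, V (x a) (y a) by simp,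
        ← Finset.sum_add_distrib, ← Finset.sum_add_distrib]
      exact Finset.sum_congr rfl fun ω _ => by ring
    · intro c
      simp only [Fintype.sum_sum_type, Sum.elim_inl, Sum.elim_inr, Fintype.card_sum,
        Finset.sum_insert ha]
      rw [← Finset.sum_add_distrib, add_smul, smul_add, ← hXc]
      rw [show Fintype.card Ω • (x a * c * x a) = ∑ _ω : Ω, (x a * c * x a) by simp,
        ← Finset.sum_add_distrib, ← Finset.sum_add_distrib]
      exact Finset.sum_congr rfl fun ω _ => by noncomm_ring
    · intro c
      simp only [Fintype.sum_sum_type, Sum.elim_inl, Sum.elim_inr, Fintype.card_sum,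
        Finset.sum_insert ha]
      rw [← Finset.sum_add_distrib, add_smul, smul_add, ← hYc]
      rw [show Fintype.card Ω • (y a * c * y a) = ∑ _ω : Ω, (y a * c * y a) by simp,
        ← Finset.sum_add_distrib, ← Finset.sum_add_distrib]
      exact Finset.sum_congr rfl fun ω _ => by noncomm_ring
    · simp only [Fintype.sum_sum_type, Sum.elim_inl, Sum.elim_inr, Fintype.card_sum]
      exact sum_add_pow_four_le hx hX ha hXc hX4
    · simp only [Fintype.sum_sum_type, Sum.elim_inl, Sum.elim_inr, Fintype.card_sum]
      exact sum_add_pow_four_le hy hY ha hYc hY4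

end Grothendieck

section Grothendieck

variable {A B : Type*} [CStarAlgebra A] [PartialOrder A] [StarOrderedRing A]
  [CStarAlgebra B] [PartialOrder B] [StarOrderedRing B]

lemma pow_four_nonneg {h : A} (hh : IsSelfAdjoint h) : 0 ≤ h ^ 4 := by
  have := (hh.pow 2).mul_self_nonneg
  rwa [← pow_add] at this

/-- The truncation `min (p, c)` of a positive element. -/
noncomputable def truncate (c : ℝ) (p : A) : A := cfc (fun x : ℝ => min x c) p

lemma truncate_nonneg {c : ℝ} (hc : 0 ≤ c) {p : A} (hp : 0 ≤ p) : 0 ≤ truncate c p :=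
  cfc_nonneg fun _ hx => le_min (spectrum_nonneg_of_nonneg hp hx) hc

lemma truncate_le {c : ℝ} {p : A} (hp : 0 ≤ p) : truncate c p ≤ c • (1 : A) := by
  have : c • (1 : A) = cfc (fun _ : ℝ => c) p := by
    rw [cfc_const c p, Algebra.algebraMap_eq_smul_one]
  rw [this]
  exact cfc_mono fun x _ => min_le_right _ _

lemma truncate_eq {c : ℝ} {p : A} (hp : 0 ≤ p) (hc : ‖p‖ ≤ c) : truncate c p = p := by
  conv_rhs => rw [← cfc_id' ℝ p]
  refine cfc_congr fun x hx => min_eq_left ?_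
  rcases subsingleton_or_nontrivial A with h | h
  · rw [spectrum.of_subsingleton] at hx
    exact absurd hx (Set.notMem_empty x)
  exact (le_abs_self x).trans ((spectrum.norm_le_norm_of_mem hx).trans hc)

lemma norm_le_of_le_smul_one {p : A} (hp : 0 ≤ p) {c : ℝ} (hc : 0 ≤ c) (h : p ≤ c • (1 : A)) :
    ‖p‖ ≤ c := by
  rw [← Algebra.algebraMap_eq_smul_one] at h
  exact (CStarAlgebra.norm_le_iff_le_algebraMap p hc hp).2 h

lemma truncate_sq_le {c : ℝ} (hc : 0 ≤ c) {p : A} (hp : 0 ≤ p) : truncate c p ^ 2 ≤ p ^ 2 := by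
  have h2 : p ^ 2 = cfc (fun x : ℝ => x ^ 2) p := by rw [cfc_pow _ _ p, cfc_id' ℝ p]
  rw [h2, truncate, ← cfc_pow _ _ p]
  refine cfc_mono fun x hx => ?_
  have := spectrum_nonneg_of_nonneg hp hx
  exact pow_le_pow_left₀ (le_min this hc) (min_le_left _ _) 2

lemma truncate_sub_nonneg {c d : ℝ} (hcd : c ≤ d) {p : A} :
    0 ≤ truncate d p - truncate c p :=
  sub_nonneg.2 (cfc_mono fun _ _ => min_le_min_left _ hcd)

lemma truncate_sub_le {c : ℝ} (hc : 0 ≤ c) {p : A} (hp : 0 ≤ p) :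
    truncate (2 * c) p - truncate c p ≤ c • (1 : A) := by
  have : c • (1 : A) = cfc (fun _ : ℝ => c) p := by
    rw [cfc_const c p, Algebra.algebraMap_eq_smul_one]
  rw [this, truncate, truncate, ← cfc_sub _ _ p]
  refine cfc_mono fun x _ => ?_
  rcases le_total x c with h | h
  · rw [min_eq_left h, min_eq_left (by linarith)]; simpa using hc
  · rw [min_eq_right h]; linarith [min_le_right x (2 * c)]

lemma truncate_sub_le_pow {c : ℝ} (hc : 0 < c) {p : A} (hp : 0 ≤ p) :
    truncate (2 * c) p - truncate c p ≤ (1 / c ^ 3) • p ^ 4 := by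
  have : (1 / c ^ 3) • p ^ 4 = cfc (fun x : ℝ => (1 / c ^ 3) * x ^ 4) p := by
    rw [cfc_const_mul _ _ p, cfc_pow _ _ p, cfc_id' ℝ p]
  rw [this, truncate, truncate, ← cfc_sub _ _ p]
  refine cfc_mono fun x hx => ?_
  have hx0 := spectrum_nonneg_of_nonneg hp hx
  rcases le_total x c with h | h
  · rw [min_eq_left h, min_eq_left (by linarith), sub_self]; positivity
  · have h1 : x ≤ 1 / c ^ 3 * x ^ 4 := by
      rw [one_div, inv_mul_eq_div, le_div_iff₀ (by positivity)]
      have : c ^ 3 ≤ x ^ 3 := pow_le_pow_left₀ hc.le h 3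
      nlinarith
    rw [min_eq_right h]; linarith [min_le_left x (2 * c)]

namespace IsNormalizedForm

variable {V : A →ₗ[ℂ] B →ₗ[ℂ] ℂ}

lemma abs_im_layer_le (hV : IsNormalizedForm V) {p : A} {q : B} (hp : 0 ≤ p) (hq : 0 ≤ q)
    {c d : ℝ} (hc : 1 ≤ c) (hd0 : 0 ≤ d) (hd : d ≤ 2 * c) :
    |(V (truncate (2 * c) p - truncate c p) (truncate d q)).im| ≤
      (4 * (V (p ^ 4) 1).re + 3 / 2 * (V 1 (q ^ 2)).re) * (1 / c) := by
  have hc0 : 0 < c := by linarith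
  have h := hV.abs_im_le (P := c) (K := 2 * c ^ 2) hc0 (by positivity)
    (truncate_sub_nonneg (by linarith : c ≤ 2 * c)) (truncate_sub_le hc0.le hp)
    (IsSelfAdjoint.of_nonneg (truncate_nonneg hd0 hq))
    ((norm_le_of_le_smul_one (truncate_nonneg hd0 hq) hd0 (truncate_le hq)).trans (by nlinarith))
  have h1 := hV.re_mono (truncate_sub_le_pow hc0 hp)
  rw [map_real_smul, Complex.re_ofReal_mul] at h1
  have h2 := hV.re_mono_right (truncate_sq_le hd0 hq)
  refine h.trans ?_
  calc _ ≤ 2 * (2 * c ^ 2) * (1 / c ^ 3 * (V (p ^ 4) 1).re) +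
        3 * (c / (2 * c ^ 2)) * (V 1 (q ^ 2)).re := by gcongr
    _ = _ := by field_simp; ring

lemma abs_im_truncate_le (hV : IsNormalizedForm V) {p : A} {q : B} (hp : 0 ≤ p) (hq : 0 ≤ q)
    (n : ℕ) : |(V (truncate (2 ^ n) p) (truncate (2 ^ n) q)).im| ≤ 1 +
      (4 * ((V (p ^ 4) 1).re + (V 1 (q ^ 4)).re) + 3 / 2 * ((V (p ^ 2) 1).re + (V 1 (q ^ 2)).re)) *
        (2 - 2 * (1 / 2 ^ n)) := by
  induction n with
  | zero =>
    have h := hV.norm_le_mul (IsSelfAdjoint.of_nonneg (truncate_nonneg zero_le_one hp))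
      (IsSelfAdjoint.of_nonneg (truncate_nonneg zero_le_one hq))
    have h1 := norm_le_of_le_smul_one (truncate_nonneg zero_le_one hp) zero_le_one (truncate_le hp)
    have h2 := norm_le_of_le_smul_one (truncate_nonneg zero_le_one hq) zero_le_one (truncate_le hq)
    have h3 := mul_le_one₀ h1 (norm_nonneg _) h2
    simpa using (Complex.abs_im_le_norm _).trans (h.trans h3)
  | succ n ih =>
    have hc : (1 : ℝ) ≤ 2 ^ n := one_le_pow₀ one_le_two
    have h1 := hV.abs_im_layer_le hp hq (d := 2 * 2 ^ n) hc (by positivity) le_rfl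
    have h2 := hV.flip.abs_im_layer_le hq hp (d := 2 ^ n) hc (by positivity) (by linarith)
    simp only [LinearMap.flip_apply] at h2
    obtain ⟨p1, hp1⟩ : ∃ x, x = truncate (2 * 2 ^ n) p := ⟨_, rfl⟩
    obtain ⟨p0, hp0⟩ : ∃ x, x = truncate (2 ^ n) p := ⟨_, rfl⟩
    obtain ⟨q1, hq1⟩ : ∃ x, x = truncate (2 * 2 ^ n) q := ⟨_, rfl⟩
    obtain ⟨q0, hq0⟩ : ∃ x, x = truncate (2 ^ n) q := ⟨_, rfl⟩
    rw [pow_succ', ← hp1, ← hq1]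
    rw [← hp0, ← hq0] at ih
    rw [← hp0, ← hp1, ← hq1] at h1
    rw [← hp0, ← hq0, ← hq1] at h2
    have e : (V p1 q1).im = (V p0 q0).im + (V (p1 - p0) q1).im + (V p0 (q1 - q0)).im := by
      simp only [map_sub, LinearMap.sub_apply, Complex.sub_im]; ring
    rw [e]
    refine (abs_add_le _ _).trans ((add_le_add ((abs_add_le _ _).trans (add_le_add ih h1)) h2).trans
      (le_of_eq ?_))
    field_simp
    ring

lemma abs_im_le_of_nonneg (hV : IsNormalizedForm V) {p : A} {q : B} (hp : 0 ≤ p) (hq : 0 ≤ q) :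
    |(V p q).im| ≤ 1 + 8 * ((V (p ^ 4) 1).re + (V 1 (q ^ 4)).re) +
      3 * ((V (p ^ 2) 1).re + (V 1 (q ^ 2)).re) := by
  obtain ⟨n, hn⟩ := pow_unbounded_of_one_lt (max ‖p‖ ‖q‖) one_lt_two
  have h := hV.abs_im_truncate_le hp hq n
  rw [truncate_eq hp ((le_max_left _ _).trans hn.le),
    truncate_eq hq ((le_max_right _ _).trans hn.le)] at h
  have hA := IsSelfAdjoint.of_nonneg hp
  have hB := IsSelfAdjoint.of_nonneg hq
  have h1 := hV.re_nonneg (pow_four_nonneg hA)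
  have h2 := hV.flip.re_nonneg (pow_four_nonneg hB)
  have h3 := hV.re_nonneg (by simpa [pow_two] using hA.mul_self_nonneg : 0 ≤ p ^ 2)
  have h5 := hV.flip.re_nonneg (by simpa [pow_two] using hB.mul_self_nonneg : 0 ≤ q ^ 2)
  simp only [LinearMap.flip_apply] at h2 h5
  have h6 : (0 : ℝ) < 1 / 2 ^ n := by positivity
  nlinarith

end IsNormalizedForm

/-- A decomposition of a self-adjoint element into positive parts. -/
lemma exists_nonneg_sub {h : A} (hh : IsSelfAdjoint h) : ∃ p q : A, 0 ≤ p ∧ 0 ≤ q ∧ h = p - q ∧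
    p ^ 2 ≤ h ^ 2 ∧ q ^ 2 ≤ h ^ 2 ∧ p ^ 4 ≤ h ^ 4 ∧ q ^ 4 ≤ h ^ 4 := by
  have hpow : ∀ n : ℕ, h ^ n = cfc (fun x : ℝ => x ^ n) h := by
    intro n; rw [cfc_pow _ _ h, cfc_id' ℝ h]
  have h1 : ∀ (n : ℕ), Even n → cfc (fun x : ℝ => max x 0) h ^ n ≤ h ^ n := by
    intro n hn
    rw [hpow n, ← cfc_pow _ _ h]
    refine cfc_mono fun x _ => ?_
    rw [← hn.pow_abs x]
    exact pow_le_pow_left₀ (le_max_right _ _) (max_le (le_abs_self x) (abs_nonneg x)) n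
  have h2 : ∀ (n : ℕ), Even n → cfc (fun x : ℝ => max (-x) 0) h ^ n ≤ h ^ n := by
    intro n hn
    rw [hpow n, ← cfc_pow _ _ h]
    refine cfc_mono fun x _ => ?_
    rw [← hn.pow_abs x]
    exact pow_le_pow_left₀ (le_max_right _ _) (max_le (neg_le_abs x) (abs_nonneg x)) n
  refine ⟨cfc (fun x : ℝ => max x 0) h, cfc (fun x : ℝ => max (-x) 0) h,
    cfc_nonneg fun _ _ => le_max_right _ _, cfc_nonneg fun _ _ => le_max_right _ _, ?_,
    h1 2 even_two, h2 2 even_two, h1 4 (by decide), h2 4 (by decide)⟩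
  rw [← cfc_sub _ _ h]
  conv_lhs => rw [← cfc_id' ℝ h]
  refine cfc_congr fun x _ => ?_
  rcases le_total 0 x with hx | hx
  · simp [max_eq_left hx, max_eq_right (neg_nonpos.2 hx)]
  · simp [max_eq_right hx, max_eq_left (neg_nonneg.2 hx)]

namespace IsNormalizedForm

variable {V : A →ₗ[ℂ] B →ₗ[ℂ] ℂ}

lemma abs_im_le_of_isSelfAdjoint (hV : IsNormalizedForm V) {h : A} {k : B} (hh : IsSelfAdjoint h)
    (hk : IsSelfAdjoint k) :
    |(V h k).im| ≤ 4 * (1 + 8 * ((V (h ^ 4) 1).re + (V 1 (k ^ 4)).re) +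
      3 * ((V (h ^ 2) 1).re + (V 1 (k ^ 2)).re)) := by
  obtain ⟨p, q, hp, hq, rfl, p2, q2, p4, q4⟩ := exists_nonneg_sub hh
  obtain ⟨r, s, hr, hs, rfl, r2, s2, r4, s4⟩ := exists_nonneg_sub hk
  have a1 := hV.re_mono p2
  have a2 := hV.re_mono q2
  have a3 := hV.re_mono p4
  have a4 := hV.re_mono q4
  have b1 := hV.re_mono_right r2
  have b2 := hV.re_mono_right s2
  have b3 := hV.re_mono_right r4
  have b4 := hV.re_mono_right s4
  have c1 := hV.abs_im_le_of_nonneg hp hr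
  have c2 := hV.abs_im_le_of_nonneg hp hs
  have c3 := hV.abs_im_le_of_nonneg hq hr
  have c4 := hV.abs_im_le_of_nonneg hq hs
  have e : (V (p - q) (r - s)).im =
      ((V p r).im - (V p s).im) - ((V q r).im - (V q s).im) := by
    simp only [map_sub, LinearMap.sub_apply, Complex.sub_im]; ring
  rw [e]
  refine (abs_sub _ _).trans ?_
  have d1 := abs_sub (V p r).im (V p s).im
  have d2 := abs_sub (V q r).im (V q s).im
  linarith

end IsNormalizedForm

end Grothendieck

section Grothendieck

open ComplexStarModule

variable {A B : Type*} [CStarAlgebra A] [PartialOrder A] [StarOrderedRing A]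
  [CStarAlgebra B] [PartialOrder B] [StarOrderedRing B]

lemma sum_pow_two_pow_two_add_le {ι : Type*} {x : ι → A} (hx : ∀ i, IsSelfAdjoint (x i))
    {s : Finset ι} (h : ∑ i ∈ s, x i ^ 2 ≤ 1) :
    (∑ i ∈ s, x i ^ 2) ^ 2 + 2 • ∑ i ∈ s, x i * (∑ j ∈ s, x j ^ 2) * x i ≤ 3 • (1 : A) := by
  have h0 : 0 ≤ ∑ i ∈ s, x i ^ 2 :=
    Finset.sum_nonneg fun i _ => by simpa [pow_two] using (hx i).mul_self_nonneg
  have h2 : ∑ i ∈ s, x i * (∑ j ∈ s, x j ^ 2) * x i ≤ ∑ i ∈ s, x i ^ 2 := by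
    refine Finset.sum_le_sum fun i _ => ?_
    have := star_left_conjugate_le_conjugate h (x i)
    rwa [(hx i).star_eq, mul_one, ← pow_two] at this
  calc _ ≤ (1 : A) + 2 • (1 : A) :=
        add_le_add ((sq_le_self_of_le_one h0 h).trans h) (nsmul_le_nsmul_right (h2.trans h) 2)
    _ = 3 • (1 : A) := by abel

namespace IsNormalizedForm

variable {V : A →ₗ[ℂ] B →ₗ[ℂ] ℂ}

lemma sum_re_le (hV : IsNormalizedForm V) {ι : Type*} (s : Finset ι) (x : ι → A) (n : ℕ)
    (m : ℕ) (h : ∑ i ∈ s, x i ≤ n • (m • (1 : A))) : ∑ i ∈ s, (V (x i) 1).re ≤ n * m := by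
  have := hV.re_mono h
  rw [smul_smul, map_sum, LinearMap.sum_apply, map_nsmul, LinearMap.smul_apply, hV.map_one,
    Complex.re_sum] at this
  simpa using this

lemma abs_sum_im_le (hV : IsNormalizedForm V) {ι : Type*} (s : Finset ι) (x : ι → A) (y : ι → B)
    (hx : ∀ i, IsSelfAdjoint (x i)) (hy : ∀ i, IsSelfAdjoint (y i))
    (hx1 : ∑ i ∈ s, x i ^ 2 ≤ 1) (hy1 : ∑ i ∈ s, y i ^ 2 ≤ 1) :
    |∑ i ∈ s, (V (x i) (y i)).im| ≤ 220 := by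
  obtain ⟨Ω, _, _, X, Y, hX, hY, hXY, hXc, hYc, hX4, hY4⟩ := exists_signs x y hx hy s
  have hN : (0 : ℝ) < Fintype.card Ω := by exact_mod_cast Fintype.card_pos
  have X2 : ∑ ω, (V (X ω ^ 2) 1).re ≤ Fintype.card Ω * (1 : ℕ) := by
    refine hV.sum_re_le _ _ _ _ ?_
    have := hXc 1
    simp only [mul_one, ← pow_two] at this
    rw [this, one_smul]
    exact nsmul_le_nsmul_right hx1 _
  have Y2 : ∑ ω, (V.flip (Y ω ^ 2) 1).re ≤ Fintype.card Ω * (1 : ℕ) := by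
    refine hV.flip.sum_re_le _ _ _ _ ?_
    have := hYc 1
    simp only [mul_one, ← pow_two] at this
    rw [this, one_smul]
    exact nsmul_le_nsmul_right hy1 _
  have X4 : ∑ ω, (V (X ω ^ 4) 1).re ≤ Fintype.card Ω * (3 : ℕ) :=
    hV.sum_re_le _ _ _ _ (hX4.trans (nsmul_le_nsmul_right (sum_pow_two_pow_two_add_le hx hx1) _))
  have Y4 : ∑ ω, (V.flip (Y ω ^ 4) 1).re ≤ Fintype.card Ω * (3 : ℕ) :=
    hV.flip.sum_re_le _ _ _ _
      (hY4.trans (nsmul_le_nsmul_right (sum_pow_two_pow_two_add_le hy hy1) _))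
  simp only [LinearMap.flip_apply] at Y2 Y4
  have h1 := congrArg Complex.im (hXY V)
  rw [Complex.im_sum, nsmul_eq_mul, ← Complex.ofReal_natCast, Complex.im_ofReal_mul,
    Complex.im_sum] at h1
  have h2 : |∑ ω, (V (X ω) (Y ω)).im| ≤ ∑ ω, 4 * (1 + 8 * ((V (X ω ^ 4) 1).re +
      (V 1 (Y ω ^ 4)).re) + 3 * ((V (X ω ^ 2) 1).re + (V 1 (Y ω ^ 2)).re)) :=
    (Finset.abs_sum_le_sum_abs _ _).trans
      (Finset.sum_le_sum fun ω _ => hV.abs_im_le_of_isSelfAdjoint (hX ω) (hY ω))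
  rw [h1, abs_mul, abs_of_pos hN] at h2
  simp only [← Finset.mul_sum, Finset.sum_add_distrib, Finset.sum_const, Finset.card_univ,
    nsmul_eq_mul, mul_one] at h2
  refine le_of_mul_le_mul_left (h2.trans ?_) hN
  push_cast at X2 Y2 X4 Y4
  linarith

lemma abs_sum_re_le (hV : IsNormalizedForm V) {ι : Type*} (s : Finset ι) (x : ι → A) (y : ι → B)
    (hx : ∀ i, IsSelfAdjoint (x i)) (hy : ∀ i, IsSelfAdjoint (y i))
    (hx1 : ∑ i ∈ s, x i ^ 2 ≤ 1) (hy1 : ∑ i ∈ s, y i ^ 2 ≤ 1) :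
    |∑ i ∈ s, (V (x i) (y i)).re| ≤ 2 := by
  have h1 := hV.sum_re_le s (fun i => x i ^ 2) 1 1 (by simpa using hx1)
  have h2 := hV.flip.sum_re_le s (fun i => y i ^ 2) 1 1 (by simpa using hy1)
  have h3 := (Finset.abs_sum_le_sum_abs (fun i => (V (x i) (y i)).re) s).trans
    (Finset.sum_le_sum fun i _ => hV.abs_re_le (hx i) (hy i))
  rw [Finset.sum_add_distrib] at h3
  simp only [LinearMap.flip_apply, Nat.cast_one, mul_one] at h1 h2
  linarith

lemma norm_sum_le_of_isSelfAdjoint (hV : IsNormalizedForm V) {ι : Type*} (s : Finset ι)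
    (x : ι → A) (y : ι → B) (hx : ∀ i, IsSelfAdjoint (x i)) (hy : ∀ i, IsSelfAdjoint (y i))
    (hx1 : ∑ i ∈ s, x i ^ 2 ≤ 1) (hy1 : ∑ i ∈ s, y i ^ 2 ≤ 1) :
    ‖∑ i ∈ s, V (x i) (y i)‖ ≤ 222 := by
  have h1 := hV.abs_sum_im_le s x y hx hy hx1 hy1
  have h2 := hV.abs_sum_re_le s x y hx hy hx1 hy1
  rw [← Complex.im_sum] at h1
  rw [← Complex.re_sum] at h2
  exact (Complex.norm_le_abs_re_add_abs_im _).trans (by linarith)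

end IsNormalizedForm

lemma exists_isSelfAdjoint_parts {ι : Type*} (s : Finset ι) (x : ι → A)
    (h1 : ∑ i ∈ s, star (x i) * x i ≤ 1) (h2 : ∑ i ∈ s, x i * star (x i) ≤ 1) :
    ∃ h k : ι → A, (∀ i, IsSelfAdjoint (h i)) ∧ (∀ i, IsSelfAdjoint (k i)) ∧
      (∀ i, x i = h i + Complex.I • k i) ∧ ∑ i ∈ s, h i ^ 2 ≤ 1 ∧ ∑ i ∈ s, k i ^ 2 ≤ 1 := by
  have hh : ∀ i, IsSelfAdjoint (ℜ (x i) : A) := fun i => (ℜ (x i)).2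
  have hk : ∀ i, IsSelfAdjoint (ℑ (x i) : A) := fun i => (ℑ (x i)).2
  have key : ∀ i, 2 • ((ℜ (x i) : A) ^ 2 + (ℑ (x i) : A) ^ 2) =
      star (x i) * x i + x i * star (x i) := by
    intro i
    conv_rhs => rw [← realPart_add_I_smul_imaginaryPart (x i)]
    simp only [star_add, star_smul, (hh i).star_eq, (hk i).star_eq, RCLike.star_def,
      Complex.conj_I, add_mul, mul_add, smul_mul_assoc, mul_smul_comm, smul_smul,
      neg_smul, smul_neg, neg_mul, mul_neg, Complex.I_mul_I, neg_neg, one_smul, pow_two, smul_add,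
      two_smul]
    abel
  have hsum : ∑ i ∈ s, (ℜ (x i) : A) ^ 2 + ∑ i ∈ s, (ℑ (x i) : A) ^ 2 ≤ 1 := by
    have : (2 : ℝ) • (∑ i ∈ s, (ℜ (x i) : A) ^ 2 + ∑ i ∈ s, (ℑ (x i) : A) ^ 2) ≤
        (2 : ℝ) • (1 : A) := by
      rw [two_smul, two_smul, ← two_nsmul, ← Finset.sum_add_distrib, Finset.smul_sum,
        Finset.sum_congr rfl fun i _ => key i, Finset.sum_add_distrib]
      exact add_le_add h1 h2
    exact le_of_smul_le_smul_of_pos_left this two_pos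
  have p1 : 0 ≤ ∑ i ∈ s, (ℜ (x i) : A) ^ 2 :=
    Finset.sum_nonneg fun i _ => by simpa [pow_two] using (hh i).mul_self_nonneg
  have p2 : 0 ≤ ∑ i ∈ s, (ℑ (x i) : A) ^ 2 :=
    Finset.sum_nonneg fun i _ => by simpa [pow_two] using (hk i).mul_self_nonneg
  exact ⟨fun i => ℜ (x i), fun i => ℑ (x i), hh, hk,
    fun i => (realPart_add_I_smul_imaginaryPart (x i)).symm,
    (le_add_of_nonneg_right p2).trans hsum, (le_add_of_nonneg_left p1).trans hsum⟩

lemma IsNormalizedForm.norm_sum_le {V : A →ₗ[ℂ] B →ₗ[ℂ] ℂ} (hV : IsNormalizedForm V)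
    {ι : Type*} (s : Finset ι) (x : ι → A) (y : ι → B)
    (hx1 : ∑ i ∈ s, star (x i) * x i ≤ 1) (hx2 : ∑ i ∈ s, x i * star (x i) ≤ 1)
    (hy1 : ∑ i ∈ s, star (y i) * y i ≤ 1) (hy2 : ∑ i ∈ s, y i * star (y i) ≤ 1) :
    ‖∑ i ∈ s, V (x i) (y i)‖ ≤ 888 := by
  obtain ⟨h, k, hh, hk, hx, h1, k1⟩ := exists_isSelfAdjoint_parts s x hx1 hx2
  obtain ⟨f, g, hf, hg, hy, f1, g1⟩ := exists_isSelfAdjoint_parts s y hy1 hy2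
  have e : ∑ i ∈ s, V (x i) (y i) = (∑ i ∈ s, V (h i) (f i) - ∑ i ∈ s, V (k i) (g i)) +
      Complex.I * (∑ i ∈ s, V (h i) (g i) + ∑ i ∈ s, V (k i) (f i)) := by
    rw [← Finset.sum_sub_distrib, ← Finset.sum_add_distrib, Finset.mul_sum,
      ← Finset.sum_add_distrib]
    refine Finset.sum_congr rfl fun i _ => ?_
    rw [hx i, hy i]
    simp only [map_add, map_smul, LinearMap.add_apply, LinearMap.smul_apply, smul_eq_mul]
    linear_combination V (k i) (g i) * Complex.I_mul_I
  have e1 := hV.norm_sum_le_of_isSelfAdjoint s h f hh hf h1 f1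
  have e2 := hV.norm_sum_le_of_isSelfAdjoint s k g hk hg k1 g1
  have e3 := hV.norm_sum_le_of_isSelfAdjoint s h g hh hg h1 g1
  have e4 := hV.norm_sum_le_of_isSelfAdjoint s k f hk hf k1 f1
  rw [e]
  refine (norm_add_le _ _).trans ?_
  rw [norm_mul, Complex.norm_I, one_mul]
  have := norm_sub_le (∑ i ∈ s, V (h i) (f i)) (∑ i ∈ s, V (k i) (g i))
  have := norm_add_le (∑ i ∈ s, V (h i) (g i)) (∑ i ∈ s, V (k i) (f i))
  linarith

end Grothendieck

section UltrafilterLimit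

open Filter Topology

/-- The limit along the hyperfilter on `ℕ` of a bounded sequence of complex numbers. -/
lemma exists_tendsto_hyperfilter {f : ℕ → ℂ} {C : ℝ} (h : ∀ n, ‖f n‖ ≤ C) :
    Tendsto f (hyperfilter ℕ) (𝓝 (limUnder (hyperfilter ℕ : Filter ℕ) f)) := by
  refine tendsto_nhds_limUnder ?_
  have hK := isCompact_closedBall (0 : ℂ) C
  have := hK.ultrafilter_le_nhds' ((hyperfilter ℕ).map f) (by
    rw [Ultrafilter.mem_map]
    exact Filter.univ_mem' fun n => by simpa using h n)
  obtain ⟨x, _, hx⟩ := this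
  exact ⟨x, hx⟩

open BoundedContinuousFunction in
lemma exists_ultraproduct_form {A B : Type*} [CStarAlgebra A] [CStarAlgebra B]
    (W : ℕ → A →L[ℂ] B →L[ℂ] ℂ) {C : ℝ} (hW : ∀ n, ‖W n‖ ≤ C) :
    ∃ V : (ℕ →ᵇ A) →ₗ[ℂ] (ℕ →ᵇ B) →ₗ[ℂ] ℂ, ∀ a b,
      Tendsto (fun n => W n (a n) (b n)) (hyperfilter ℕ) (𝓝 (V a b)) := by
  have key : ∀ (a : ℕ →ᵇ A) (b : ℕ →ᵇ B), Tendsto (fun n => W n (a n) (b n)) (hyperfilter ℕ)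
      (𝓝 (limUnder (hyperfilter ℕ : Filter ℕ) fun n => W n (a n) (b n))) := by
    intro a b
    refine exists_tendsto_hyperfilter (C := C * ‖a‖ * ‖b‖) fun n => ?_
    exact (W n).le_of_opNorm₂_le_of_le (hW n) (a.norm_coe_le_norm n) (b.norm_coe_le_norm n)
  refine ⟨LinearMap.mk₂ ℂ (fun a b => limUnder (hyperfilter ℕ : Filter ℕ) fun n => W n (a n) (b n))
    ?_ ?_ ?_ ?_, key⟩
  · intro a a' b
    refine tendsto_nhds_unique (key _ _) ?_
    simpa using (key a b).add (key a' b)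
  · intro c a b
    refine tendsto_nhds_unique (key _ _) ?_
    simpa using (key a b).const_mul c
  · intro a b b'
    refine tendsto_nhds_unique (key _ _) ?_
    simpa using (key a b).add (key a b')
  · intro c a b
    refine tendsto_nhds_unique (key _ _) ?_
    simpa using (key a b).const_mul c

end UltrafilterLimit

section GrothendieckInequality

open Filter Topology BoundedContinuousFunction

lemma exists_star_unitary_mul {D : Type*} [CStarAlgebra D] [PartialOrder (ℕ →ᵇ D)]
    [StarOrderedRing (ℕ →ᵇ D)] {ι : Type} (s : Finset ι) (u : ℕ → unitary D) (x : ι → D)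
    (h1 : ‖∑ i ∈ s, star (x i) * x i‖ ≤ 1) (h2 : ‖∑ i ∈ s, x i * star (x i)‖ ≤ 1) :
    ∃ X : ι → (ℕ →ᵇ D), (∀ i n, X i n = star (u n : D) * x i) ∧
      ∑ i ∈ s, star (X i) * X i ≤ 1 ∧ ∑ i ∈ s, X i * star (X i) ≤ 1 := by
  have hb : ∀ i n, ‖star (u n : D) * x i‖ ≤ ‖x i‖ := fun i n => by
    rw [← Unitary.coe_star, CStarRing.norm_coe_unitary_mul]
  refine ⟨fun i => ofNormedAddCommGroup (fun n => star (u n : D) * x i)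
    continuous_of_discreteTopology ‖x i‖ (hb i), fun i n => rfl, ?_, ?_⟩
  · rw [← CStarAlgebra.norm_le_one_iff_of_nonneg _
      (Finset.sum_nonneg fun i _ => star_mul_self_nonneg _),
      BoundedContinuousFunction.norm_le zero_le_one]
    intro n
    rw [BoundedContinuousFunction.coe_sum, Finset.sum_apply]
    refine le_trans (le_of_eq ?_) h1
    congr 1
    refine Finset.sum_congr rfl fun i _ => ?_
    simp only [coe_mul, Pi.mul_apply, star_apply, coe_ofNormedAddCommGroup, star_mul, star_star]
    rw [mul_assoc, ← mul_assoc (u n : D), Unitary.mul_star_self_of_mem (u n).2, one_mul]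
  · rw [← CStarAlgebra.norm_le_one_iff_of_nonneg _
      (Finset.sum_nonneg fun i _ => mul_star_self_nonneg _),
      BoundedContinuousFunction.norm_le zero_le_one]
    intro n
    rw [BoundedContinuousFunction.coe_sum, Finset.sum_apply]
    have : ∑ i ∈ s, (ofNormedAddCommGroup (fun n => star (u n : D) * x i)
        continuous_of_discreteTopology ‖x i‖ (hb i) * star (ofNormedAddCommGroup
        (fun n => star (u n : D) * x i) continuous_of_discreteTopology ‖x i‖ (hb i))) n =
        (star (u n) : unitary D) * (∑ i ∈ s, x i * star (x i)) * (u n : D) := by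
      rw [Finset.mul_sum, Finset.sum_mul]
      refine Finset.sum_congr rfl fun i _ => ?_
      simp only [coe_mul, Pi.mul_apply, star_apply, coe_ofNormedAddCommGroup, star_mul, star_star,
        Unitary.coe_star, mul_assoc]
    rw [this, CStarRing.norm_mul_coe_unitary, CStarRing.norm_coe_unitary_mul]
    exact h2

lemma grothendieck_unital {A B : Type*} [CStarAlgebra A] [CStarAlgebra B]
    (Φ : A →L[ℂ] B →L[ℂ] ℂ) : ∃ C : ℝ, 0 ≤ C ∧ ∀ {ι : Type} (s : Finset ι) (x : ι → A) (y : ι → B),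
      ‖∑ i ∈ s, star (x i) * x i‖ ≤ 1 → ‖∑ i ∈ s, x i * star (x i)‖ ≤ 1 →
      ‖∑ i ∈ s, star (y i) * y i‖ ≤ 1 → ‖∑ i ∈ s, y i * star (y i)‖ ≤ 1 →
      ‖∑ i ∈ s, Φ (x i) (y i)‖ ≤ C := by
  rcases subsingleton_or_nontrivial A with hA | hA
  · exact ⟨0, le_rfl, fun s x y _ _ _ _ => by simp [Subsingleton.elim (x _) 0]⟩
  rcases subsingleton_or_nontrivial B with hB | hB
  · exact ⟨0, le_rfl, fun s x y _ _ _ _ => by simp [Subsingleton.elim (y _) 0]⟩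
  obtain ⟨t, ht⟩ : ∃ t, t = ⨆ p : unitary A × unitary B, ‖Φ p.1 p.2‖ := ⟨_, rfl⟩
  have hbdd : BddAbove (Set.range fun p : unitary A × unitary B => ‖Φ p.1 p.2‖) := by
    refine ⟨‖Φ‖ * 1 * 1, ?_⟩
    rintro _ ⟨p, rfl⟩
    exact Φ.le_of_opNorm₂_le_of_le le_rfl (CStarRing.norm_coe_unitary p.1).le
      (CStarRing.norm_coe_unitary p.2).le
  have hle : ∀ u ∈ unitary A, ∀ v ∈ unitary B, ‖Φ u v‖ ≤ t := fun u hu v hv =>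
    ht ▸ le_ciSup hbdd (⟨⟨u, hu⟩, ⟨v, hv⟩⟩ : unitary A × unitary B)
  have ht0 : 0 ≤ t := (norm_nonneg _).trans (hle 1 (one_mem _) 1 (one_mem _))
  rcases ht0.eq_or_lt with h0 | hpos
  · have hz : ∀ a b, Φ a b = 0 := by
      intro a b
      have h1 : ∀ u ∈ unitary A, Φ u b = 0 := by
        intro u hu
        have : b ∈ Submodule.span ℂ (unitary B : Set B) := by
          rw [CStarAlgebra.span_unitary]; trivial
        induction this using Submodule.span_induction with
        | mem v hv => simpa [← h0] using hle u hu v hv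
        | zero => simp
        | add x y _ _ hx hy => rw [map_add, hx, hy, add_zero]
        | smul c x _ hx => rw [map_smul, hx, smul_zero]
      have : a ∈ Submodule.span ℂ (unitary A : Set A) := by
        rw [CStarAlgebra.span_unitary]; trivial
      induction this using Submodule.span_induction with
      | mem v hv => exact h1 v hv
      | zero => simp
      | add x y _ _ hx hy => simp [hx, hy]
      | smul c x _ hx => simp [hx]
    exact ⟨0, le_rfl, fun s x y _ _ _ _ => by simp [hz]⟩
  have hex : ∀ n : ℕ, ∃ p : unitary A × unitary B, t * (1 - 1 / ((n : ℝ) + 2)) < ‖Φ p.1 p.2‖ := by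
    intro n
    refine exists_lt_of_lt_ciSup (ht ▸ ?_)
    have : 0 < 1 / ((n : ℝ) + 2) := by positivity
    nlinarith
  choose p hp using hex
  have hppos : ∀ n, 0 < ‖Φ (p n).1 (p n).2‖ := by
    intro n
    refine lt_of_le_of_lt (mul_nonneg hpos.le ?_) (hp n)
    have : 1 / ((n : ℝ) + 2) ≤ 1 := by
      rw [div_le_one (by positivity)]; linarith [(Nat.cast_nonneg n : (0 : ℝ) ≤ n)]
    linarith
  obtain ⟨c, hc⟩ : ∃ c : ℕ → ℂ, c = fun n =>
    (‖Φ (p n).1 (p n).2‖ : ℂ) / (Φ (p n).1 (p n).2 * t) := ⟨_, rfl⟩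
  have hcn : ∀ n, ‖c n‖ = 1 / t := by
    intro n
    rw [hc, norm_div, norm_mul, Complex.norm_real, norm_norm, Complex.norm_real,
      Real.norm_of_nonneg hpos.le]
    have := (hppos n).ne'
    field_simp
  let W : ℕ → A →L[ℂ] B →L[ℂ] ℂ := fun n => c n •
    Φ.bilinearComp (ContinuousLinearMap.mul ℂ A (p n).1) (ContinuousLinearMap.mul ℂ B (p n).2)
  have hWapp : ∀ n a b, W n a b = c n * Φ ((p n).1 * a) ((p n).2 * b) := fun n a b => rfl
  have hW : ∀ n, ‖W n‖ ≤ 1 / t * ‖Φ‖ := by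
    intro n
    refine ContinuousLinearMap.opNorm_le_bound₂ _ (by positivity) fun a b => ?_
    rw [hWapp, norm_mul, hcn, mul_assoc, mul_assoc]
    refine mul_le_mul_of_nonneg_left ?_ (by positivity)
    refine (Φ.le_opNorm₂ _ _).trans ?_
    rw [CStarRing.norm_coe_unitary_mul, CStarRing.norm_coe_unitary_mul, mul_assoc]
  obtain ⟨V, hV⟩ := exists_ultraproduct_form W hW
  have hVn : IsNormalizedForm V := by
    constructor
    · intro u hu v hv
      refine le_of_tendsto (hV u v).norm (Filter.Eventually.of_forall fun n => ?_)
      have hu' : (u n) ∈ unitary A := by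
        rw [Unitary.mem_iff] at hu ⊢
        exact ⟨congrArg (fun f : ℕ →ᵇ A => f n) hu.1, congrArg (fun f : ℕ →ᵇ A => f n) hu.2⟩
      have hv' : (v n) ∈ unitary B := by
        rw [Unitary.mem_iff] at hv ⊢
        exact ⟨congrArg (fun f : ℕ →ᵇ B => f n) hv.1, congrArg (fun f : ℕ →ᵇ B => f n) hv.2⟩
      rw [hWapp, norm_mul, hcn, one_div, inv_mul_le_iff₀ hpos, mul_one]
      exact hle _ (mul_mem (p n).1.2 hu') _ (mul_mem (p n).2.2 hv')
    · refine tendsto_nhds_unique (hV 1 1) ?_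
      have e : ∀ n, W n ((1 : ℕ →ᵇ A) n) ((1 : ℕ →ᵇ B) n) =
          ((‖Φ (p n).1 (p n).2‖ / t : ℝ) : ℂ) := by
        intro n
        have h1 : Φ (p n).1 (p n).2 ≠ 0 := norm_pos_iff.1 (hppos n)
        have h2 : (t : ℂ) ≠ 0 := by exact_mod_cast hpos.ne'
        rw [hWapp, hc]
        simp only [coe_one, Pi.one_apply, mul_one]
        push_cast
        field_simp
      simp_rw [e]
      rw [← Complex.ofReal_one]
      refine (Complex.continuous_ofReal.tendsto _).comp ?_
      refine Tendsto.mono_left ?_ Nat.hyperfilter_le_atTop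
      have hl : Tendsto (fun n : ℕ => 1 - 1 / ((n : ℝ) + 2)) atTop (𝓝 1) := by
        have h3 := (tendsto_one_div_add_atTop_nhds_zero_nat (𝕜 := ℝ)).comp (tendsto_add_atTop_nat 1)
        have h4 := h3.const_sub 1
        rw [sub_zero] at h4
        refine h4.congr fun n => ?_
        simp only [Function.comp]; push_cast; ring
      refine tendsto_of_tendsto_of_tendsto_of_le_of_le hl tendsto_const_nhds (fun n => ?_)
        fun n => ?_
      · simp only
        rw [le_div_iff₀ hpos]; linarith [hp n]
      · simp only
        rw [div_le_one hpos]; exact hle _ (p n).1.2 _ (p n).2.2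
  refine ⟨888 * t, by positivity, fun {ι} s x y h1 h2 h3 h4 => ?_⟩
  let _ := CStarAlgebra.spectralOrder (ℕ →ᵇ A)
  have := CStarAlgebra.spectralOrderedRing (ℕ →ᵇ A)
  let _ := CStarAlgebra.spectralOrder (ℕ →ᵇ B)
  have := CStarAlgebra.spectralOrderedRing (ℕ →ᵇ B)
  obtain ⟨X, hX, X1, X2⟩ := exists_star_unitary_mul s (fun n => (p n).1) x h1 h2
  obtain ⟨Y, hY, Y1, Y2⟩ := exists_star_unitary_mul s (fun n => (p n).2) y h3 h4
  have hb := hVn.norm_sum_le s X Y X1 X2 Y1 Y2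
  have hlim : Tendsto (fun n => ‖∑ i ∈ s, W n (X i n) (Y i n)‖) (hyperfilter ℕ)
      (𝓝 ‖∑ i ∈ s, V (X i) (Y i)‖) := (tendsto_finsetSum s fun i _ => hV (X i) (Y i)).norm
  have e : ∀ n, ‖∑ i ∈ s, W n (X i n) (Y i n)‖ = 1 / t * ‖∑ i ∈ s, Φ (x i) (y i)‖ := by
    intro n
    rw [← hcn n, ← norm_mul, Finset.mul_sum]
    congr 1
    refine Finset.sum_congr rfl fun i _ => ?_
    rw [hWapp, hX, hY, ← mul_assoc, ← mul_assoc, Unitary.mul_star_self_of_mem (p n).1.2,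
      Unitary.mul_star_self_of_mem (p n).2.2, one_mul, one_mul]
  simp_rw [e] at hlim
  rw [tendsto_nhds_unique hlim tendsto_const_nhds, one_div, inv_mul_le_iff₀ hpos] at hb
  linarith

lemma norm_sum_inr_mul {D : Type*} [NonUnitalCStarAlgebra D] {ι : Type*} (s : Finset ι)
    (u v : ι → D) : ‖∑ i ∈ s, (u i : Unitization ℂ D) * v i‖ = ‖∑ i ∈ s, u i * v i‖ := by
  rw [← Unitization.norm_inr (𝕜 := ℂ) (∑ i ∈ s, u i * v i)]
  congr 1
  have := map_sum (Unitization.inrNonUnitalStarAlgHom ℂ D) (fun i => u i * v i) s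
  simp only [map_mul] at this
  exact this.symm

/-- A noncommutative Grothendieck inequality, without an explicit constant. -/
theorem grothendieck_inequality {A B : Type*} [NonUnitalCStarAlgebra A] [NonUnitalCStarAlgebra B]
    (Φ : A →L[ℂ] B →L[ℂ] ℂ) : ∃ C : ℝ, 0 ≤ C ∧ ∀ {ι : Type} (s : Finset ι) (x : ι → A) (y : ι → B),
      ‖∑ i ∈ s, star (x i) * x i‖ ≤ 1 → ‖∑ i ∈ s, x i * star (x i)‖ ≤ 1 →
      ‖∑ i ∈ s, star (y i) * y i‖ ≤ 1 → ‖∑ i ∈ s, y i * star (y i)‖ ≤ 1 →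
      ‖∑ i ∈ s, Φ (x i) (y i)‖ ≤ C := by
  let pA : Unitization ℂ A →L[ℂ] A := ⟨Unitization.sndHom ℂ ℂ A, Unitization.continuous_snd⟩
  let pB : Unitization ℂ B →L[ℂ] B := ⟨Unitization.sndHom ℂ ℂ B, Unitization.continuous_snd⟩
  obtain ⟨C, hC, h⟩ := grothendieck_unital (Φ.bilinearComp pA pB)
  refine ⟨C, hC, fun s x y h1 h2 h3 h4 => ?_⟩
  rw [← norm_sum_inr_mul] at h1 h2 h3 h4
  simp only [Unitization.inr_star] at h1 h2 h3 h4
  exact h s (fun i => (x i : Unitization ℂ A)) (fun i => (y i : Unitization ℂ B)) h1 h2 h3 h4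

end GrothendieckInequality

section ApproximationProperty

open scoped ComplexConjugate InnerProductSpace ComplexOrder MatrixOrder
open Filter Topology

/-- The matrix of the orthogonal projection of `ℓ²` onto a closed subspace. -/
lemma exists_projection_matrix {ι : Type*} (W : Submodule ℂ (lp (fun _ : ι => ℂ) 2)) :
    ∃ p : ι → ι → ℂ, (∀ i j, p i j = conj (p j i)) ∧ (∀ i, Summable fun j => ‖p i j‖ ^ 2) ∧
      (∀ v ∈ W, ∀ i, HasSum (fun j => p i j * v j) (v i)) ∧
      (∀ v ∈ Wᗮ, ∀ i, HasSum (fun j => p i j * v j) 0) ∧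
      ∀ (s t : Finset ι) (v : ι → ℂ),
        ∑ i ∈ s, ‖∑ j ∈ t, p i j * v j‖ ^ 2 ≤ ∑ j ∈ t, ‖v j‖ ^ 2 := by
  classical
  let Q := W.topologicalClosure.starProjection
  have hin : ∀ (i : ι) (v : lp (fun _ : ι => ℂ) 2), ⟪lp.single 2 i (1 : ℂ), v⟫_ℂ = v i := by
    intro i v
    rw [lp.inner_single_left]; simp
  have hsym : ∀ i j, (Q (lp.single 2 j (1 : ℂ))) i = conj ((Q (lp.single 2 i (1 : ℂ))) j) := by
    intro i j
    rw [← hin, ← hin, inner_conj_symm]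
    exact (Submodule.starProjection_isSymmetric _ _ _).symm
  have hsum : ∀ (v : lp (fun _ : ι => ℂ) 2) i,
      HasSum (fun j => (Q (lp.single 2 j (1 : ℂ))) i * v j) (Q v i) := by
    intro v i
    have h1 := (lp.hasSum_single (p := 2) (by simp) v).mapL Q
    have h2 := h1.mapL (innerSL ℂ (lp.single 2 i (1 : ℂ)))
    simp only [innerSL_apply_apply, hin] at h2
    refine (congrArg (HasSum · _) (funext fun j => ?_)).mp h2
    have h3 : lp.single (E := fun _ : ι => ℂ) 2 j (v j) = v j • lp.single 2 j (1 : ℂ) := by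
      rw [← lp.single_smul, smul_eq_mul, mul_one]
    refine (congrArg (fun w : lp (fun _ : ι => ℂ) 2 => Q w i) h3).trans ?_
    refine (congrArg (fun w : lp (fun _ : ι => ℂ) 2 => w i) (map_smul Q (v j) _)).trans ?_
    exact mul_comm (v j) _
  refine ⟨fun i j => (Q (lp.single 2 j (1 : ℂ))) i, hsym, fun i => ?_, fun v hv i => ?_,
    fun v hv i => ?_, fun s t v => ?_⟩
  · simp only [hsym i, RCLike.norm_conj]
    have := lp.memℓp (Q (lp.single 2 i (1 : ℂ)))
    have := this.summable (by simp)
    simpa using this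
  · convert hsum v i
    exact congrArg (fun w : lp (fun _ : ι => ℂ) 2 => w i)
      (Submodule.starProjection_eq_self_iff.2 (W.le_topologicalClosure hv)).symm
  · convert hsum v i
    have : Q v = 0 := by
      rw [Submodule.starProjection_apply_eq_zero_iff]
      rwa [Submodule.orthogonal_closure]
    rw [this]; rfl
  · let w : lp (fun _ : ι => ℂ) 2 := ∑ j ∈ t, lp.single 2 j (v j)
    have hw : ∀ i, w i = if i ∈ t then v i else 0 := by
      intro i
      rw [← hin, inner_sum]
      simp only [hin, lp.single_apply]
      simp [Pi.single_apply]
    have h1 : ∀ i, ∑ j ∈ t, (Q (lp.single 2 j (1 : ℂ))) i * v j = Q w i := by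
      intro i
      refine HasSum.unique ?_ (hsum w i)
      convert hasSum_sum_of_ne_finset_zero (s := t) (L := .unconditional ι) ?_ using 1
      · exact Finset.sum_congr rfl fun j hj => by simp [hw, hj]
      · intro j hj; simp [hw, hj]
    simp only [h1]
    have h2 : ∑ i ∈ s, ‖Q w i‖ ^ 2 ≤ ‖Q w‖ ^ 2 := by
      have := lp.sum_rpow_le_norm_rpow (p := 2) (by simp) (Q w) s
      simpa using this
    have h3 : ‖Q w‖ ≤ ‖w‖ := by
      have := Submodule.starProjection_norm_le W.topologicalClosure
      calc ‖Q w‖ ≤ ‖Q‖ * ‖w‖ := Q.le_opNorm _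
        _ ≤ 1 * ‖w‖ := by gcongr
        _ = _ := one_mul _
    have h4 : ‖w‖ ^ 2 = ∑ j ∈ t, ‖v j‖ ^ 2 := by
      have := lp.norm_sum_single (p := 2) (by simp) v t
      simpa using this
    rw [← h4]
    exact h2.trans (by gcongr)

lemma sum_star_mul_matrix {D : Type*} [NonUnitalCStarAlgebra D] {m n : Type*} [Fintype m]
    [Fintype n] (M : Matrix m n ℂ) (b : n → D) :
    ∑ i, star (∑ j, M i j • b j) * ∑ j, M i j • b j =
      ∑ j, ∑ k, (M.conjTranspose * M) j k • (star (b j) * b k) := by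
  simp only [star_sum, Finset.sum_mul_sum, Matrix.mul_apply, Finset.sum_smul,
    Matrix.conjTranspose_apply, star_smul, smul_mul_smul_comm]
  rw [Finset.sum_comm]
  exact Finset.sum_congr rfl fun j _ => Finset.sum_comm

/-- A contractive scalar matrix acts contractively on column tuples of a C*-algebra. -/
lemma norm_sum_star_mul_matrix_le {D : Type*} [NonUnitalCStarAlgebra D] {m n : Type*} [Fintype m]
    [Fintype n] (q : m → n → ℂ)
    (hq : ∀ v : n → ℂ, ∑ i, ‖∑ j, q i j * v j‖ ^ 2 ≤ ∑ j, ‖v j‖ ^ 2) (b : n → D) :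
    ‖∑ i, star (∑ j, q i j • b j) * ∑ j, q i j • b j‖ ≤ ∑ j, ‖b j‖ ^ 2 := by
  classical
  let _ := CStarAlgebra.spectralOrder D
  have := CStarAlgebra.spectralOrderedRing D
  let Q : Matrix m n ℂ := Matrix.of q
  have hpsd : (1 - Q.conjTranspose * Q).PosSemidef := by
    refine Matrix.PosSemidef.of_dotProduct_mulVec_nonneg ?_ fun v => ?_
    · simp [Matrix.IsHermitian]
    · have e1 : star v ⬝ᵥ (1 - Q.conjTranspose * Q).mulVec v =
          ((∑ j, ‖v j‖ ^ 2 - ∑ i, ‖∑ j, q i j * v j‖ ^ 2 : ℝ) : ℂ) := by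
        rw [Matrix.sub_mulVec, dotProduct_sub, Matrix.one_mulVec, ← Matrix.mulVec_mulVec,
          Matrix.dotProduct_mulVec, Matrix.vecMul_conjTranspose, star_star]
        push_cast
        congr 1
        · simp only [dotProduct, Pi.star_apply]
          exact Finset.sum_congr rfl fun j _ => by simpa using Complex.conj_mul' (v j)
        · simp only [dotProduct, Pi.star_apply]
          exact Finset.sum_congr rfl fun j _ => by
            simpa [Matrix.mulVec, dotProduct, Q] using Complex.conj_mul' (∑ k, q j k * v k)
      rw [e1]
      exact_mod_cast sub_nonneg.2 (hq v)
  obtain ⟨R, hR⟩ := CStarAlgebra.nonneg_iff_eq_star_mul_self.mp hpsd.nonneg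
  have hone : ∑ j, star (b j) * b j = ∑ j, ∑ k, (1 : Matrix n n ℂ) j k • (star (b j) * b k) := by
    simp [Matrix.one_apply, ite_smul]
  have hle : ∑ i, star (∑ j, q i j • b j) * ∑ j, q i j • b j ≤ ∑ j, star (b j) * b j := by
    have h0 : 0 ≤ ∑ i, star (∑ j, R i j • b j) * ∑ j, R i j • b j :=
      Finset.sum_nonneg fun i _ => star_mul_self_nonneg _
    rw [sum_star_mul_matrix, ← Matrix.star_eq_conjTranspose, ← hR] at h0
    have h1 := sum_star_mul_matrix Q b
    change ∑ i, star (∑ j, q i j • b j) * ∑ j, q i j • b j = _ at h1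
    rw [h1, hone, ← sub_nonneg]
    simpa [sub_smul, Finset.sum_sub_distrib] using h0
  refine (CStarAlgebra.norm_le_norm_of_nonneg_of_le
    (Finset.sum_nonneg fun i _ => star_mul_self_nonneg _) hle).trans ?_
  refine (norm_sum_le _ _).trans (Finset.sum_le_sum fun j _ => ?_)
  rw [CStarRing.norm_star_mul_self, sq]

lemma norm_sum_mul_star_matrix_le {D : Type*} [NonUnitalCStarAlgebra D] {m n : Type*} [Fintype m]
    [Fintype n] (q : m → n → ℂ)
    (hq : ∀ v : n → ℂ, ∑ i, ‖∑ j, q i j * v j‖ ^ 2 ≤ ∑ j, ‖v j‖ ^ 2) (b : n → D) :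
    ‖∑ i, (∑ j, q i j • b j) * star (∑ j, q i j • b j)‖ ≤ ∑ j, ‖b j‖ ^ 2 := by
  have := norm_sum_star_mul_matrix_le (fun i j => conj (q i j)) (fun v => ?_) fun j => star (b j)
  · simpa [star_sum] using this
  · have := hq fun j => conj (v j)
    simp only [RCLike.norm_conj] at this
    refine le_trans (le_of_eq ?_) this
    refine Finset.sum_congr rfl fun i _ => ?_
    rw [← RCLike.norm_conj, map_sum]
    simp

end ApproximationProperty

section ApproximationProperty

open scoped ComplexConjugate InnerProductSpace
open Filter Topology

/-- Hahn–Banach for a subspace: a norm-one functional vanishing on `p` attaining the quotient norm. -/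
lemma exists_dual_vanishing {E : Type*} [NormedAddCommGroup E] [NormedSpace ℂ E]
    (p : Submodule ℂ E) (x : E) : ∃ f : E →L[ℂ] ℂ, (∀ y ∈ p, f y = 0) ∧ ‖f‖ ≤ 1 ∧
      f x = ‖(Submodule.Quotient.mk x : E ⧸ p)‖ := by
  obtain ⟨g, hg, hgx⟩ := exists_dual_vector'' ℂ (Submodule.Quotient.mk x : E ⧸ p)
  let π : E →L[ℂ] E ⧸ p := p.mkQ.mkContinuous 1 fun y => by
    simpa using Submodule.Quotient.norm_mk_le p y
  refine ⟨g.comp π, fun y hy => ?_, ?_, hgx⟩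
  · have : π y = 0 := (Submodule.Quotient.mk_eq_zero p).2 hy
    simp [this]
  · calc _ ≤ ‖g‖ * ‖π‖ := g.opNorm_comp_le π
      _ ≤ 1 * 1 := by
        gcongr
        exact LinearMap.mkContinuous_norm_le _ zero_le_one _
      _ = 1 := one_mul 1

lemma Submodule.mem_of_forall_dual {E : Type*} [NormedAddCommGroup E] [NormedSpace ℂ E]
    {p : Submodule ℂ E} (hp : IsClosed (p : Set E)) {x : E}
    (h : ∀ f : E →L[ℂ] ℂ, (∀ y ∈ p, f y = 0) → f x = 0) : x ∈ p := by
  obtain ⟨f, h1, -, h2⟩ := exists_dual_vanishing p x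
  rw [h f h1, eq_comm, Complex.ofReal_eq_zero] at h2
  exact (QuotientAddGroup.norm_mk_eq_zero (S := p.toAddSubgroup) (hS := hp)).1 h2

variable {A B : Type*} [NonUnitalCStarAlgebra A] [NonUnitalCStarAlgebra B]

lemma norm_sum_smul_mul_smul_le {ι : Type*} (s : Finset ι) (u v : ι → A) {γ : ℝ} (hγ : 0 < γ)
    (h : ‖∑ i ∈ s, u i * v i‖ ≤ γ ^ 2) :
    ‖∑ i ∈ s, (((γ⁻¹ : ℝ) : ℂ) • u i) * (((γ⁻¹ : ℝ) : ℂ) • v i)‖ ≤ 1 := by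
  simp only [smul_mul_smul_comm, ← Finset.smul_sum, norm_smul, norm_mul, Complex.norm_real,
    Real.norm_of_nonneg (inv_nonneg.2 hγ.le)]
  rw [← mul_inv, inv_mul_le_iff₀ (by positivity)]
  linarith

lemma grothendieck_inequality_scaled (Φ : A →L[ℂ] B →L[ℂ] ℂ) : ∃ C : ℝ, 0 ≤ C ∧
    ∀ {ι : Type} (s : Finset ι) (x : ι → A) (y : ι → B) {α β : ℝ}, 0 < α → 0 < β →
      ‖∑ i ∈ s, star (x i) * x i‖ ≤ α ^ 2 → ‖∑ i ∈ s, x i * star (x i)‖ ≤ α ^ 2 →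
      ‖∑ i ∈ s, star (y i) * y i‖ ≤ β ^ 2 → ‖∑ i ∈ s, y i * star (y i)‖ ≤ β ^ 2 →
      ‖∑ i ∈ s, Φ (x i) (y i)‖ ≤ C * α * β := by
  obtain ⟨C, hC, h⟩ := grothendieck_inequality Φ
  refine ⟨C, hC, fun {ι} s x y α β hα hβ h1 h2 h3 h4 => ?_⟩
  have key := h s (fun i => ((α⁻¹ : ℝ) : ℂ) • x i) (fun i => ((β⁻¹ : ℝ) : ℂ) • y i)
    (by simpa using norm_sum_smul_mul_smul_le s (fun i => star (x i)) x hα h1)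
    (by simpa using norm_sum_smul_mul_smul_le s x (fun i => star (x i)) hα h2)
    (by simpa using norm_sum_smul_mul_smul_le s (fun i => star (y i)) y hβ h3)
    (by simpa using norm_sum_smul_mul_smul_le s y (fun i => star (y i)) hβ h4)
  simp only [map_smul, _root_.smul_apply, ← Finset.smul_sum, norm_smul,
    Complex.norm_real, Real.norm_of_nonneg (inv_nonneg.2 hα.le),
    Real.norm_of_nonneg (inv_nonneg.2 hβ.le)] at key
  rw [inv_mul_le_iff₀ hβ, inv_mul_le_iff₀ hα] at key
  linarith

lemma memlp_two_comp_dual {E ι : Type*} [NormedAddCommGroup E] [NormedSpace ℂ E] {c : ι → E}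
    (hc : Summable fun i => ‖c i‖ ^ 2) (f : E →L[ℂ] ℂ) : Memℓp (fun i => f (c i)) 2 := by
  refine memℓp_gen ?_
  refine Summable.of_nonneg_of_le (fun i => by positivity) (fun i => ?_) (hc.mul_left (‖f‖ ^ 2))
  simp only [ENNReal.toReal_ofNat, Real.rpow_ofNat]
  rw [← mul_pow]
  gcongr
  exact f.le_opNorm _

lemma summable_smul_of_sq {E ι : Type*} [NormedAddCommGroup E] [NormedSpace ℂ E] [CompleteSpace E]
    {c : ι → E} {p : ι → ℂ} (hp : Summable fun i => ‖p i‖ ^ 2) (hc : Summable fun i => ‖c i‖ ^ 2) :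
    Summable fun i => p i • c i := by
  refine Summable.of_norm_bounded (hp.add hc) fun i => ?_
  rw [norm_smul]
  nlinarith [sq_nonneg (‖p i‖ - ‖c i‖), sq_nonneg ‖p i‖, sq_nonneg ‖c i‖]

lemma norm_sum_matrix_le_of_finset {ι : Type*} {s t : Finset ι} {p : ι → ι → ℂ}
    (hp : ∀ v : ι → ℂ, ∑ i ∈ s, ‖∑ j ∈ t, p i j * v j‖ ^ 2 ≤ ∑ j ∈ t, ‖v j‖ ^ 2) (b : ι → A) :
    ‖∑ i ∈ s, star (∑ j ∈ t, p i j • b j) * ∑ j ∈ t, p i j • b j‖ ≤ ∑ j ∈ t, ‖b j‖ ^ 2 ∧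
      ‖∑ i ∈ s, (∑ j ∈ t, p i j • b j) * star (∑ j ∈ t, p i j • b j)‖ ≤ ∑ j ∈ t, ‖b j‖ ^ 2 := by
  classical
  have hq : ∀ v : t → ℂ, ∑ i : s, ‖∑ j : t, p i j * v j‖ ^ 2 ≤ ∑ j, ‖v j‖ ^ 2 := by
    intro v
    let w : ι → ℂ := fun j => if hj : j ∈ t then v ⟨j, hj⟩ else 0
    have hw : ∀ j : t, w j = v j := fun j => by simp [w]
    have e : ∀ i, ∑ j : t, p i j * v j = ∑ j ∈ t, p i j * w j := fun i => by
      rw [← Finset.sum_coe_sort t fun j => p i j * w j]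
      exact Finset.sum_congr rfl fun j _ => by rw [hw]
    have := hp w
    simp only [e]
    rw [← Finset.sum_coe_sort s, ← Finset.sum_coe_sort t fun j => ‖w j‖ ^ 2] at this
    simpa only [hw] using this
  have e3 : ∀ i, ∑ j : t, p i j • b j = ∑ j ∈ t, p i j • b j := fun i =>
    Finset.sum_coe_sort t fun j => p i j • b j
  have e1 := norm_sum_star_mul_matrix_le (fun (i : s) (j : t) => p i j) hq fun j => b j
  have e2 := norm_sum_mul_star_matrix_le (fun (i : s) (j : t) => p i j) hq fun j => b j
  rw [Finset.sum_coe_sort t fun j => ‖b j‖ ^ 2] at e1 e2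
  simp only [e3] at e1 e2
  rw [Finset.sum_coe_sort s fun i => star (∑ j ∈ t, p i j • b j) * ∑ j ∈ t, p i j • b j] at e1
  rw [Finset.sum_coe_sort s fun i => (∑ j ∈ t, p i j • b j) * star (∑ j ∈ t, p i j • b j)] at e2
  exact ⟨e1, e2⟩

/-- A consequence of Grothendieck's inequality playing the role of the approximation property:
a form vanishing on `J × B` and `A × K` kills every absolutely convergent tensor series which is
killed by all products of functionals vanishing on `J` and `K`. -/
theorem hasSum_form_eq_zero (Φ : A →L[ℂ] B →L[ℂ] ℂ) {J : Submodule ℂ A} {K : Submodule ℂ B}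
    (hJ : IsClosed (J : Set A)) (hK : IsClosed (K : Set B))
    (hΦJ : ∀ a ∈ J, ∀ b, Φ a b = 0) (hΦK : ∀ a, ∀ b ∈ K, Φ a b = 0)
    {ι : Type} (a : ι → A) (b : ι → B) (ha : Summable fun i => ‖a i‖ ^ 2)
    (hb : Summable fun i => ‖b i‖ ^ 2)
    (h : ∀ (f : A →L[ℂ] ℂ) (g : B →L[ℂ] ℂ), (∀ x ∈ J, f x = 0) → (∀ y ∈ K, g y = 0) →
      HasSum (fun i => f (a i) * g (b i)) 0) :
    HasSum (fun i => Φ (a i) (b i)) 0 := by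
  classical
  let W : Submodule ℂ (lp (fun _ : ι => ℂ) 2) := Submodule.span ℂ
    {v | ∃ g : B →L[ℂ] ℂ, (∀ y ∈ K, g y = 0) ∧ ∀ i, v i = g (b i)}
  obtain ⟨p, hp1, hp2, hp3, hp4, hp5⟩ := exists_projection_matrix W
  have hrow : ∀ i, HasSum (fun j => Φ (a i) (p i j • b j)) (Φ (a i) (b i)) := by
    intro i
    have hs := summable_smul_of_sq (hp2 i) hb
    have hmem : ∑' j, p i j • b j - b i ∈ K := by
      refine Submodule.mem_of_forall_dual hK fun g hg => ?_
      let v : lp (fun _ : ι => ℂ) 2 := ⟨fun i => g (b i), memlp_two_comp_dual hb g⟩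
      have h1 : HasSum (fun j => p i j * g (b j)) (g (b i)) :=
        hp3 v (Submodule.subset_span ⟨g, hg, fun _ => rfl⟩) i
      have h2 := hs.hasSum.mapL g
      simp only [map_smul, smul_eq_mul] at h2
      rw [map_sub, h2.unique h1, sub_self]
    have h3 := hs.hasSum.mapL (Φ (a i))
    have h4 := hΦK (a i) _ hmem
    rw [map_sub, sub_eq_zero] at h4
    rwa [← h4]
  have hcol : ∀ j, HasSum (fun i => Φ (a i) (p i j • b j)) 0 := by
    intro j
    have hp2' : Summable fun i => ‖p i j‖ ^ 2 := by
      simpa only [hp1 _ j, RCLike.norm_conj] using hp2 j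
    have hs := summable_smul_of_sq hp2' ha
    have hmem : ∑' i, p i j • a i ∈ J := by
      refine Submodule.mem_of_forall_dual hJ fun f hf => ?_
      have hmf := memlp_two_comp_dual ha f
      let u : lp (fun _ : ι => ℂ) 2 := star ⟨fun i => f (a i), hmf⟩
      have hu : u ∈ Wᗮ := by
        have : W ≤ (Submodule.span ℂ {u})ᗮ := by
          refine Submodule.span_le.2 ?_
          rintro v ⟨g, hg, hv⟩
          rw [SetLike.mem_coe, Submodule.mem_orthogonal_singleton_iff_inner_right]
          have h1 := lp.hasSum_inner (𝕜 := ℂ) u v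
          refine h1.unique ?_
          refine (congrArg (HasSum · _) (funext fun i => ?_)).mp (h f g hf hg)
          rw [hv, RCLike.inner_apply]
          change _ = g (b i) * conj (conj (f (a i)))
          rw [Complex.conj_conj, mul_comm]
        rw [Submodule.mem_orthogonal]
        intro v hv
        exact Submodule.mem_orthogonal_singleton_iff_inner_left.1 (this hv)
      have h1 : HasSum (fun i => conj (p j i * conj (f (a i)))) (conj 0) :=
        (hp4 u hu j).map (starRingEnd ℂ) Complex.continuous_conj
      have h2 := hs.hasSum.mapL f
      refine h2.unique ?_
      rw [map_zero] at h1
      refine (congrArg (HasSum · _) (funext fun i => ?_)).mp h1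
      rw [map_mul, Complex.conj_conj, ← hp1, map_smul, smul_eq_mul]
    have h3 := hs.hasSum.mapL (Φ.flip (b j))
    rw [ContinuousLinearMap.flip_apply, hΦJ _ hmem] at h3
    simpa using h3
  obtain ⟨C, hC, hG⟩ := grothendieck_inequality_scaled Φ
  obtain ⟨α, hα, hαs⟩ : ∃ α : ℝ, 0 < α ∧ ∀ s : Finset ι, ∑ i ∈ s, ‖a i‖ ^ 2 ≤ α ^ 2 := by
    have h0 : 0 ≤ ∑' i, ‖a i‖ ^ 2 := tsum_nonneg fun _ => by positivity
    refine ⟨∑' i, ‖a i‖ ^ 2 + 1, by positivity, fun s => ?_⟩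
    have := ha.sum_le_tsum s fun _ _ => by positivity
    nlinarith
  have hbound : ∀ (s t : Finset ι) {β : ℝ}, 0 < β → ∑ j ∈ t, ‖b j‖ ^ 2 ≤ β ^ 2 →
      ‖∑ i ∈ s, Φ (a i) (∑ j ∈ t, p i j • b j)‖ ≤ C * α * β := by
    intro s t β hβ hβt
    obtain ⟨e1, e2⟩ := norm_sum_matrix_le_of_finset (hp5 s t) b
    refine hG s a _ hα hβ ?_ ?_ (e1.trans hβt) (e2.trans hβt)
    · refine (norm_sum_le _ _).trans (le_trans (le_of_eq ?_) (hαs s))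
      exact Finset.sum_congr rfl fun i _ => by rw [CStarRing.norm_star_mul_self, sq]
    · refine (norm_sum_le _ _).trans (le_trans (le_of_eq ?_) (hαs s))
      exact Finset.sum_congr rfl fun i _ => by rw [CStarRing.norm_self_mul_star, sq]
  rw [HasSum, SummationFilter.unconditional_filter, Metric.tendsto_atTop]
  intro ε hε
  let β := ε / (3 * (C * α + 1))
  have hβ : 0 < β := by positivity
  have hβε : C * α * β ≤ ε / 3 := by
    have : C * α * β = (C * α / (C * α + 1)) * (ε / 3) := by simp only [β]; field_simp
    rw [this]
    have : C * α / (C * α + 1) ≤ 1 := by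
      rw [div_le_one (by positivity)]; linarith
    nlinarith
  obtain ⟨t₀, ht₀⟩ := summable_iff_vanishing_norm.1 hb (β ^ 2) (by positivity)
  have hcol₀ : HasSum (fun i => Φ (a i) (∑ j ∈ t₀, p i j • b j)) 0 := by
    simpa using hasSum_sum fun j (_ : j ∈ t₀) => hcol j
  rw [HasSum, SummationFilter.unconditional_filter, Metric.tendsto_atTop] at hcol₀
  obtain ⟨s₀, hs₀⟩ := hcol₀ (ε / 3) (by positivity)
  refine ⟨s₀, fun s hs => ?_⟩
  have h1 := hs₀ s hs
  rw [dist_zero_right] at h1 ⊢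
  have h2 : Tendsto (fun t => ∑ i ∈ s, Φ (a i) (∑ j ∈ t, p i j • b j)) atTop
      (𝓝 (∑ i ∈ s, Φ (a i) (b i))) := by
    refine tendsto_finsetSum s fun i _ => ?_
    simpa [HasSum] using hrow i
  have h3 : ∀ᶠ t in atTop, ‖∑ i ∈ s, Φ (a i) (∑ j ∈ t, p i j • b j)‖ ≤ ε / 3 + ε / 3 := by
    filter_upwards [eventually_ge_atTop t₀] with t ht
    have e : ∑ i ∈ s, Φ (a i) (∑ j ∈ t, p i j • b j) =
        ∑ i ∈ s, Φ (a i) (∑ j ∈ t \ t₀, p i j • b j) +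
          ∑ i ∈ s, Φ (a i) (∑ j ∈ t₀, p i j • b j) := by
      rw [← Finset.sum_add_distrib]
      refine Finset.sum_congr rfl fun i _ => ?_
      rw [← map_add, Finset.sum_sdiff ht]
    rw [e]
    refine (norm_add_le _ _).trans (add_le_add ?_ h1.le)
    refine (hbound s _ hβ ?_).trans hβε
    have := ht₀ (t \ t₀) Finset.sdiff_disjoint
    exact (le_abs_self _).trans this.le
  have := le_of_tendsto h2.norm h3
  linarith

end ApproximationProperty

namespace CStarProjTensor

open Filter Topology

variable {A B : Type u} [NonUnitalCStarAlgebra A] [NonUnitalCStarAlgebra B]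
  (P : CStarProjTensor A B)

/-- The canonical bilinear map as a continuous bilinear map. -/
noncomputable def tmulL : A →L[ℂ] B →L[ℂ] P.T :=
  P.tmul.mkContinuous₂ 1 fun a b => by rw [P.norm_tmul, one_mul]

@[simp] lemma tmulL_apply (a : A) (b : B) : P.tmulL a b = P.tmul a b := rfl

lemma ext_of_tmul {E : Type*} [NormedAddCommGroup E] [NormedSpace ℂ E] {f g : P.T →L[ℂ] E}
    (h : ∀ a b, f (P.tmul a b) = g (P.tmul a b)) : f = g := by
  refine ContinuousLinearMap.ext_on (s := {t : P.T | ∃ a b, t = P.tmul a b}) ?_ ?_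
  · exact dense_iff_closure_eq.2 P.span_dense
  · rintro _ ⟨a, b, rfl⟩; exact h a b

lemma exists_lift_form (β : A →L[ℂ] B →L[ℂ] ℂ) :
    ∃ L : P.T →L[ℂ] ℂ, (∀ a b, L (P.tmul a b) = β a b) ∧ ‖L‖ ≤ ‖β‖ := by
  let e : ULift.{u} ℂ ≃ₗᵢ[ℂ] ℂ := LinearIsometryEquiv.ulift ℂ ℂ
  let d : ℂ →L[ℂ] ULift.{u} ℂ := e.symm.toContinuousLinearEquiv
  let c : ULift.{u} ℂ →L[ℂ] ℂ := e.toContinuousLinearEquiv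
  have hc : ‖c‖ ≤ 1 := c.opNorm_le_bound zero_le_one fun x => by
    rw [one_mul]; exact (e.norm_map x).le
  obtain ⟨L, hL, hLn⟩ := P.lift (ULift.{u} ℂ) ((ContinuousLinearMap.compL ℂ B ℂ _ d).comp β)
  refine ⟨c.comp L, fun a b => ?_, ?_⟩
  · change e (L _) = _
    rw [hL]
    exact e.apply_symm_apply _
  · have h1 : ‖(ContinuousLinearMap.compL ℂ B ℂ _ d).comp β‖ ≤ ‖β‖ := by
      refine ContinuousLinearMap.opNorm_le_bound₂ _ (norm_nonneg β) fun a b => ?_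
      refine le_trans (le_of_eq ?_) (β.le_opNorm₂ a b)
      exact e.symm.norm_map _
    calc _ ≤ ‖c‖ * ‖L‖ := c.opNorm_comp_le L
      _ ≤ 1 * ‖L‖ := by gcongr
      _ ≤ _ := by rw [one_mul]; exact hLn.trans h1

lemma mem_closure_convexHull {x : P.T} (hx : ‖x‖ ≤ 1) :
    x ∈ closure (convexHull ℝ {t : P.T | ∃ a b, ‖a‖ ≤ 1 ∧ ‖b‖ ≤ 1 ∧ t = P.tmul a b}) := by
  by_contra hcon
  obtain ⟨f, r, hr, hrx⟩ := RCLike.geometric_hahn_banach_closed_point (𝕜 := ℂ)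
    (convex_convexHull ℝ _).closure isClosed_closure hcon
  have h1 : ∀ a b, ‖a‖ ≤ 1 → ‖b‖ ≤ 1 → ‖f (P.tmul a b)‖ ≤ r := by
    intro a b ha hb
    obtain ⟨z, hz, hzf⟩ : ∃ z : ℂ, ‖z‖ ≤ 1 ∧ z * f (P.tmul a b) = ‖f (P.tmul a b)‖ := by
      by_cases h0 : f (P.tmul a b) = 0
      · exact ⟨0, by simp, by simp [h0]⟩
      · refine ⟨(‖f (P.tmul a b)‖ : ℂ) / f (P.tmul a b), ?_, div_mul_cancel₀ _ h0⟩
        rw [norm_div, Complex.norm_real, norm_norm, div_self (norm_ne_zero_iff.2 h0)]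
    have := hr _ (subset_closure (subset_convexHull ℝ _ ⟨z • a, b, ?_, hb, rfl⟩))
    · rw [map_smul, LinearMap.smul_apply, map_smul, smul_eq_mul, hzf] at this
      simpa using this.le
    · rw [norm_smul]; exact mul_le_one₀ hz (norm_nonneg _) ha
  have hr0 : 0 ≤ r := (norm_nonneg _).trans (h1 0 0 (by simp) (by simp))
  obtain ⟨L, hL, hLn⟩ := P.exists_lift_form ((ContinuousLinearMap.compL ℂ B _ _ f).comp P.tmulL)
  have hLf : L = f := P.ext_of_tmul fun a b => hL a b
  have h2 : ‖(ContinuousLinearMap.compL ℂ B _ _ f).comp P.tmulL‖ ≤ r := by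
    refine ContinuousLinearMap.opNorm_le_of_unit_norm hr0 fun a ha => ?_
    refine ContinuousLinearMap.opNorm_le_of_unit_norm hr0 fun b hb => ?_
    exact h1 a b ha.le hb.le
  have h3 : ‖f x‖ ≤ r := by
    calc ‖f x‖ ≤ ‖f‖ * ‖x‖ := f.le_opNorm x
      _ ≤ r * 1 := by
        gcongr
        rw [← hLf]; exact hLn.trans h2
      _ = r := mul_one r
  have h4 : RCLike.re (f x) ≤ ‖f x‖ := RCLike.re_le_norm _
  linarith

lemma exists_finite_approx (x : P.T) : ∃ (ι : Type) (_ : Fintype ι) (a : ι → A) (b : ι → B),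
    ∑ i, ‖a i‖ ^ 2 ≤ ‖x‖ ∧ ∑ i, ‖b i‖ ^ 2 ≤ ‖x‖ ∧ ‖x - ∑ i, P.tmul (a i) (b i)‖ ≤ ‖x‖ / 2 := by
  by_cases hx : x = 0
  · exact ⟨PEmpty, inferInstance, fun _ => 0, fun _ => 0, by simp [hx], by simp [hx], by simp [hx]⟩
  have hpos : 0 < ‖x‖ := norm_pos_iff.2 hx
  have hmem := P.mem_closure_convexHull (x := ((‖x‖⁻¹ : ℝ) : ℂ) • x) (by
    rw [norm_smul, Complex.norm_real, norm_inv, norm_norm, inv_mul_cancel₀ hpos.ne'])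
  obtain ⟨y, hy, hxy⟩ := Metric.mem_closure_iff.1 hmem (1 / 2) (by norm_num)
  obtain ⟨ι, _, w, z, hw0, hw1, hz, rfl⟩ := mem_convexHull_iff_exists_fintype.1 hy
  choose a b ha hb hab using hz
  have hsq : ∀ i, √(‖x‖ * w i) ^ 2 = ‖x‖ * w i := fun i =>
    Real.sq_sqrt (mul_nonneg hpos.le (hw0 i))
  have aux : ∀ {D : Type u} [NormedAddCommGroup D] [NormedSpace ℂ D] (c : ι → D),
      (∀ i, ‖c i‖ ≤ 1) → ∑ i, ‖((√(‖x‖ * w i) : ℝ) : ℂ) • c i‖ ^ 2 ≤ ‖x‖ := by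
    intro D _ _ c hc
    calc _ ≤ ∑ i, ‖x‖ * w i := by
          refine Finset.sum_le_sum fun i _ => ?_
          rw [norm_smul, mul_pow, Complex.norm_real, Real.norm_eq_abs, sq_abs, hsq]
          have := mul_nonneg hpos.le (hw0 i)
          have h1 : ‖c i‖ ^ 2 ≤ 1 := pow_le_one₀ (norm_nonneg _) (hc i)
          nlinarith
      _ = ‖x‖ := by rw [← Finset.mul_sum, hw1, mul_one]
  refine ⟨ι, inferInstance, fun i => ((√(‖x‖ * w i) : ℝ) : ℂ) • a i,
    fun i => ((√(‖x‖ * w i) : ℝ) : ℂ) • b i, aux a ha, aux b hb, ?_⟩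
  have e : ∑ i, P.tmul (((√(‖x‖ * w i) : ℝ) : ℂ) • a i) (((√(‖x‖ * w i) : ℝ) : ℂ) • b i) =
      (‖x‖ : ℂ) • ∑ i, w i • z i := by
    rw [Finset.smul_sum]
    refine Finset.sum_congr rfl fun i _ => ?_
    rw [map_smul, map_smul, LinearMap.smul_apply, hab, smul_smul, ← Complex.ofReal_mul, ← sq, hsq,
      Complex.ofReal_mul, mul_smul, Complex.coe_smul (w i)]
  have e2 : x = (‖x‖ : ℂ) • ((‖x‖⁻¹ : ℝ) : ℂ) • x := by
    rw [smul_smul, ← Complex.ofReal_mul, mul_inv_cancel₀ hpos.ne', Complex.ofReal_one, one_smul]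
  rw [e]
  nth_rw 1 [e2]
  rw [← smul_sub, norm_smul, ← dist_eq_norm, Complex.norm_real, norm_norm]
  nlinarith

/-- Every element of `A ⊗̂ B` is the sum of an absolutely convergent series of elementary
tensors. -/
theorem exists_hasSum_tmul (x : P.T) : ∃ (ι : Type) (a : ι → A) (b : ι → B),
    (Summable fun i => ‖a i‖ ^ 2) ∧ (Summable fun i => ‖b i‖ ^ 2) ∧
      HasSum (fun i => P.tmul (a i) (b i)) x := by
  choose ι inst a b h1 h2 h3 using P.exists_finite_approx
  let r : ℕ → P.T := fun n => (fun y => y - ∑ i, P.tmul (a y i) (b y i))^[n] x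
  have hr : ∀ n, r (n + 1) = r n - ∑ i, P.tmul (a (r n) i) (b (r n) i) := fun n =>
    Function.iterate_succ_apply' _ n x
  have hrn : ∀ n, ‖r n‖ ≤ ‖x‖ * (1 / 2) ^ n := by
    intro n
    induction n with
    | zero => simp [r]
    | succ n ih =>
      rw [hr, pow_succ]
      have := h3 (r n)
      linarith
  have hgeo : Summable fun n : ℕ => ‖x‖ * (1 / 2 : ℝ) ^ n := summable_geometric_two.mul_left _
  have aux : ∀ {D : Type u} [NormedAddCommGroup D] (c : ∀ y, ι y → D),
      (∀ y, ∑ i, ‖c y i‖ ^ 2 ≤ ‖y‖) → Summable fun i : Σ n, ι (r n) => ‖c (r i.1) i.2‖ ^ 2 := by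
    intro D _ c hc
    rw [summable_sigma_of_nonneg fun _ => by positivity]
    refine ⟨fun n => (hasSum_fintype _).summable, ?_⟩
    refine Summable.of_nonneg_of_le (fun n => tsum_nonneg fun _ => by positivity) (fun n => ?_) hgeo
    rw [tsum_fintype]
    exact (hc _).trans (hrn n)
  have ha := aux a h1
  have hb := aux b h2
  refine ⟨Σ n, ι (r n), fun i => a (r i.1) i.2, fun i => b (r i.1) i.2, ha, hb, ?_⟩
  have hs : Summable fun i : Σ n, ι (r n) => P.tmul (a (r i.1) i.2) (b (r i.1) i.2) := by
    refine Summable.of_norm_bounded (ha.add hb) fun i => ?_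
    rw [P.norm_tmul]
    nlinarith [sq_nonneg (‖a (r i.1) i.2‖ - ‖b (r i.1) i.2‖), sq_nonneg ‖a (r i.1) i.2‖,
      sq_nonneg ‖b (r i.1) i.2‖]
  have h4 := hs.hasSum.sigma fun n => hasSum_fintype _
  have h5 : Tendsto (fun N => ∑ n ∈ Finset.range N, ∑ i, P.tmul (a (r n) i) (b (r n) i)) atTop
      (𝓝 x) := by
    have e : ∀ N, ∑ n ∈ Finset.range N, ∑ i, P.tmul (a (r n) i) (b (r n) i) = x - r N := by
      intro N
      induction N with
      | zero => simp [r]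
      | succ N ih => rw [Finset.sum_range_succ, ih, hr]; abel
    simp_rw [e]
    have : Tendsto r atTop (𝓝 0) := squeeze_zero_norm hrn hgeo.tendsto_atTop_zero
    simpa using this.const_sub x
  rw [tendsto_nhds_unique h5 h4.tendsto_sum_nat]
  exact hs.hasSum

end CStarProjTensor

section ClosedIdeals

open Filter Topology

section

variable {D : Type*} [NonUnitalCStarAlgebra D]

lemma norm_one_sub_inr_le {u v : D} (hu : u = star v * v) (h1 : ‖u‖ ≤ 1) :
    ‖(1 : Unitization ℂ D) - (u : Unitization ℂ D)‖ ≤ 1 := by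
  let _ := CStarAlgebra.spectralOrder (Unitization ℂ D)
  have := CStarAlgebra.spectralOrderedRing (Unitization ℂ D)
  have h0 : (0 : Unitization ℂ D) ≤ (u : Unitization ℂ D) := by
    rw [hu, Unitization.inr_mul, Unitization.inr_star]
    exact star_mul_self_nonneg _
  refine norm_one_sub_le h0 ((CStarAlgebra.norm_le_one_iff_of_nonneg _ h0).1 ?_)
  rwa [Unitization.norm_inr]

lemma norm_sub_mul_positive_le {u v : D} (hu : u = star v * v) (h1 : ‖u‖ ≤ 1) (x : D) :
    ‖x - x * u‖ ≤ ‖x‖ := by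
  have h : ((x - x * u : D) : Unitization ℂ D) = x * (1 - u) := by
    rw [mul_sub, mul_one, Unitization.inr_sub, Unitization.inr_mul]
  rw [← Unitization.norm_inr (𝕜 := ℂ), h]
  refine (norm_mul_le _ _).trans ?_
  rw [Unitization.norm_inr]
  exact mul_le_of_le_one_right (norm_nonneg _) (norm_one_sub_inr_le hu h1)

lemma norm_sub_positive_mul_le {u v : D} (hu : u = star v * v) (h1 : ‖u‖ ≤ 1) (x : D) :
    ‖x - u * x‖ ≤ ‖x‖ := by
  have := norm_sub_mul_positive_le hu h1 (star x)
  have hs : star u = u := by rw [hu]; simp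
  rwa [norm_star, ← norm_star, star_sub, star_mul, star_star, hs] at this

lemma exists_approximate_unit (s : Finset D) {ε : ℝ} (hε : 0 < ε) :
    ∃ u v : D, u = star v * v ∧ ‖u‖ ≤ 1 ∧ ∀ a ∈ s, ‖a - a * u‖ < ε ∧ ‖a - u * a‖ < ε := by
  let _ := CStarAlgebra.spectralOrder D
  have := CStarAlgebra.spectralOrderedRing D
  have hl := CStarAlgebra.increasingApproximateUnit D
  have h1 : ∀ᶠ u in CStarAlgebra.approximateUnit D, ∀ a ∈ s, ‖a - a * u‖ < ε ∧ ‖a - u * a‖ < ε := by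
    refine (Finset.eventually_all s).2 fun a _ => ?_
    have e1 := (hl.tendsto_mul_left a).eventually (Metric.ball_mem_nhds a hε)
    have e2 := (hl.tendsto_mul_right a).eventually (Metric.ball_mem_nhds a hε)
    filter_upwards [e1, e2] with u h1 h2
    rw [dist_eq_norm, norm_sub_rev] at h1 h2
    exact ⟨h1, h2⟩
  have := hl.neBot
  obtain ⟨u, h2, h3, h4⟩ := (h1.and (hl.eventually_nonneg.and hl.eventually_norm)).exists
  obtain ⟨v, rfl⟩ := CStarAlgebra.nonneg_iff_eq_star_mul_self.1 h3
  exact ⟨_, v, rfl, h4, h2⟩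

end

/-- A norm-closed two-sided ideal that is stable under scalars. -/
structure IsClosedIdeal {R : Type*} [NonUnitalNormedRing R] [NormedSpace ℂ R]
    (J : Submodule ℂ R) : Prop where
  isClosed : IsClosed (J : Set R)
  mul_left : ∀ r {x}, x ∈ J → r * x ∈ J
  mul_right : ∀ r {x}, x ∈ J → x * r ∈ J

namespace IsClosedIdeal

section

variable {D : Type*} [NonUnitalCStarAlgebra D] {J : Submodule ℂ D}

/-- The selfadjoint part of a closed ideal. -/
def starInter (hJ : IsClosedIdeal J) : NonUnitalStarSubalgebra ℂ D where
  carrier := {x | x ∈ J ∧ star x ∈ J}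
  add_mem' {x y} hx hy := ⟨J.add_mem hx.1 hy.1, by
    rw [star_add]; exact J.add_mem hx.2 hy.2⟩
  zero_mem' := ⟨J.zero_mem, by simp⟩
  mul_mem' {x y} hx hy := ⟨hJ.mul_left _ hy.1, by rw [star_mul]; exact hJ.mul_left _ hx.2⟩
  smul_mem' c x hx := ⟨J.smul_mem c hx.1, by rw [star_smul]; exact J.smul_mem _ hx.2⟩
  star_mem' {x} hx := ⟨hx.2, by rw [star_star]; exact hx.1⟩

lemma isClosed_starInter (hJ : IsClosedIdeal J) : IsClosed (hJ.starInter : Set D) :=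
  hJ.isClosed.inter (hJ.isClosed.preimage continuous_star)

lemma exists_unit_starInter (hJ : IsClosedIdeal J) (s : Finset hJ.starInter) {ε : ℝ}
    (hε : 0 < ε) : ∃ u v : D, u ∈ J ∧ u = star v * v ∧ ‖u‖ ≤ 1 ∧
      ∀ a ∈ s, ‖(a : D) - a * u‖ < ε ∧ ‖(a : D) - u * a‖ < ε := by
  have := hJ.isClosed_starInter
  obtain ⟨u, v, h1, h2, h3⟩ := exists_approximate_unit s hε
  exact ⟨u, v, u.2.1, congrArg Subtype.val h1, h2, h3⟩

lemma norm_star_sub_sq_le {a u v : D} (hu : u = star v * v) (h1 : ‖u‖ ≤ 1) :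
    ‖a - a * u‖ ^ 2 ≤ ‖star a * a - star a * a * u‖ := by
  have hs : star u = u := by rw [hu]; simp
  have h2 := norm_sub_positive_mul_le hu h1 (star a * a - star a * a * u)
  refine le_trans (le_of_eq ?_) h2
  rw [sq, ← CStarRing.norm_star_mul_self]
  congr 1
  rw [star_sub, star_mul, hs]
  noncomm_ring

lemma star_mem (hJ : IsClosedIdeal J) {a : D} (ha : a ∈ J) : star a ∈ J := by
  have hN : a * star a ∈ hJ.starInter := ⟨hJ.mul_right _ ha, by
    rw [star_mul, star_star]; exact hJ.mul_right _ ha⟩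
  have : star a ∈ closure (J : Set D) := by
    refine Metric.mem_closure_iff.2 fun ε hε => ?_
    obtain ⟨u, v, hu, h1, h2, h3⟩ := hJ.exists_unit_starInter {⟨_, hN⟩} (pow_pos hε 2)
    refine ⟨star a * u, hJ.mul_left _ hu, ?_⟩
    rw [dist_eq_norm]
    refine lt_of_pow_lt_pow_left₀ 2 hε.le ((norm_star_sub_sq_le h1 h2).trans_lt ?_)
    rw [star_star]
    exact (h3 _ (Finset.mem_singleton_self _)).1
  rwa [hJ.isClosed.closure_eq] at this

lemma exists_unit (hJ : IsClosedIdeal J) (s : Finset D) (hs : ∀ a ∈ s, a ∈ J) {ε : ℝ}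
    (hε : 0 < ε) : ∃ u v : D, u ∈ J ∧ u = star v * v ∧ ‖u‖ ≤ 1 ∧
      ∀ a ∈ s, ‖a - a * u‖ < ε ∧ ‖a - u * a‖ < ε := by
  classical
  let e : {a // a ∈ s} → hJ.starInter := fun a => ⟨a.1, hs a.1 a.2, hJ.star_mem (hs a.1 a.2)⟩
  obtain ⟨u, v, h1, h2, h3, h4⟩ := hJ.exists_unit_starInter (s.attach.image e) hε
  exact ⟨u, v, h1, h2, h3, fun a ha => h4 (e ⟨a, ha⟩)
    (Finset.mem_image_of_mem e (Finset.mem_attach s ⟨a, ha⟩))⟩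

end

section

variable {R : Type*} [NonUnitalNormedRing R] [NormedSpace ℂ R] [IsScalarTower ℂ R R]
  [SMulCommClass ℂ R R]

/-- A closed two-sided ideal in a ring with approximate left units is stable under scalars. -/
lemma exists_submodule_eq (hR : ∀ (x : R) (ε : ℝ), 0 < ε → ∃ e, ‖x - e * x‖ < ε)
    (I : TwoSidedIdeal R) (hI : IsClosed (I : Set R)) :
    ∃ J : Submodule ℂ R, (J : Set R) = I ∧ IsClosedIdeal J := by
  refine ⟨{ carrier := I, add_mem' := I.add_mem, zero_mem' := I.zero_mem, smul_mem' := ?_ }, rfl,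
    hI, fun r x hx => I.mul_mem_left r x hx, fun r x hx => I.mul_mem_right x r hx⟩
  intro c x hx
  have : c • x ∈ closure (I : Set R) := by
    refine Metric.mem_closure_iff.2 fun ε hε => ?_
    obtain ⟨e, he⟩ := hR (c • x) ε hε
    refine ⟨e * (c • x), ?_, by rwa [dist_eq_norm]⟩
    rw [mul_smul_comm, ← smul_mul_assoc]
    exact I.mul_mem_left _ _ hx
  rwa [hI.closure_eq] at this

end
end IsClosedIdeal
end ClosedIdeals

namespace IsClosedIdeal

variable {D : Type*} [NonUnitalCStarAlgebra D] {J : Submodule ℂ D}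

/-- Multiplication on the quotient by a closed ideal. -/
@[reducible] def quotientMul (hJ : IsClosedIdeal J) : Mul (D ⧸ J) where
  mul x y := Quotient.map₂ (· * ·) (fun a b hab c d hcd => by
    have h1 := (Submodule.quotientRel_def J).1 hab
    have h2 := (Submodule.quotientRel_def J).1 hcd
    refine (Submodule.quotientRel_def J).2 ?_
    have : a * c - b * d = (a - b) * c + b * (c - d) := by noncomm_ring
    rw [this]
    exact J.add_mem (hJ.mul_right _ h1) (hJ.mul_left _ h2)) x y

/-- The involution on the quotient by a closed ideal. -/
@[reducible] def quotientStar (hJ : IsClosedIdeal J) : Star (D ⧸ J) where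
  star x := Quotient.map star (fun a b hab => by
    have h1 := (Submodule.quotientRel_def J).1 hab
    refine (Submodule.quotientRel_def J).2 ?_
    rw [← star_sub]
    exact hJ.star_mem h1) x

lemma quotient_norm_mul_le (hJ : IsClosedIdeal J) (x y : D ⧸ J) :
    ‖hJ.quotientMul.mul x y‖ ≤ ‖x‖ * ‖y‖ := by
  refine le_of_forall_pos_le_add fun ε hε => ?_
  have hc : Filter.Tendsto (fun δ : ℝ => (‖x‖ + δ) * (‖y‖ + δ)) (nhdsWithin 0 (Set.Ioi 0))
      (nhds (‖x‖ * ‖y‖)) := by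
    have : Continuous fun δ : ℝ => (‖x‖ + δ) * (‖y‖ + δ) := by fun_prop
    simpa using (this.tendsto 0).mono_left nhdsWithin_le_nhds
  obtain ⟨δ, h1, h2⟩ := ((hc.eventually_lt_const (lt_add_of_pos_right _ hε)).and
    self_mem_nhdsWithin).exists
  obtain ⟨a, rfl, ha⟩ := Submodule.Quotient.norm_mk_lt x h2
  obtain ⟨b, rfl, hb⟩ := Submodule.Quotient.norm_mk_lt y h2
  refine le_trans ?_ h1.le
  refine (Submodule.Quotient.norm_mk_le J (a * b)).trans ((norm_mul_le a b).trans ?_)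
  gcongr

lemma quotient_norm_sq_le (hJ : IsClosedIdeal J) (a : D) :
    ‖(Submodule.Quotient.mk a : D ⧸ J)‖ ^ 2 ≤ ‖(Submodule.Quotient.mk (star a * a) : D ⧸ J)‖ := by
  refine le_of_forall_pos_lt_add fun ε hε => ?_
  obtain ⟨x, hx, hxn⟩ := Submodule.Quotient.norm_mk_lt
    (Submodule.Quotient.mk (star a * a) : D ⧸ J) (half_pos hε)
  have hj : star a * a - x ∈ J := (Submodule.Quotient.eq J).1 hx.symm
  obtain ⟨u, v, hu, h1, h2, h3⟩ := hJ.exists_unit {star a * a - x} (by simpa using hj) (half_pos hε)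
  have h4 : (Submodule.Quotient.mk a : D ⧸ J) = Submodule.Quotient.mk (a - a * u) :=
    (Submodule.Quotient.eq J).2 (by rw [sub_sub_cancel]; exact hJ.mul_left _ hu)
  have h5 := norm_star_sub_sq_le (a := a) h1 h2
  have h6 := norm_sub_mul_positive_le h1 h2 x
  have h7 := (h3 _ (Finset.mem_singleton_self _)).1
  have h8 : star a * a - star a * a * u =
    (x - x * u) + ((star a * a - x) - (star a * a - x) * u) := by noncomm_ring
  have h9 := norm_add_le (x - x * u) ((star a * a - x) - (star a * a - x) * u)
  rw [← h8] at h9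
  rw [h4]
  have h10 := Submodule.Quotient.norm_mk_le J (a - a * u)
  have := pow_le_pow_left₀ (norm_nonneg _) h10 2
  linarith

/-- The quotient by a closed ideal, as a C*-algebra. -/
def QuotientAlgebra (_ : IsClosedIdeal J) : Type _ := D ⧸ J

/-- The C*-algebra structure on the quotient by a closed ideal. -/
noncomputable instance quotientCStarAlgebra (hJ : IsClosedIdeal J) :
    NonUnitalCStarAlgebra hJ.QuotientAlgebra :=
  haveI := hJ.isClosed
  { (inferInstance : NormedAddCommGroup (D ⧸ J)), (inferInstance : NormedSpace ℂ (D ⧸ J)),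
    hJ.quotientMul, hJ.quotientStar with
    left_distrib := by
      rintro ⟨a⟩ ⟨b⟩ ⟨c⟩; exact congrArg (Submodule.Quotient.mk (p := J)) (mul_add a b c)
    right_distrib := by
      rintro ⟨a⟩ ⟨b⟩ ⟨c⟩; exact congrArg (Submodule.Quotient.mk (p := J)) (add_mul a b c)
    zero_mul := by rintro ⟨a⟩; exact congrArg (Submodule.Quotient.mk (p := J)) (zero_mul a)
    mul_zero := by rintro ⟨a⟩; exact congrArg (Submodule.Quotient.mk (p := J)) (mul_zero a)
    mul_assoc := by
      rintro ⟨a⟩ ⟨b⟩ ⟨c⟩; exact congrArg (Submodule.Quotient.mk (p := J)) (mul_assoc a b c)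
    norm_mul_le := by
      exact hJ.quotient_norm_mul_le
    star_involutive := by
      rintro ⟨a⟩; exact congrArg (Submodule.Quotient.mk (p := J)) (star_star a)
    star_mul := by
      rintro ⟨a⟩ ⟨b⟩; exact congrArg (Submodule.Quotient.mk (p := J)) (star_mul a b)
    star_add := by
      rintro ⟨a⟩ ⟨b⟩; exact congrArg (Submodule.Quotient.mk (p := J)) (star_add a b)
    complete := (inferInstance : CompleteSpace (D ⧸ J)).complete
    norm_mul_self_le := by
      rintro ⟨a⟩
      have := hJ.quotient_norm_sq_le a
      rw [sq] at this
      exact this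
    smul_assoc := by
      rintro c ⟨a⟩ ⟨b⟩; exact congrArg (Submodule.Quotient.mk (p := J)) (smul_assoc c a b)
    smul_comm := by
      rintro c ⟨a⟩ ⟨b⟩; exact congrArg (Submodule.Quotient.mk (p := J)) (smul_comm c a b)
    star_smul := by
      rintro c ⟨a⟩; exact congrArg (Submodule.Quotient.mk (p := J)) (star_smul c a) }

end IsClosedIdeal

theorem IsClosedIdeal.exists_quotient.{v} {D : Type v} [NonUnitalCStarAlgebra D]
    {J : Submodule ℂ D} (hJ : IsClosedIdeal J) :
    ∃ (Q : Type v) (_ : NonUnitalCStarAlgebra Q) (q : D →⋆ₙₐ[ℂ] Q),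
      (∀ a, q a = 0 ↔ a ∈ J) ∧ (∀ a, ‖q a‖ = ‖(Submodule.Quotient.mk a : D ⧸ J)‖) ∧
      ∀ (d : Q) (ε : ℝ), 0 < ε → ∃ a, q a = d ∧ ‖a‖ < ‖d‖ + ε := by
  refine ⟨hJ.QuotientAlgebra, inferInstance,
    { toFun := fun x => (Submodule.Quotient.mk x : D ⧸ J)
      map_smul' := fun _ _ => rfl
      map_zero' := rfl
      map_add' := fun _ _ => rfl
      map_mul' := fun _ _ => rfl
      map_star' := fun _ => rfl }, fun a => Submodule.Quotient.mk_eq_zero J, fun a => rfl,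
    fun d ε hε => ?_⟩
  exact Submodule.Quotient.norm_mk_lt d hε

section Excision

/-- A continuous ramp rising from `0` at `α` to `1` at `β`. -/
noncomputable def ramp (α β t : ℝ) : ℝ := max 0 (min 1 ((t - α) / (β - α)))

@[fun_prop]
lemma continuous_ramp (α β : ℝ) : Continuous (ramp α β) := by unfold ramp; fun_prop

lemma ramp_nonneg (α β t : ℝ) : 0 ≤ ramp α β t := le_max_left _ _

lemma ramp_le_one (α β t : ℝ) : ramp α β t ≤ 1 := max_le zero_le_one (min_le_left _ _)

lemma ramp_eq_zero {α β t : ℝ} (h : α < β) (ht : t ≤ α) : ramp α β t = 0 :=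
  max_eq_left ((min_le_right _ _).trans
    (div_nonpos_of_nonpos_of_nonneg (by linarith) (by linarith)))

lemma ramp_eq_one {α β t : ℝ} (h : α < β) (ht : β ≤ t) : ramp α β t = 1 := by
  have : 1 ≤ (t - α) / (β - α) := by rw [one_le_div (by linarith)]; linarith
  rw [ramp, min_eq_left this, max_eq_right zero_le_one]

variable {D : Type*} [NonUnitalCStarAlgebra D] [PartialOrder D] [StarOrderedRing D]

/-- Positive contractions `d` having a nonzero positive element `d'` on which `d` acts as a unit. -/
structure IsExcisor (d d' : D) : Prop where
  nonneg : 0 ≤ d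
  norm_le : ‖d‖ ≤ 1
  nonneg' : 0 ≤ d'
  mul_eq : d * d' = d'
  ne_zero : d' ≠ 0

lemma IsExcisor.star_eq {d d' : D} (h : IsExcisor d d') : star d = d := h.nonneg.isSelfAdjoint

lemma mul_eq_of_star {e d : D} (he : star e = e) (hd : star d = d) (h : e * d = d) :
    d * e = d := by
  rw [← he, ← hd, ← star_mul, h]

lemma exists_isExcisor {c : D} (hc : 0 ≤ c) (hc0 : c ≠ 0) {δ : ℝ} (hδ : 0 < δ) :
    ∃ d d' y z : D, IsExcisor d d' ∧ d = c * y ∧ d' = c * z ∧ ‖c * d - ‖c‖ • d‖ ≤ δ := by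
  have hr : 0 < ‖c‖ := norm_pos_iff.2 hc0
  set r := ‖c‖ with hrdef
  have hsa : IsSelfAdjoint c := hc.isSelfAdjoint
  have hspec : ∀ x ∈ quasispectrum ℝ c, 0 ≤ x ∧ x ≤ r := fun x hx =>
    ⟨quasispectrum_nonneg_of_nonneg c hc x hx,
      (le_abs_self x).trans
        (NonUnitalIsometricContinuousFunctionalCalculus.norm_quasispectrum_le (𝕜 := ℝ) c hx hsa)⟩
  have hrspec : r ∈ quasispectrum ℝ c := by
    obtain ⟨x, hx, hxr⟩ :=
      (NonUnitalIsometricContinuousFunctionalCalculus.isGreatest_norm_quasispectrum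
        (𝕜 := ℝ) c hsa).1
    simp only [Real.norm_of_nonneg (hspec x hx).1] at hxr
    rwa [hxr] at hx
  obtain ⟨η, hη, hηδ, hηr⟩ : ∃ η, 0 < η ∧ η ≤ δ ∧ η < r :=
    ⟨min δ (r / 2), lt_min hδ (half_pos hr), min_le_left _ _,
      (min_le_right _ _).trans_lt (half_lt_self hr)⟩
  let h1 : ℝ → ℝ := ramp (r - η) (r - η / 2)
  let h2 : ℝ → ℝ := ramp (r - η / 2) r
  have c1 : Continuous h1 := continuous_ramp _ _
  have c2 : Continuous h2 := continuous_ramp _ _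
  have z1 : h1 0 = 0 := ramp_eq_zero (by linarith) (by linarith)
  have z2 : h2 0 = 0 := ramp_eq_zero (by linarith) (by linarith)
  have hfac : ∀ h : ℝ → ℝ, Continuous h → h 0 = 0 → (∀ t ≤ r - η, h t = 0) →
      ∃ y, cfcₙ h c = c * y := by
    intro h hcont h0 hz
    have hm : ∀ t, max t (r - η) ≠ 0 := fun t => (lt_max_of_lt_right (by linarith)).ne'
    have hc' : Continuous fun t => h t / max t (r - η) :=
      hcont.div (by fun_prop) hm
    refine ⟨cfcₙ (fun t => h t / max t (r - η)) c, ?_⟩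
    have := cfcₙ_mul (fun t : ℝ => t) (fun t => h t / max t (r - η)) c
      (by fun_prop) rfl hc'.continuousOn (by simp [h0])
    rw [cfcₙ_id' ℝ c] at this
    rw [← this]
    refine congrArg (cfcₙ · c) (funext fun t => ?_)
    rcases le_total t (r - η) with ht | ht
    · simp [hz t ht]
    · have := hm t
      rw [max_eq_left ht] at this ⊢
      field_simp
  obtain ⟨y, hy⟩ := hfac h1 c1 z1 fun t ht => ramp_eq_zero (by linarith) ht
  obtain ⟨z, hz⟩ := hfac h2 c2 z2 fun t ht => ramp_eq_zero (by linarith) (by linarith)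
  refine ⟨cfcₙ h1 c, cfcₙ h2 c, y, z, ⟨?_, ?_, ?_, ?_, ?_⟩, hy, hz, ?_⟩
  · exact cfcₙ_nonneg fun x _ => ramp_nonneg _ _ _
  · exact norm_cfcₙ_le fun x _ => by
      rw [Real.norm_of_nonneg (ramp_nonneg _ _ _)]; exact ramp_le_one _ _ _
  · exact cfcₙ_nonneg fun x _ => ramp_nonneg _ _ _
  · rw [← cfcₙ_mul h1 h2 c c1.continuousOn z1 c2.continuousOn z2]
    refine congrArg (cfcₙ · c) (funext fun t => ?_)
    rcases le_total t (r - η / 2) with ht | ht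
    · have : h2 t = 0 := ramp_eq_zero (by linarith) ht
      simp [this]
    · have : h1 t = 1 := ramp_eq_one (by linarith) ht
      simp [this]
  · intro h0
    have := norm_apply_le_norm_cfcₙ h2 c hrspec c2.continuousOn z2 hsa
    rw [h0, norm_zero, show h2 r = 1 from ramp_eq_one (by linarith) le_rfl] at this
    norm_num at this
  · have e1 := cfcₙ_mul (fun t : ℝ => t) h1 c (by fun_prop) rfl c1.continuousOn z1
    rw [cfcₙ_id' ℝ c] at e1
    have e2 := cfcₙ_smul r h1 c c1.continuousOn z1
    rw [← e1, ← e2, ← cfcₙ_sub _ _ c (by fun_prop) (by simp) (by fun_prop) (by simp [z1])]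
    refine norm_cfcₙ_le fun x hx => ?_
    rcases le_total x (r - η) with ht | ht
    · have : h1 x = 0 := ramp_eq_zero (by linarith) ht
      simp [this, hδ.le]
    · have e3 : x * h1 x - r • h1 x = (x - r) * h1 x := by rw [smul_eq_mul]; ring
      have h3 := (hspec x hx).2
      rw [e3, norm_mul, Real.norm_eq_abs, Real.norm_of_nonneg (ramp_nonneg _ _ _)]
      refine (mul_le_of_le_one_right (abs_nonneg _) (ramp_le_one _ _ _)).trans ?_
      rw [abs_le]; constructor <;> linarith

end Excision

section Excision

variable {D : Type*} [NonUnitalCStarAlgebra D] [PartialOrder D] [StarOrderedRing D]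

lemma mul_self_le_of_norm_le_one {m : D} (hm : 0 ≤ m) (h1 : ‖m‖ ≤ 1) : m * m ≤ m := by
  have hs : IsSelfAdjoint m := hm.isSelfAdjoint
  have h := cfcₙ_mul (fun t : ℝ => t) (fun t : ℝ => t) m
  rw [cfcₙ_id' ℝ m] at h
  have h2 := cfcₙ_sub (fun t : ℝ => t) (fun t : ℝ => t * t) m
  rw [h, cfcₙ_id' ℝ m] at h2
  rw [← sub_nonneg, ← h2]
  refine cfcₙ_nonneg fun x hx => ?_
  have h3 := quasispectrum_nonneg_of_nonneg m hm x hx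
  have h4 := (le_abs_self x).trans
    (NonUnitalIsometricContinuousFunctionalCalculus.norm_quasispectrum_le (𝕜 := ℝ) m hx hs)
  nlinarith

namespace IsExcisor

lemma exists_le {e e' : D} (he : IsExcisor e e') : ∃ m m', IsExcisor m m' ∧ e * m = m := by
  obtain ⟨m, m', y, z, h, rfl, -, -⟩ := exists_isExcisor he.nonneg' he.ne_zero one_pos
  exact ⟨_, m', h, by rw [← mul_assoc, he.mul_eq]⟩

lemma norm_sub_sq_le {d d' m m' b : D} (hd : IsExcisor d d') (hm : IsExcisor m m') (hb : 0 ≤ b) :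
    ‖b‖ * ‖d - m * d‖ ^ 2 ≤ ‖‖b‖ • (d * d) - d * (m * b * m) * d‖ := by
  have h1 : star (d - m * d) * (d - m * d) ≤ d * d - d * (m * m) * d := by
    rw [← sub_nonneg]
    have h2 : d * d - d * (m * m) * d - star (d - m * d) * (d - m * d) =
        star d * (m - m * m) * d + star d * (m - m * m) * d := by
      rw [star_sub, star_mul, hd.star_eq, hm.star_eq]; noncomm_ring
    have h3 := star_left_conjugate_nonneg
      (sub_nonneg.2 (mul_self_le_of_norm_le_one hm.nonneg hm.norm_le)) d
    rw [h2]
    exact add_nonneg h3 h3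
  have h4 : d * (m * b * m) * d ≤ ‖b‖ • (d * (m * m) * d) := by
    have := CStarAlgebra.star_left_conjugate_le_norm_smul (a := m * d) (b := b) hb.isSelfAdjoint
    rw [star_mul, hd.star_eq, hm.star_eq] at this
    simpa only [mul_assoc] using this
  have h5 : ‖b‖ • (star (d - m * d) * (d - m * d)) ≤ ‖b‖ • (d * d) - d * (m * b * m) * d := by
    refine (smul_le_smul_of_nonneg_left h1 (norm_nonneg b)).trans ?_
    rw [smul_sub]
    exact sub_le_sub_left h4 _
  have h6 := CStarAlgebra.norm_le_norm_of_nonneg_of_le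
    (smul_nonneg (norm_nonneg b) (star_mul_self_nonneg _)) h5
  rwa [norm_smul, norm_norm, CStarRing.norm_star_mul_self, ← sq] at h6

theorem exists_excise_nonneg {a : D} (ha : 0 ≤ a) {e e' : D} (he : IsExcisor e e') {ε : ℝ}
    (hε : 0 < ε) : ∃ d d', IsExcisor d d' ∧ e * d = d ∧
      ∃ r : ℝ, ‖d * a * d - r • (d * d)‖ ≤ ε := by
  let S : Set ℝ := {t | ∃ d d', IsExcisor d d' ∧ e * d = d ∧ t = ‖d * a * d‖}
  have hne : S.Nonempty := by
    obtain ⟨m, m', hm, hem⟩ := he.exists_le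
    exact ⟨_, m, m', hm, hem, rfl⟩
  have hbd : BddBelow S := ⟨0, by rintro _ ⟨d, -, -, -, rfl⟩; exact norm_nonneg _⟩
  obtain ⟨κ, hκ, hκε⟩ : ∃ κ : ℝ, 0 < κ ∧ 2 * ‖a‖ * κ ≤ ε / 2 := by
    refine ⟨ε / (4 * (‖a‖ + 1)), by positivity, ?_⟩
    have : 2 * ‖a‖ * (ε / (4 * (‖a‖ + 1))) = ε / 2 * (‖a‖ / (‖a‖ + 1)) := by field_simp; ring
    rw [this]
    exact mul_le_of_le_one_right (by positivity) ((div_le_one (by positivity)).2 (by linarith))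
  obtain ⟨η, hη, hηε, hηκ⟩ : ∃ η : ℝ, 0 < η ∧ η ≤ ε / 2 ∧ 2 * η ≤ ε * κ ^ 2 :=
    ⟨min (ε / 2) (ε * κ ^ 2 / 2), by positivity, min_le_left _ _, by
      linarith [min_le_right (ε / 2) (ε * κ ^ 2 / 2)]⟩
  obtain ⟨_, ⟨d₁, d₁', hd₁, hed₁, rfl⟩, hlt⟩ := exists_lt_of_csInf_lt hne
    (lt_add_of_pos_right (sInf S) hη)
  obtain ⟨m, m', hm, hdm⟩ := hd₁.exists_le
  have hem : e * m = m := by rw [← hdm, ← mul_assoc, hed₁]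
  set b := d₁ * a * d₁ with hb
  have hb0 : 0 ≤ b := by
    have := star_left_conjugate_nonneg ha d₁
    rwa [hd₁.star_eq] at this
  have hmd : m * d₁ = m := mul_eq_of_star hd₁.star_eq hm.star_eq hdm
  have hmam : m * a * m = m * b * m := by
    rw [hb]
    calc m * a * m = (m * d₁) * a * (d₁ * m) := by rw [hmd, hdm]
      _ = _ := by noncomm_ring
  have hle : sInf S ≤ ‖m * b * m‖ := csInf_le hbd ⟨m, m', hm, hem, by rw [hmam]⟩
  have hc0 : 0 ≤ m * b * m := by
    have := star_left_conjugate_nonneg hb0 m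
    rwa [hm.star_eq] at this
  have hrs : ‖m * b * m‖ ≤ ‖b‖ := by
    calc ‖m * b * m‖ ≤ ‖m‖ * ‖b‖ * ‖m‖ := norm_mul₃_le
      _ ≤ 1 * ‖b‖ * 1 := by gcongr <;> exact hm.norm_le
      _ = _ := by ring
  rcases le_or_gt ‖m * b * m‖ ε with hr | hr
  · exact ⟨m, m', hm, hem, 0, by rwa [zero_smul, sub_zero, hmam]⟩
  obtain ⟨d, d', y, z, hd, hdy, -, hcd⟩ := exists_isExcisor hc0
    (norm_pos_iff.1 (hε.trans hr)) hη
  set r := ‖m * b * m‖ with hrdef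
  refine ⟨d, d', hd, ?_, r, ?_⟩
  · rw [hdy]; simp only [← mul_assoc, hem]
  have hdd : ‖d * d‖ ≤ 1 := (norm_mul_le _ _).trans
    (mul_le_one₀ hd.norm_le (norm_nonneg _) hd.norm_le)
  have hdcd : ‖d * (m * b * m) * d - r • (d * d)‖ ≤ η := by
    have : d * (m * b * m) * d - r • (d * d) = d * ((m * b * m) * d - r • d) := by
      rw [mul_sub, mul_smul_comm, mul_assoc]
    rw [this]
    refine (norm_mul_le _ _).trans ?_
    exact (mul_le_of_le_one_left (norm_nonneg _) hd.norm_le).trans hcd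
  have hv : ‖d - m * d‖ ≤ κ := by
    have h1 := norm_sub_sq_le hd hm hb0
    have h2 : ‖b‖ • (d * d) - d * (m * b * m) * d =
        (‖b‖ - r) • (d * d) - (d * (m * b * m) * d - r • (d * d)) := by
      rw [sub_smul]; abel
    have h3 : ‖‖b‖ • (d * d) - d * (m * b * m) * d‖ ≤ 2 * η := by
      rw [h2]
      refine (norm_sub_le _ _).trans ?_
      rw [norm_smul, Real.norm_of_nonneg (by linarith)]
      nlinarith [norm_nonneg (d * d)]
    refine le_of_pow_le_pow_left₀ two_ne_zero hκ.le ?_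
    have h4 : ε * ‖d - m * d‖ ^ 2 ≤ ‖b‖ * ‖d - m * d‖ ^ 2 := by
      gcongr; linarith
    exact le_of_mul_le_mul_left (by linarith) hε
  have hsplit : d * a * d - r • (d * d) = star (d - m * d) * a * d + d * m * a * (d - m * d) +
      (d * (m * b * m) * d - r • (d * d)) := by
    rw [← hmam, star_sub, star_mul, hd.star_eq, hm.star_eq]; noncomm_ring
  have e1 : ‖star (d - m * d) * a * d‖ ≤ κ * ‖a‖ * 1 := by
    refine norm_mul₃_le.trans ?_
    rw [norm_star]
    gcongr
    exact hd.norm_le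
  have e2 : ‖d * m * a * (d - m * d)‖ ≤ (1 * 1) * ‖a‖ * κ := by
    refine norm_mul₃_le.trans ?_
    gcongr
    exact (norm_mul_le _ _).trans (by gcongr; exacts [hd.norm_le, hm.norm_le])
  rw [hsplit]
  refine (norm_add₃_le).trans ?_
  linarith

lemma norm_excise_le {a e d d' : D} {z : ℂ} {ε : ℝ} (he : star e = e) (hd : IsExcisor d d')
    (hed : e * d = d) (h : ‖e * a * e - z • (e * e)‖ ≤ ε) : ‖d * a * d - z • (d * d)‖ ≤ ε := by
  have hde : d * e = d := mul_eq_of_star he hd.star_eq hed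
  have : d * a * d - z • (d * d) = d * (e * a * e - z • (e * e)) * d := by
    calc _ = (d * e) * a * (e * d) - z • ((d * e) * (e * d)) := by rw [hde, hed]
      _ = _ := by simp only [mul_sub, sub_mul, mul_smul_comm, smul_mul_assoc, mul_assoc]
  rw [this]
  refine norm_mul₃_le.trans ?_
  calc _ ≤ 1 * ‖e * a * e - z • (e * e)‖ * 1 := by gcongr <;> exact hd.norm_le
    _ ≤ _ := by rw [one_mul, mul_one]; exact h

theorem exists_excise (a : D) {ε : ℝ} (hε : 0 < ε) {e e' : D} (he : IsExcisor e e') :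
    ∃ d d', IsExcisor d d' ∧ e * d = d ∧ ∃ z : ℂ, ‖d * a * d - z • (d * d)‖ ≤ ε := by
  have ha : a ∈ Submodule.span ℂ {a : D | 0 ≤ a} := by
    rw [CStarAlgebra.span_nonneg]; trivial
  induction ha using Submodule.span_induction generalizing ε e e' with
  | mem a ha =>
    obtain ⟨d, d', hd, hed, r, hr⟩ := exists_excise_nonneg ha he hε
    exact ⟨d, d', hd, hed, r, by rwa [Complex.coe_smul]⟩
  | zero =>
    obtain ⟨d, d', hd, hed⟩ := he.exists_le
    exact ⟨d, d', hd, hed, 0, by simpa using hε.le⟩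
  | add a b _ _ iha ihb =>
    obtain ⟨d₁, d₁', hd₁, hed₁, z, hz⟩ := iha (half_pos hε) he
    obtain ⟨d, d', hd, hed, w, hw⟩ := ihb (half_pos hε) hd₁
    refine ⟨d, d', hd, by rw [← hed, ← mul_assoc, hed₁], z + w, ?_⟩
    have : d * (a + b) * d - (z + w) • (d * d) =
        (d * a * d - z • (d * d)) + (d * b * d - w • (d * d)) := by
      rw [mul_add, add_mul, add_smul]; abel
    rw [this]
    exact (norm_add_le _ _).trans (by linarith [norm_excise_le hd₁.star_eq hd hed hz])
  | smul c a _ iha =>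
    obtain ⟨d, d', hd, hed, z, hz⟩ := iha (ε := ε / (‖c‖ + 1)) (by positivity) he
    refine ⟨d, d', hd, hed, c * z, ?_⟩
    have : d * (c • a) * d - (c * z) • (d * d) = c • (d * a * d - z • (d * d)) := by
      rw [mul_smul_comm, smul_mul_assoc, smul_sub, mul_smul]
    rw [this, norm_smul]
    rw [le_div_iff₀ (by positivity)] at hz
    nlinarith [norm_nonneg (d * a * d - z • (d * d))]

theorem exists_excise_finset {ι : Type*} (s : Finset ι) (a : ι → D) {ε : ℝ} (hε : 0 < ε)
    {e e' : D} (he : IsExcisor e e') : ∃ d d', IsExcisor d d' ∧ e * d = d ∧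
      ∃ z : ι → ℂ, ∀ i ∈ s, ‖d * a i * d - z i • (d * d)‖ ≤ ε := by
  classical
  induction s using Finset.induction_on with
  | empty =>
    obtain ⟨d, d', hd, hed⟩ := he.exists_le
    exact ⟨d, d', hd, hed, 0, by simp⟩
  | insert i s hi ih =>
    obtain ⟨d₁, d₁', hd₁, hed₁, z, hz⟩ := ih
    obtain ⟨d, d', hd, hed, w, hw⟩ := exists_excise (a i) hε hd₁
    refine ⟨d, d', hd, by rw [← hed, ← mul_assoc, hed₁], Function.update z i w, fun j hj => ?_⟩
    rcases Finset.mem_insert.1 hj with rfl | hj'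
    · rwa [Function.update_self]
    · rw [Function.update_of_ne (by rintro rfl; exact hi hj')]
      exact norm_excise_le hd₁.star_eq hd hed (hz j hj')

end IsExcisor

end Excision

section TensorMaps

open Filter Topology

lemma exists_approximate_unit_filter (D : Type*) [NonUnitalCStarAlgebra D] :
    ∃ l : Filter D, l.NeBot ∧ (∀ᶠ u in l, ‖u‖ ≤ 1) ∧ (∀ a, Tendsto (fun u => u * a) l (𝓝 a)) ∧
      ∀ a, Tendsto (fun u => a * u) l (𝓝 a) := by
  let _ := CStarAlgebra.spectralOrder D
  have := CStarAlgebra.spectralOrderedRing D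
  have hl := CStarAlgebra.increasingApproximateUnit D
  exact ⟨_, hl.neBot, hl.eventually_norm, hl.tendsto_mul_right, hl.tendsto_mul_left⟩

/-- Left multiplication as a continuous linear map. -/
noncomputable abbrev lmul {D : Type*} [NonUnitalCStarAlgebra D] (a : D) : D →L[ℂ] D :=
  ContinuousLinearMap.mul ℂ D a

/-- Right multiplication as a continuous linear map. -/
noncomputable abbrev rmul {D : Type*} [NonUnitalCStarAlgebra D] (a : D) : D →L[ℂ] D :=
  (ContinuousLinearMap.mul ℂ D).flip a

lemma norm_lmul_le {D : Type*} [NonUnitalCStarAlgebra D] (a : D) : ‖lmul a‖ ≤ ‖a‖ :=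
  ContinuousLinearMap.opNorm_mul_apply_le ℂ D a

lemma norm_rmul_le {D : Type*} [NonUnitalCStarAlgebra D] (a : D) : ‖rmul a‖ ≤ ‖a‖ :=
  ContinuousLinearMap.opNorm_le_bound _ (norm_nonneg a) fun x => by
    rw [mul_comm]; exact norm_mul_le x a

namespace CStarProjTensor

variable {A B : Type u} [NonUnitalCStarAlgebra A] [NonUnitalCStarAlgebra B]
  (P : CStarProjTensor A B)

lemma exists_map (α : A →L[ℂ] A) (β : B →L[ℂ] B) :
    ∃ M : P.T →L[ℂ] P.T, (∀ a b, M (P.tmul a b) = P.tmul (α a) (β b)) ∧ ‖M‖ ≤ ‖α‖ * ‖β‖ := by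
  obtain ⟨M, h1, h2⟩ := P.lift P.T (P.tmulL.bilinearComp α β)
  refine ⟨M, h1, h2.trans (ContinuousLinearMap.opNorm_le_bound₂ _ (by positivity) fun a b => ?_)⟩
  rw [ContinuousLinearMap.bilinearComp_apply, tmulL_apply, P.norm_tmul]
  calc _ ≤ (‖α‖ * ‖a‖) * (‖β‖ * ‖b‖) := by gcongr <;> exact ContinuousLinearMap.le_opNorm _ _
    _ = _ := by ring

/-- The tensor product of two bounded linear maps. -/
noncomputable def map (α : A →L[ℂ] A) (β : B →L[ℂ] B) : P.T →L[ℂ] P.T := (P.exists_map α β).choose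

@[simp] lemma map_tmul (α : A →L[ℂ] A) (β : B →L[ℂ] B) (a : A) (b : B) :
    P.map α β (P.tmul a b) = P.tmul (α a) (β b) := (P.exists_map α β).choose_spec.1 a b

lemma norm_map_le (α : A →L[ℂ] A) (β : B →L[ℂ] B) : ‖P.map α β‖ ≤ ‖α‖ * ‖β‖ :=
  (P.exists_map α β).choose_spec.2

lemma norm_map_apply_le {α : A →L[ℂ] A} {β : B →L[ℂ] B} (hα : ‖α‖ ≤ 1) (hβ : ‖β‖ ≤ 1) (x : P.T) :
    ‖P.map α β x‖ ≤ ‖x‖ :=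
  (P.map α β).le_of_opNorm_le ((P.norm_map_le α β).trans (mul_le_one₀ hα (norm_nonneg _) hβ)) x
    |>.trans (one_mul _).le

lemma dense_induction {p : P.T → Prop} (x : P.T) (hc : IsClosed {x | p x})
    (h0 : p 0) (hadd : ∀ x y, p x → p y → p (x + y)) (ht : ∀ a b, p (P.tmul a b)) : p x := by
  have hx : x ∈ closure (Submodule.span ℂ {t : P.T | ∃ a b, t = P.tmul a b} : Set P.T) := by
    rw [P.span_dense]; trivial
  refine closure_minimal (fun y hy => ?_) hc hx
  obtain ⟨n, c, g, rfl⟩ := Submodule.mem_span_set'.1 hy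
  refine Finset.sum_induction _ p hadd h0 fun i _ => ?_
  obtain ⟨a, b, h⟩ := (g i).2
  rw [h, ← LinearMap.smul_apply, ← map_smul]
  exact ht _ _

lemma tendsto_map {ι : Type*} {l : Filter ι} {α : ι → A →L[ℂ] A} {β : ι → B →L[ℂ] B}
    (hα : ∀ᶠ i in l, ‖α i‖ ≤ 1) (hβ : ∀ᶠ i in l, ‖β i‖ ≤ 1)
    (ha : ∀ a, Tendsto (fun i => α i a) l (𝓝 a)) (hb : ∀ b, Tendsto (fun i => β i b) l (𝓝 b))
    (x : P.T) : Tendsto (fun i => P.map (α i) (β i) x) l (𝓝 x) := by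
  refine P.dense_induction (p := fun x => Tendsto (fun i => P.map (α i) (β i) x) l (𝓝 x)) x
    ?_ ?_ ?_ ?_
  · refine isClosed_of_closure_subset fun x hx => ?_
    refine Metric.tendsto_nhds.2 fun ε hε => ?_
    obtain ⟨y, hy, hxy⟩ := Metric.mem_closure_iff.1 hx (ε / 4) (by positivity)
    filter_upwards [hα, hβ, Metric.tendsto_nhds.1 hy (ε / 4) (by positivity)] with i h1 h2 h3
    have h4 := P.norm_map_apply_le h1 h2 (x - y)
    rw [map_sub] at h4
    rw [dist_eq_norm] at *
    have : P.map (α i) (β i) x - x = (P.map (α i) (β i) x - P.map (α i) (β i) y) +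
        (P.map (α i) (β i) y - y) + (y - x) := by abel
    rw [this]
    refine norm_add₃_le.trans_lt ?_
    rw [norm_sub_rev y x]
    linarith
  · simpa only [map_zero] using tendsto_const_nhds
  · intro x y hx hy; simpa only [map_add] using hx.add hy
  · intro a b
    have h : Tendsto (fun i => P.tmulL (α i a)) l (𝓝 (P.tmulL a)) :=
      (P.tmulL.continuous.tendsto a).comp (ha a)
    have h' := (isBoundedBilinearMap_apply (𝕜 := ℂ).continuous.tendsto
      (P.tmulL a, b)).comp (h.prodMk_nhds (hb b))
    simp only [map_tmul]
    exact h'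

lemma tmul_mul_eq_map (a : A) (b : B) (x : P.T) : P.tmul a b * x = P.map (lmul a) (lmul b) x := by
  refine P.dense_induction (p := fun x => P.tmul a b * x = P.map (lmul a) (lmul b) x) x
    (isClosed_eq (by fun_prop) (by fun_prop)) (by simp) ?_ ?_
  · intro x y hx hy; rw [mul_add, hx, hy, map_add]
  · intro a' b'; simp [P.tmul_mul]

lemma mul_tmul_eq_map (a : A) (b : B) (x : P.T) : x * P.tmul a b = P.map (rmul a) (rmul b) x := by
  refine P.dense_induction (p := fun x => x * P.tmul a b = P.map (rmul a) (rmul b) x) x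
    (isClosed_eq (by fun_prop) (by fun_prop)) (by simp) ?_ ?_
  · intro x y hx hy; rw [add_mul, hx, hy, map_add]
  · intro a' b'; simp [P.tmul_mul]

lemma map_map (α α' : A →L[ℂ] A) (β β' : B →L[ℂ] B) (x : P.T) :
    P.map α β (P.map α' β' x) = P.map (α.comp α') (β.comp β') x := by
  refine P.dense_induction
    (p := fun x => P.map α β (P.map α' β' x) = P.map (α.comp α') (β.comp β') x) x
    (isClosed_eq (by fun_prop) (by fun_prop)) (by simp) ?_ ?_
  · intro x y hx hy; simp only [map_add, hx, hy]
  · intro a' b'; simp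

lemma exists_left_unit (x : P.T) (ε : ℝ) (hε : 0 < ε) : ∃ e, ‖x - e * x‖ < ε := by
  obtain ⟨l, hl, h1, h2, -⟩ := exists_approximate_unit_filter A
  obtain ⟨k, hk, h3, h4, -⟩ := exists_approximate_unit_filter B
  have h := P.tendsto_map (l := l ×ˢ k) (α := fun p => lmul p.1) (β := fun p => lmul p.2)
    (h1.prod_inl k |>.mono fun p hp => (norm_lmul_le _).trans hp)
    (h3.prod_inr l |>.mono fun p hp => (norm_lmul_le _).trans hp)
    (fun a => (h2 a).comp tendsto_fst) (fun b => (h4 b).comp tendsto_snd) x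
  obtain ⟨p, hp⟩ := (Metric.tendsto_nhds.1 h ε hε).exists
  refine ⟨P.tmul p.1 p.2, ?_⟩
  rwa [tmul_mul_eq_map, ← dist_eq_norm, dist_comm]

section ideal

variable {P} {I : Submodule ℂ P.T}

lemma map_lmul_id_mem (hI : IsClosedIdeal I) (a : A) {x : P.T} (hx : x ∈ I) :
    P.map (lmul a) (.id ℂ B) x ∈ I := by
  obtain ⟨k, hk, h3, h4, -⟩ := exists_approximate_unit_filter B
  have h := P.tendsto_map (l := k) (α := fun _ => .id ℂ A) (β := fun v => lmul v)
    (.of_forall fun _ => ContinuousLinearMap.norm_id_le)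
    (h3.mono fun p hp => (norm_lmul_le _).trans hp) (fun a => tendsto_const_nhds) h4 x
  refine hI.isClosed.mem_of_tendsto (((P.map (lmul a) (.id ℂ B)).continuous.tendsto x).comp h)
    (.of_forall fun v => ?_)
  have := hI.mul_left (P.tmul a v) hx
  rw [tmul_mul_eq_map] at this
  rw [Function.comp_apply, map_map]
  exact this

lemma map_rmul_id_mem (hI : IsClosedIdeal I) (a : A) {x : P.T} (hx : x ∈ I) :
    P.map (rmul a) (.id ℂ B) x ∈ I := by
  obtain ⟨k, hk, h3, -, h4⟩ := exists_approximate_unit_filter B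
  have h := P.tendsto_map (l := k) (α := fun _ => .id ℂ A) (β := fun v => rmul v)
    (.of_forall fun _ => ContinuousLinearMap.norm_id_le)
    (h3.mono fun p hp => (norm_rmul_le _).trans hp) (fun a => tendsto_const_nhds) h4 x
  refine hI.isClosed.mem_of_tendsto (((P.map (rmul a) (.id ℂ B)).continuous.tendsto x).comp h)
    (.of_forall fun v => ?_)
  have := hI.mul_right (P.tmul a v) hx
  rw [mul_tmul_eq_map] at this
  rw [Function.comp_apply, map_map]
  exact this

lemma map_id_lmul_mem (hI : IsClosedIdeal I) (b : B) {x : P.T} (hx : x ∈ I) :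
    P.map (.id ℂ A) (lmul b) x ∈ I := by
  obtain ⟨k, hk, h3, h4, -⟩ := exists_approximate_unit_filter A
  have h := P.tendsto_map (l := k) (α := fun v => lmul v) (β := fun _ => .id ℂ B)
    (h3.mono fun p hp => (norm_lmul_le _).trans hp)
    (.of_forall fun _ => ContinuousLinearMap.norm_id_le) h4 (fun a => tendsto_const_nhds) x
  refine hI.isClosed.mem_of_tendsto (((P.map (.id ℂ A) (lmul b)).continuous.tendsto x).comp h)
    (.of_forall fun v => ?_)
  have := hI.mul_left (P.tmul v b) hx
  rw [tmul_mul_eq_map] at this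
  rw [Function.comp_apply, map_map]
  exact this

lemma map_id_rmul_mem (hI : IsClosedIdeal I) (b : B) {x : P.T} (hx : x ∈ I) :
    P.map (.id ℂ A) (rmul b) x ∈ I := by
  obtain ⟨k, hk, h3, -, h4⟩ := exists_approximate_unit_filter A
  have h := P.tendsto_map (l := k) (α := fun v => rmul v) (β := fun _ => .id ℂ B)
    (h3.mono fun p hp => (norm_rmul_le _).trans hp)
    (.of_forall fun _ => ContinuousLinearMap.norm_id_le) h4 (fun a => tendsto_const_nhds) x
  refine hI.isClosed.mem_of_tendsto (((P.map (.id ℂ A) (rmul b)).continuous.tendsto x).comp h)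
    (.of_forall fun v => ?_)
  have := hI.mul_right (P.tmul v b) hx
  rw [mul_tmul_eq_map] at this
  rw [Function.comp_apply, map_map]
  exact this

end ideal

end CStarProjTensor

end TensorMaps

section IdealSum

open Filter Topology Pointwise

/-- The sum of two closed subspaces is closed as soon as contractions into the first one that
preserve the second one approximate the identity pointwise on the first one. -/
lemma Submodule.isClosed_sup_of_contractions {E : Type*} [NormedAddCommGroup E] [NormedSpace ℂ E]
    [CompleteSpace E] {L R : Submodule ℂ E} (hL : IsClosed (L : Set E)) (hR : IsClosed (R : Set E))
    (h : ∀ x ∈ L, ∀ ε : ℝ, 0 < ε → ∃ N : E →L[ℂ] E, (∀ y, N y ∈ L) ∧ (∀ y ∈ R, N y ∈ R) ∧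
      (∀ y, ‖N y‖ ≤ ‖y‖) ∧ ‖x - N x‖ ≤ ε) :
    IsClosed ((L ⊔ R : Submodule ℂ E) : Set E) := by
  have : CompleteSpace L := hL.completeSpace_coe
  have : CompleteSpace R := hR.completeSpace_coe
  let f : NormedAddGroupHom (L × R) E :=
    ⟨fun p => (p.1 : E) + p.2, fun p q => by
        simp only [Prod.fst_add, Prod.snd_add, Submodule.coe_add]
        exact add_add_add_comm _ _ _ _, 2, fun p => by
        refine (norm_add_le _ _).trans ?_
        have h1 : ‖(p.1 : E)‖ ≤ ‖p‖ := norm_fst_le p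
        have h2 : ‖(p.2 : E)‖ ≤ ‖p‖ := norm_snd_le p
        linarith⟩
  have hyp : f.SurjectiveOnWith (L ⊔ R).toAddSubgroup 3 := by
    intro s hs
    by_cases hs0 : s = 0
    · exact ⟨0, by simp [hs0], by simp [hs0]⟩
    obtain ⟨l, hl, r, hr, rfl⟩ := Submodule.mem_sup.1 hs
    obtain ⟨N, h1, h2, h3, h4⟩ := h l hl ‖l + r‖ (norm_pos_iff.2 hs0)
    refine ⟨(⟨N (l + r) + (l - N l), L.add_mem (h1 _) (L.sub_mem hl (h1 _))⟩,
      ⟨r - N r, R.sub_mem hr (h2 _ hr)⟩), ?_, ?_⟩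
    · change N (l + r) + (l - N l) + (r - N r) = l + r
      rw [map_add]; abel
    · have h5 : ‖N (l + r) + (l - N l)‖ ≤ 2 * ‖l + r‖ :=
        (norm_add_le _ _).trans (by linarith [h3 (l + r)])
      have h6 : ‖r - N r‖ ≤ 3 * ‖l + r‖ := by
        have : r - N r = (l + r) - (N (l + r) + (l - N l)) := by rw [map_add]; abel
        rw [this]
        exact (norm_sub_le _ _).trans (by linarith)
      exact max_le (h5.trans (by nlinarith [norm_nonneg (l + r)])) h6
  have hc := controlled_closure_of_complete (by norm_num : (0 : ℝ) < 3) one_pos hyp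
  refine isClosed_of_closure_subset fun x hx => ?_
  obtain ⟨p, rfl, -⟩ := hc x hx
  exact Submodule.add_mem_sup p.1.2 p.2.2

namespace CStarProjTensor

variable {A B : Type u} [NonUnitalCStarAlgebra A] [NonUnitalCStarAlgebra B]
  (P : CStarProjTensor A B)

/-- The closed subspace `J ⊗̂ B`. -/
def leftSub (J : Submodule ℂ A) : Submodule ℂ P.T :=
  (Submodule.span ℂ {t : P.T | ∃ a ∈ (J : Set A), ∃ b : B, t = P.tmul a b}).topologicalClosure

/-- The closed subspace `A ⊗̂ K`. -/
def rightSub (K : Submodule ℂ B) : Submodule ℂ P.T :=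
  (Submodule.span ℂ {t : P.T | ∃ a : A, ∃ b ∈ (K : Set B), t = P.tmul a b}).topologicalClosure

lemma coe_leftSub (J : Submodule ℂ A) : (P.leftSub J : Set P.T) = leftTensorIdeal P (J : Set A) :=
  rfl

lemma coe_rightSub (K : Submodule ℂ B) :
    (P.rightSub K : Set P.T) = rightTensorIdeal P (K : Set B) := rfl

/-- The subspace `J ⊗̂ B + A ⊗̂ K`. -/
def sumSub (J : Submodule ℂ A) (K : Submodule ℂ B) : Submodule ℂ P.T := P.leftSub J ⊔ P.rightSub K

lemma coe_sumSub (J : Submodule ℂ A) (K : Submodule ℂ B) :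
    (P.sumSub J K : Set P.T) =
      leftTensorIdeal P (J : Set A) + rightTensorIdeal P (K : Set B) := by
  rw [sumSub, Submodule.coe_sup, coe_leftSub, coe_rightSub]

variable {P} {J : Submodule ℂ A} {K : Submodule ℂ B}

lemma tmul_mem_leftSub {a : A} (ha : a ∈ J) (b : B) : P.tmul a b ∈ P.leftSub J :=
  subset_closure (Submodule.subset_span ⟨a, ha, b, rfl⟩)

lemma tmul_mem_rightSub (a : A) {b : B} (hb : b ∈ K) : P.tmul a b ∈ P.rightSub K :=
  subset_closure (Submodule.subset_span ⟨a, b, hb, rfl⟩)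

lemma leftSub_map_mem (M : P.T →L[ℂ] P.T) {S : Submodule ℂ P.T} (hS : IsClosed (S : Set P.T))
    (h : ∀ a ∈ J, ∀ b, M (P.tmul a b) ∈ S) {x : P.T} (hx : x ∈ P.leftSub J) : M x ∈ S := by
  refine Submodule.topologicalClosure_minimal (t := S.comap (M : P.T →ₗ[ℂ] P.T)) _
    (Submodule.span_le.2 ?_) (hS.preimage M.continuous) hx
  rintro _ ⟨a, ha, b, rfl⟩
  exact h a ha b

lemma rightSub_map_mem (M : P.T →L[ℂ] P.T) {S : Submodule ℂ P.T} (hS : IsClosed (S : Set P.T))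
    (h : ∀ a, ∀ b ∈ K, M (P.tmul a b) ∈ S) {x : P.T} (hx : x ∈ P.rightSub K) : M x ∈ S := by
  refine Submodule.topologicalClosure_minimal (t := S.comap (M : P.T →ₗ[ℂ] P.T)) _
    (Submodule.span_le.2 ?_) (hS.preimage M.continuous) hx
  rintro _ ⟨a, b, hb, rfl⟩
  exact h a b hb

lemma isClosed_leftSub : IsClosed (P.leftSub J : Set P.T) := isClosed_closure

lemma isClosed_rightSub : IsClosed (P.rightSub K : Set P.T) := isClosed_closure

lemma sumSub_le {S : Submodule ℂ P.T} (hS : IsClosed (S : Set P.T))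
    (hJ : ∀ a ∈ J, ∀ b, P.tmul a b ∈ S) (hK : ∀ a, ∀ b ∈ K, P.tmul a b ∈ S) :
    P.sumSub J K ≤ S :=
  sup_le (fun _ hx => leftSub_map_mem (.id ℂ P.T) hS hJ hx)
    fun _ hx => rightSub_map_mem (.id ℂ P.T) hS hK hx

lemma mul_mem_of_tmul_mem {S : Submodule ℂ P.T} (hS : IsClosed (S : Set P.T)) {x : P.T}
    (h : ∀ a b, P.tmul a b * x ∈ S) (r : P.T) : r * x ∈ S :=
  P.dense_induction (p := fun r => r * x ∈ S) r
    (hS.preimage (continuous_id.mul continuous_const)) (by rw [zero_mul]; exact S.zero_mem)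
    (fun x y hx hy => by rw [add_mul]; exact S.add_mem hx hy) h

lemma mem_mul_of_mem_tmul {S : Submodule ℂ P.T} (hS : IsClosed (S : Set P.T)) {x : P.T}
    (h : ∀ a b, x * P.tmul a b ∈ S) (r : P.T) : x * r ∈ S :=
  P.dense_induction (p := fun r => x * r ∈ S) r
    (hS.preimage (continuous_const.mul continuous_id)) (by rw [mul_zero]; exact S.zero_mem)
    (fun x y hx hy => by rw [mul_add]; exact S.add_mem hx hy) h

lemma isClosed_sumSub (hJ : IsClosedIdeal J) : IsClosed (P.sumSub J K : Set P.T) := by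
  refine Submodule.isClosed_sup_of_contractions isClosed_leftSub isClosed_rightSub
    fun x hx ε hε => ?_
  have hid : ‖ContinuousLinearMap.id ℂ B‖ ≤ 1 := ContinuousLinearMap.norm_id_le
  obtain ⟨y, hy, hxy⟩ := Metric.mem_closure_iff.1 hx (ε / 3) (by positivity)
  obtain ⟨n, c, g, rfl⟩ := Submodule.mem_span_set'.1 hy
  choose a ha b hab using fun i => (g i).2
  classical
  set M : ℝ := ∑ i, ‖c i‖ * ‖b i‖ with hM
  have hM0 : 0 ≤ M := by positivity
  obtain ⟨u, v, hu, huv, hu1, hua⟩ := hJ.exists_unit (Finset.univ.image a)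
    (by simpa using ha) (ε := ε / 3 / (M + 1)) (by positivity)
  have hlu : ‖lmul u‖ ≤ 1 := (norm_lmul_le u).trans hu1
  refine ⟨P.map (lmul u) (.id ℂ B), fun y => ?_, fun y hy => ?_,
    fun y => P.norm_map_apply_le hlu hid y, ?_⟩
  · refine P.dense_induction (p := fun y => P.map (lmul u) (.id ℂ B) y ∈ P.leftSub J) y
      (isClosed_leftSub.preimage (ContinuousLinearMap.continuous _))
      (by rw [map_zero]; exact Submodule.zero_mem _)
      (fun x y hx hy => by rw [map_add]; exact Submodule.add_mem _ hx hy) fun a b => ?_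
    rw [map_tmul]
    exact tmul_mem_leftSub (hJ.mul_right a hu) _
  · refine rightSub_map_mem _ isClosed_rightSub (fun a b hb => ?_) hy
    rw [map_tmul]
    exact tmul_mem_rightSub _ hb
  · set N := P.map (lmul u) (.id ℂ B) with hN
    set y : P.T := ∑ i, c i • (g i : P.T) with hyd
    have h1 : ‖y - N y‖ ≤ ε / 3 := by
      have : y - N y = ∑ i, c i • P.tmul (a i - u * a i) (b i) := by
        simp only [hyd, hab, map_sum, map_smul, ← Finset.sum_sub_distrib, hN, map_tmul, map_sub,
          LinearMap.sub_apply, smul_sub]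
        rfl
      rw [this]
      refine (norm_sum_le _ _).trans ?_
      calc _ ≤ ∑ i, ‖c i‖ * ‖b i‖ * (ε / 3 / (M + 1)) := by
            refine Finset.sum_le_sum fun i _ => ?_
            rw [norm_smul, P.norm_tmul, mul_assoc, mul_comm ‖b i‖]
            gcongr
            exact (hua _ (Finset.mem_image_of_mem a (Finset.mem_univ i))).2.le
        _ = M * (ε / 3 / (M + 1)) := by rw [← Finset.sum_mul]
        _ ≤ (M + 1) * (ε / 3 / (M + 1)) := by gcongr; linarith
        _ = ε / 3 := mul_div_cancel₀ _ (by positivity)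
    have h2 : x - N x = (x - y) + (y - N y) + N (y - x) := by rw [map_sub]; abel
    rw [h2]
    refine norm_add₃_le.trans ?_
    have h3 : ‖N (y - x)‖ ≤ ‖y - x‖ := P.norm_map_apply_le hlu hid _
    rw [dist_eq_norm] at hxy
    rw [norm_sub_rev y x] at h3
    linarith

lemma isClosedIdeal_sumSub (hJ : IsClosedIdeal J) (hK : IsClosedIdeal K) :
    IsClosedIdeal (P.sumSub J K) := by
  refine ⟨isClosed_sumSub hJ, fun r x hx => ?_, fun r x hx => ?_⟩
  all_goals
    obtain ⟨l, hl, m, hm, rfl⟩ := Submodule.mem_sup.1 hx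
    first | rw [mul_add] | rw [add_mul]
    refine Submodule.add_mem_sup ?_ ?_
  · refine mul_mem_of_tmul_mem isClosed_leftSub (fun a b => ?_) r
    rw [tmul_mul_eq_map]
    refine leftSub_map_mem _ isClosed_leftSub (fun a' ha' b' => ?_) hl
    rw [map_tmul]; exact tmul_mem_leftSub (hJ.mul_left a ha') _
  · refine mul_mem_of_tmul_mem isClosed_rightSub (fun a b => ?_) r
    rw [tmul_mul_eq_map]
    refine rightSub_map_mem _ isClosed_rightSub (fun a' b' hb' => ?_) hm
    rw [map_tmul]; exact tmul_mem_rightSub _ (hK.mul_left b hb')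
  · refine mem_mul_of_mem_tmul isClosed_leftSub (fun a b => ?_) r
    rw [mul_tmul_eq_map]
    refine leftSub_map_mem _ isClosed_leftSub (fun a' ha' b' => ?_) hl
    rw [map_tmul]; exact tmul_mem_leftSub (hJ.mul_right a ha') _
  · refine mem_mul_of_mem_tmul isClosed_rightSub (fun a b => ?_) r
    rw [mul_tmul_eq_map]
    refine rightSub_map_mem _ isClosed_rightSub (fun a' b' hb' => ?_) hm
    rw [map_tmul]; exact tmul_mem_rightSub _ (hK.mul_right b hb')

lemma tmul_mem_sumSub_left {a : A} (ha : a ∈ J) (b : B) : P.tmul a b ∈ P.sumSub J K :=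
  Submodule.mem_sup_left (tmul_mem_leftSub ha b)

lemma tmul_mem_sumSub_right (a : A) {b : B} (hb : b ∈ K) : P.tmul a b ∈ P.sumSub J K :=
  Submodule.mem_sup_right (tmul_mem_rightSub a hb)

lemma mem_or_mem_of_tmul_mem_sumSub (hJ : IsClosed (J : Set A)) (hK : IsClosed (K : Set B))
    {a : A} {b : B} (h : P.tmul a b ∈ P.sumSub J K) : a ∈ J ∨ b ∈ K := by
  by_contra! hcon
  obtain ⟨ha, hb⟩ := hcon
  have hf : ∃ f : A →L[ℂ] ℂ, (∀ y ∈ J, f y = 0) ∧ f a ≠ 0 := by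
    by_contra! hf; exact ha (Submodule.mem_of_forall_dual hJ hf)
  have hg : ∃ g : B →L[ℂ] ℂ, (∀ y ∈ K, g y = 0) ∧ g b ≠ 0 := by
    by_contra! hg; exact hb (Submodule.mem_of_forall_dual hK hg)
  obtain ⟨f, hf, hfa⟩ := hf
  obtain ⟨g, hg, hgb⟩ := hg
  obtain ⟨φ, hφ, -⟩ := P.exists_lift_form
    ((ContinuousLinearMap.mul ℂ ℂ).bilinearComp f g)
  have : P.sumSub J K ≤ LinearMap.ker (φ : P.T →ₗ[ℂ] ℂ) := by
    refine sumSub_le (S := LinearMap.ker (φ : P.T →ₗ[ℂ] ℂ)) 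
      (isClosed_singleton.preimage φ.continuous) (fun a ha b => ?_) fun a b hb => ?_
    · change φ _ = 0; rw [hφ]; simp [hf a ha]
    · change φ _ = 0; rw [hφ]; simp [hg b hb]
  have h0 : φ (P.tmul a b) = 0 := this h
  rw [hφ] at h0
  simp [hfa, hgb] at h0

end CStarProjTensor

end IdealSum

section Slices

open Filter Topology

lemma IsClosedIdeal.mem_of_sub_mul_mem {R : Type*} [NonUnitalNormedRing R] [NormedSpace ℂ R]
    {I : Submodule ℂ R} (hI : IsClosedIdeal I) {s z : R} (hs : ‖s‖ < 1) (h : z - s * z ∈ I) :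
    z ∈ I := by
  let w : ℕ → R := fun n => (fun y => s * y)^[n] z
  have hw : ∀ n, w (n + 1) = s * w n := fun n => Function.iterate_succ_apply' _ n z
  have hmem : ∀ n, z - w n ∈ I := by
    intro n
    induction n with
    | zero => simp [w]
    | succ n ih =>
      rw [hw, show z - s * w n = (z - s * z) + s * (z - w n) by rw [mul_sub]; abel]
      exact I.add_mem h (hI.mul_left s ih)
  have hnorm : ∀ n, ‖w n‖ ≤ ‖s‖ ^ n * ‖z‖ := by
    intro n
    induction n with
    | zero => simp [w]
    | succ n ih =>
      rw [hw, pow_succ', mul_assoc]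
      exact (norm_mul_le _ _).trans (by gcongr)
  have h0 : Tendsto w atTop (𝓝 0) := by
    refine squeeze_zero_norm hnorm ?_
    simpa using (tendsto_pow_atTop_nhds_zero_of_lt_one (norm_nonneg s) hs).mul_const ‖z‖
  have h1 : Tendsto (fun n => z - w n) atTop (𝓝 z) := by simpa using h0.const_sub z
  exact hI.isClosed.mem_of_tendsto h1 (.of_forall hmem)

namespace CStarProjTensor

variable {A B : Type u} [NonUnitalCStarAlgebra A] [NonUnitalCStarAlgebra B]
  (P : CStarProjTensor A B)

lemma exists_slice (g : B →L[ℂ] ℂ) :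
    ∃ R : P.T →L[ℂ] A, (∀ a b, R (P.tmul a b) = g b • a) ∧ ‖R‖ ≤ ‖g‖ := by
  obtain ⟨R, h1, h2⟩ := P.lift A 
    (((ContinuousLinearMap.lsmul ℂ ℂ).flip : A →L[ℂ] ℂ →L[ℂ] A).bilinearComp (.id ℂ A) g)
  refine ⟨R, h1, h2.trans (ContinuousLinearMap.opNorm_le_bound₂ _ (norm_nonneg g) fun a b => ?_)⟩
  change ‖g b • a‖ ≤ _
  rw [norm_smul, mul_right_comm]
  gcongr
  exact g.le_opNorm b

lemma exists_finset_approx (x : P.T) {ε : ℝ} (hε : 0 < ε) : ∃ (ι : Type) (s : Finset ι) (a : ι → A)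
    (b : ι → B), ‖x - ∑ i ∈ s, P.tmul (a i) (b i)‖ ≤ ε := by
  obtain ⟨ι, a, b, -, -, h⟩ := P.exists_hasSum_tmul x
  rw [HasSum, SummationFilter.unconditional_filter] at h
  obtain ⟨s, hs⟩ := (Metric.tendsto_nhds.1 h ε hε).exists
  rw [dist_comm, dist_eq_norm] at hs
  exact ⟨ι, s, a, b, hs.le⟩

variable {P} {J : Submodule ℂ A} {K : Submodule ℂ B} {I : Submodule ℂ P.T}

/-- Membership in `J ⊗̂ B + A ⊗̂ K` can be tested by slicing with functionals vanishing on `K`. -/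
lemma mem_sumSub_of_slice (hJ : IsClosedIdeal J) (hK : IsClosedIdeal K) {x : P.T}
    (h : ∀ (g : B →L[ℂ] ℂ) (R : P.T →L[ℂ] A), (∀ b ∈ K, g b = 0) → ‖g‖ ≤ 1 →
      (∀ a b, R (P.tmul a b) = g b • a) → ‖R‖ ≤ 1 → R x ∈ J) : x ∈ P.sumSub J K := by
  refine Submodule.mem_of_forall_dual (isClosed_sumSub hJ) fun φ hφ => ?_
  obtain ⟨ι, a, b, ha, hb, hx⟩ := P.exists_hasSum_tmul x
  have h0 := hasSum_form_eq_zero ((ContinuousLinearMap.compL ℂ B _ _ φ).comp P.tmulL)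
    hJ.isClosed hK.isClosed (fun a ha b => hφ _ (tmul_mem_sumSub_left ha b))
    (fun a b hb => hφ _ (tmul_mem_sumSub_right a hb)) a b ha hb fun f g hf hg => ?_
  · exact (hx.mapL φ).unique h0
  · set c : ℂ := ((‖g‖ + 1 : ℝ) : ℂ) with hc
    have hc0 : c ≠ 0 := Complex.ofReal_ne_zero.2 (by positivity)
    have hcn : ‖c‖ = ‖g‖ + 1 := by rw [hc, Complex.norm_real, Real.norm_of_nonneg (by positivity)]
    have hg1 : ‖c⁻¹ • g‖ ≤ 1 := by
      rw [norm_smul, norm_inv, hcn, inv_mul_le_iff₀ (by positivity)]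
      linarith
    obtain ⟨R, hR, hRn⟩ := P.exists_slice (c⁻¹ • g)
    have hRx := hf _ (h (c⁻¹ • g) R (fun b hb => by simp [hg b hb]) hg1 hR (hRn.trans hg1))
    have hs := ((hx.mapL R).mapL f).mul_left c
    rw [hRx, mul_zero] at hs
    refine (funext fun i => ?_ : (fun i => f (a i) * g (b i)) = _) ▸ hs
    rw [hR, map_smul, smul_apply, smul_eq_mul, smul_eq_mul, ← mul_assoc, ← mul_assoc,
      mul_inv_cancel₀ hc0, one_mul, mul_comm]

lemma slice_map_lmul {g : B →L[ℂ] ℂ} {R : P.T →L[ℂ] A} (hR : ∀ a b, R (P.tmul a b) = g b • a)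
    (s : A) (x : P.T) : R (P.map (lmul s) (.id ℂ B) x) = s * R x :=
  P.dense_induction (p := fun x => R (P.map (lmul s) (.id ℂ B) x) = s * R x) x
    (isClosed_eq (by fun_prop) (by fun_prop)) (by simp)
    (fun x y hx hy => by simp only [map_add, hx, hy, mul_add])
    fun a b => by simp [hR, mul_smul_comm]

end CStarProjTensor

end Slices

section LeftExcision

open Filter Topology

namespace CStarProjTensor

variable {A B Q : Type u} [NonUnitalCStarAlgebra A] [NonUnitalCStarAlgebra B]
  [NonUnitalCStarAlgebra Q] {P : CStarProjTensor A B}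
  {J : Submodule ℂ A} {K : Submodule ℂ B} {I : Submodule ℂ P.T}

lemma norm_apply_le_of_vanish {q : B →⋆ₙₐ[ℂ] Q} (hq0 : ∀ b, q b = 0 ↔ b ∈ K)
    (hq : ∀ d (ε : ℝ), 0 < ε → ∃ b, q b = d ∧ ‖b‖ < ‖d‖ + ε) {g : B →L[ℂ] ℂ}
    (hg : ∀ b ∈ K, g b = 0) (hg1 : ‖g‖ ≤ 1) (b : B) : ‖g b‖ ≤ ‖q b‖ := by
  refine le_of_forall_pos_le_add fun ε hε => ?_
  obtain ⟨b', h1, h2⟩ := hq (q b) ε hε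
  have h3 : g b = g b' := by
    rw [← sub_eq_zero, ← map_sub]
    exact hg _ ((hq0 _).1 (by rw [map_sub, h1, sub_self]))
  rw [h3]
  exact (g.le_of_opNorm_le hg1 b').trans (by linarith)

/-- Excision in the left factor: an element of `I` which slices to `y⋆y` produces, up to a small
error, an elementary tensor in `I`. -/
lemma exists_excised_tmul (hI : IsClosedIdeal I) (hIS : P.sumSub J K ≤ I)
    {q : A →⋆ₙₐ[ℂ] Q} (hq0 : ∀ a, q a = 0 ↔ a ∈ J)
    (hq : ∀ d (ε : ℝ), 0 < ε → ∃ a, q a = d ∧ ‖a‖ < ‖d‖ + ε)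
    {g : B →L[ℂ] ℂ} {R : P.T →L[ℂ] A} (hR : ∀ a b, R (P.tmul a b) = g b • a)
    (hg1 : ‖g‖ ≤ 1) (hR1 : ‖R‖ ≤ 1) {x : P.T} (hx : x ∈ I) {y : A} (hy : R x = star y * y)
    (hyJ : y ∉ J) {ε : ℝ} (hε : 0 < ε) :
    ∃ (d d' : A) (b : B), ‖d‖ ≤ 2 ∧ d' ∉ J ∧ d * d' - d' ∈ J ∧
      (∃ i ∈ I, ‖P.tmul (d * d) b - i‖ ≤ ε) ∧ ‖g b - (‖q y‖ ^ 2 : ℝ)‖ ≤ ε := by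
  let _ := CStarAlgebra.spectralOrder Q
  have := CStarAlgebra.spectralOrderedRing Q
  obtain ⟨ι, s, a, b, hab⟩ := P.exists_finset_approx x (ε := ε / 8) (by positivity)
  set x' := ∑ i ∈ s, P.tmul (a i) (b i) with hx'
  set M := ∑ i ∈ s, ‖b i‖ with hM
  have hM0 : 0 ≤ M := by positivity
  set δ := ε / 8 / (M + 1) with hδ
  have hδ0 : 0 < δ := by positivity
  have hδM : M * δ ≤ ε / 8 := by
    have : (M + 1) * δ = ε / 8 := mul_div_cancel₀ _ (by positivity)
    linarith
  have hδ1 : δ ≤ ε / 8 := div_le_self (by positivity) (by linarith)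
  set c := q (star y * y) with hc
  have hc' : c = star (q y) * q y := by rw [hc, map_mul, map_star]
  have hcr : ‖c‖ = ‖q y‖ ^ 2 := by rw [hc', CStarRing.norm_star_mul_self, sq]
  have hqy : q y ≠ 0 := fun h => hyJ ((hq0 y).1 h)
  have hc0 : c ≠ 0 := norm_ne_zero_iff.1 (by rw [hcr]; positivity)
  obtain ⟨e, e', -, -, he, -, -, hce⟩ :=
    exists_isExcisor (hc' ▸ star_mul_self_nonneg (q y)) hc0 hδ0
  obtain ⟨f, f', hf, hef, z, hz⟩ := IsExcisor.exists_excise_finset s (fun i => q (a i)) hδ0 he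
  obtain ⟨d, hd, hdn⟩ := hq f 1 one_pos
  obtain ⟨d', hd', -⟩ := hq f' 1 one_pos
  have hd2 : ‖d‖ ≤ 2 := by linarith [hf.norm_le]
  refine ⟨d, d', ∑ i ∈ s, z i • b i, hd2, fun h => hf.ne_zero (hd' ▸ (hq0 d').2 h), ?_, ?_, ?_⟩
  · rw [← hq0, map_sub, map_mul, hd, hd', hf.mul_eq, sub_self]
  · have hk : ∀ i, ∃ k, q k = q (d * a i * d - z i • (d * d)) ∧
        ‖k‖ < ‖q (d * a i * d - z i • (d * d))‖ + δ := fun i => hq _ δ hδ0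
    choose k hk hkn using hk
    have hkd : ∀ i ∈ s, ‖k i‖ ≤ 2 * δ := fun i hi => by
      have := hz i hi
      have h := hkn i
      rw [map_sub, map_smul, map_mul, map_mul, map_mul, hd] at h
      linarith
    set N := P.map (lmul d) (.id ℂ B) with hN
    set N' := P.map (rmul d) (.id ℂ B) with hN'
    have hid : ‖ContinuousLinearMap.id ℂ B‖ ≤ 1 := ContinuousLinearMap.norm_id_le
    have hNn : ‖N‖ ≤ 2 := (P.norm_map_le _ _).trans (by
      calc _ ≤ 2 * (1 : ℝ) := by gcongr; exact (norm_lmul_le d).trans hd2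
        _ = 2 := by norm_num)
    have hNn' : ‖N'‖ ≤ 2 := (P.norm_map_le _ _).trans (by
      calc _ ≤ 2 * (1 : ℝ) := by gcongr; exact (norm_rmul_le d).trans hd2
        _ = 2 := by norm_num)
    have hsum : ∑ i ∈ s, P.tmul (d * a i * d - z i • (d * d) - k i) (b i) ∈ I :=
      I.sum_mem fun i _ => hIS (tmul_mem_sumSub_left ((hq0 _).1 (by
        rw [map_sub, hk i, sub_self])) _)
    refine ⟨N' (N x) - ∑ i ∈ s, P.tmul (d * a i * d - z i • (d * d) - k i) (b i),
      I.sub_mem (map_rmul_id_mem hI d (map_lmul_id_mem hI d hx)) hsum, ?_⟩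
    have hNx' : N' (N x') = ∑ i ∈ s, P.tmul (d * a i * d) (b i) := by
      simp only [hx', map_sum, hN, hN', map_tmul]
      rfl
    have key : P.tmul (d * d) (∑ i ∈ s, z i • b i) -
        (N' (N x) - ∑ i ∈ s, P.tmul (d * a i * d - z i • (d * d) - k i) (b i)) =
        - N' (N (x - x')) - ∑ i ∈ s, P.tmul (k i) (b i) := by
      rw [map_sub, map_sub, hNx']
      simp only [map_sub, LinearMap.sub_apply, Finset.sum_sub_distrib, map_smul,
        LinearMap.smul_apply, map_sum]
      abel
    rw [key]
    have h1 : ‖N' (N (x - x'))‖ ≤ 2 * (2 * (ε / 8)) :=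
      (N'.le_of_opNorm_le hNn' _).trans (by gcongr; exact (N.le_of_opNorm_le hNn _).trans (by gcongr))
    have h2 : ‖∑ i ∈ s, P.tmul (k i) (b i)‖ ≤ 2 * (M * δ) := by
      calc _ ≤ ∑ i ∈ s, 2 * δ * ‖b i‖ := norm_sum_le_of_le _ fun i hi => by
            rw [P.norm_tmul]; gcongr; exact hkd i hi
        _ = 2 * (M * δ) := by rw [← Finset.mul_sum]; ring
    calc _ ≤ ‖N' (N (x - x'))‖ + ‖∑ i ∈ s, P.tmul (k i) (b i)‖ := by
          refine (norm_sub_le _ _).trans ?_; rw [norm_neg]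
      _ ≤ _ := by linarith
  · set v := ∑ i ∈ s, g (b i) • q (a i) with hv
    have hRx' : q (R x') = v := by simp only [hx', map_sum, hR, map_smul, hv]
    have hvc : ‖c - v‖ ≤ ε / 8 := by
      rw [hc, ← hy, ← hRx', ← map_sub, ← map_sub]
      exact (NonUnitalStarAlgHom.norm_apply_le q _).trans
        ((R.le_of_opNorm_le hR1 _).trans (by rw [one_mul]; exact hab))
    have hgb : g (∑ i ∈ s, z i • b i) = ∑ i ∈ s, g (b i) * z i := by
      simp only [map_sum, map_smul, smul_eq_mul, mul_comm]
    rw [hgb, ← hcr]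
    set γ := ∑ i ∈ s, g (b i) * z i with hγ
    have hff : 1 ≤ ‖f * f‖ := by
      have h1 : f * f * f' = f' := by rw [mul_assoc, hf.mul_eq, hf.mul_eq]
      have h2 : ‖f'‖ ≤ ‖f * f‖ * ‖f'‖ := by simpa only [h1] using norm_mul_le (f * f) f'
      exact le_of_mul_le_mul_right (by linarith) (norm_pos_iff.2 hf.ne_zero)
    have hf1 := hf.norm_le
    have hcf : ‖f * c * f - (‖c‖ : ℂ) • (f * f)‖ ≤ ε / 8 := by
      have : f * c * f - (‖c‖ : ℂ) • (f * f) = f * (c * e - ‖c‖ • e) * f := by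
        rw [mul_sub, sub_mul, mul_assoc, mul_assoc, mul_assoc, hef, mul_smul_comm, smul_mul_assoc,
          mul_assoc, hef, Complex.coe_smul]
      rw [this]
      calc _ ≤ ‖f‖ * ‖c * e - ‖c‖ • e‖ * ‖f‖ := norm_mul₃_le
        _ ≤ 1 * (ε / 8) * 1 := by gcongr; exact hce.trans hδ1
        _ = ε / 8 := by ring
    have hvf : ‖f * v * f - γ • (f * f)‖ ≤ ε / 8 := by
      have : f * v * f - γ • (f * f) =
          ∑ i ∈ s, g (b i) • (f * q (a i) * f - z i • (f * f)) := by
        simp only [hv, hγ, Finset.mul_sum, Finset.sum_mul, Finset.sum_smul, smul_sub,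
          Finset.sum_sub_distrib, mul_smul_comm, smul_mul_assoc, mul_smul]
      rw [this]
      calc _ ≤ ∑ i ∈ s, ‖b i‖ * δ := norm_sum_le_of_le _ fun i hi => by
            rw [norm_smul]
            gcongr
            · exact (g.le_of_opNorm_le hg1 _).trans (one_mul _).le
            · exact hz i hi
        _ = M * δ := by rw [← Finset.sum_mul]
        _ ≤ _ := hδM
    have hcv : ‖f * (c - v) * f‖ ≤ ε / 8 :=
      calc _ ≤ ‖f‖ * ‖c - v‖ * ‖f‖ := norm_mul₃_le
        _ ≤ 1 * (ε / 8) * 1 := by gcongr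
        _ = ε / 8 := by ring
    have hfin : (γ - (‖c‖ : ℂ)) • (f * f) = (f * c * f - (‖c‖ : ℂ) • (f * f)) +
        (-(f * v * f - γ • (f * f))) + (-(f * (c - v) * f)) := by
      rw [mul_sub, sub_mul, sub_smul]; abel
    have h3 : ‖γ - (‖c‖ : ℂ)‖ * ‖f * f‖ ≤ 3 * (ε / 8) := by
      rw [← norm_smul, hfin]
      refine norm_add₃_le.trans ?_
      rw [norm_neg, norm_neg]
      linarith
    have h4 := le_mul_of_one_le_right (norm_nonneg (γ - (‖c‖ : ℂ))) hff
    linarith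

end CStarProjTensor

end LeftExcision

section RightExcision

open Filter Topology

namespace CStarProjTensor

variable {A B Q : Type u} [NonUnitalCStarAlgebra A] [NonUnitalCStarAlgebra B]
  [NonUnitalCStarAlgebra Q] {P : CStarProjTensor A B}
  {J : Submodule ℂ A} {K : Submodule ℂ B} {I : Submodule ℂ P.T}

/-- An elementary tensor sufficiently close to `I` and bounded away from `K` in the right factor
produces a nonzero elementary tensor in `I`. -/
lemma exists_tmul_mem_of_close (hI : IsClosedIdeal I) (hIS : P.sumSub J K ≤ I)
    {q : B →⋆ₙₐ[ℂ] Q} (hq0 : ∀ b, q b = 0 ↔ b ∈ K)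
    (hq : ∀ d (ε : ℝ), 0 < ε → ∃ b, q b = d ∧ ‖b‖ < ‖d‖ + ε)
    {d d' : A} (hd : ‖d‖ ≤ 2) (hdd : d * d' - d' ∈ J) (hdl : ∀ a, ∀ j ∈ J, a * j ∈ J)
    {b : B} {i : P.T} (hi : i ∈ I) {ε : ℝ} (hε : 0 < ε) (hib : ‖P.tmul (d * d) b - i‖ ≤ ε)
    (hqb : 16 * ε ≤ ‖q b‖) : ∃ k, k ∉ K ∧ P.tmul d' k ∈ I := by
  let _ := CStarAlgebra.spectralOrder Q
  have := CStarAlgebra.spectralOrderedRing Q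
  set ρ := ‖q b‖ with hρ
  have hρ0 : 0 < ρ := by linarith
  obtain ⟨b', hb', hbn⟩ := hq (q b) ρ hρ0
  have hi' : i - P.tmul (d * d) (b - b') ∈ I := I.sub_mem hi
    (hIS (tmul_mem_sumSub_right _ ((hq0 _).1 (by rw [map_sub, hb', sub_self]))))
  have hib' : ‖P.tmul (d * d) b' - (i - P.tmul (d * d) (b - b'))‖ ≤ ε := by
    rwa [map_sub, show ∀ x y z : P.T, x - (y - (z - x)) = z - y by intros; abel]
  set i' := i - P.tmul (d * d) (b - b')
  set c := star (q b) * q b with hc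
  have hcr : ‖c‖ = ρ ^ 2 := by rw [hc, CStarRing.norm_star_mul_self, sq]
  have hc0 : c ≠ 0 := norm_ne_zero_iff.1 (by rw [hcr]; positivity)
  obtain ⟨e, e', -, -, he, -, -, hce⟩ :=
    exists_isExcisor (star_mul_self_nonneg (q b)) hc0 (δ := ρ ^ 2 / 32) (by positivity)
  rw [hcr] at hce
  obtain ⟨k, hk, -⟩ := hq e' 1 one_pos
  set r : ℂ := (((ρ ^ 2)⁻¹ : ℝ) : ℂ) with hr
  have hrn : ‖r‖ = (ρ ^ 2)⁻¹ := by rw [hr, Complex.norm_real, Real.norm_of_nonneg (by positivity)]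
  set m := r • (c * e - ρ ^ 2 • e) with hm
  have hmn : ‖m‖ ≤ 1 / 32 := by
    rw [hm, norm_smul, hrn, inv_mul_le_iff₀ (by positivity)]
    linarith
  obtain ⟨m', hm', hmn'⟩ := hq m (1 / 32) (by norm_num)
  refine ⟨k, fun h => he.ne_zero (hk ▸ (hq0 k).2 h), ?_⟩
  set z := P.tmul d' k with hz
  set s := r • (P.tmul d (star b') * (P.tmul (d * d) b' - i')) - P.tmul d m' with hs
  refine hI.mem_of_sub_mul_mem (s := s) ?_ ?_
  · have h1 : ‖r • (P.tmul d (star b') * (P.tmul (d * d) b' - i'))‖ ≤ 1 / 4 := by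
      rw [norm_smul, hrn, inv_mul_le_iff₀ (by positivity)]
      calc _ ≤ ‖P.tmul d (star b')‖ * ‖P.tmul (d * d) b' - i'‖ := norm_mul_le _ _
        _ = ‖d‖ * ‖b'‖ * ‖P.tmul (d * d) b' - i'‖ := by rw [P.norm_tmul, norm_star]
        _ ≤ 2 * (ρ + ρ) * ε := by gcongr
        _ ≤ _ := by nlinarith
    have h2 : ‖P.tmul d m'‖ ≤ 2 * (1 / 16) := by
      rw [P.norm_tmul]
      gcongr
      linarith
    calc _ ≤ _ := norm_sub_le _ _
      _ ≤ 1 / 4 + 2 * (1 / 16) := add_le_add h1 h2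
      _ < 1 := by norm_num
  · have hJ1 : d * (d * d) * d' - d' ∈ J := by
      have : d * (d * d) * d' - d' = d * (d * (d * d' - d')) + d * (d * d' - d') + (d * d' - d') := by
        noncomm_ring
      rw [this]
      exact J.add_mem (J.add_mem (hdl _ _ (hdl _ _ hdd)) (hdl _ _ hdd)) hdd
    have hKm : k - r • (star b' * b' * k) + m' * k ∈ K := by
      rw [← hq0, map_add, map_sub, map_smul, map_mul, map_mul, map_mul, map_star, hb', hk, hm', hm,
        ← hc, smul_mul_assoc, sub_mul, mul_assoc c, smul_mul_assoc, he.mul_eq, smul_sub,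
        ← Complex.coe_smul, smul_smul, hr, ← Complex.ofReal_mul, inv_mul_cancel₀ (by positivity),
        Complex.ofReal_one, one_smul]
      abel
    have key : z - s * z = P.tmul d' (k - r • (star b' * b' * k) + m' * k)
        - P.tmul (d * (d * d) * d' - d') (r • (star b' * b' * k))
        + P.tmul (d * d' - d') (m' * k)
        + r • (P.tmul d (star b') * (i' * z)) := by
      have h1 : P.tmul d (star b') * P.tmul (d * d) b' * z =
          P.tmul (d * (d * d) * d') (star b' * b' * k) := by
        rw [hz, P.tmul_mul, P.tmul_mul]
      have h2 : P.tmul d m' * z = P.tmul (d * d') (m' * k) := P.tmul_mul _ _ _ _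
      rw [hs, sub_mul, h2, smul_mul_assoc, mul_sub, sub_mul, h1, mul_assoc _ i' z]
      simp only [map_add, map_sub, LinearMap.sub_apply, map_smul, smul_sub, ← hz]
      abel
    rw [key]
    refine I.add_mem (I.add_mem (I.sub_mem (hIS (tmul_mem_sumSub_right _ hKm))
      (hIS (tmul_mem_sumSub_left hJ1 _))) (hIS (tmul_mem_sumSub_left hdd _))) ?_
    exact I.smul_mem _ (hI.mul_left _ (hI.mul_right _ hi'))

/-- A closed ideal strictly containing `J ⊗̂ B + A ⊗̂ K` contains an elementary tensor which does
not belong to it. -/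
theorem exists_tmul_mem (hJ : IsClosedIdeal J) (hK : IsClosedIdeal K) (hI : IsClosedIdeal I)
    (hIS : P.sumSub J K ≤ I) {x : P.T} (hx : x ∈ I) (hxS : x ∉ P.sumSub J K) :
    ∃ a b, a ∉ J ∧ b ∉ K ∧ P.tmul a b ∈ I := by
  obtain ⟨g, R, hg, hg1, hR, hR1, hRx⟩ : ∃ (g : B →L[ℂ] ℂ) (R : P.T →L[ℂ] A),
      (∀ b ∈ K, g b = 0) ∧ ‖g‖ ≤ 1 ∧ (∀ a b, R (P.tmul a b) = g b • a) ∧ ‖R‖ ≤ 1 ∧ R x ∉ J := by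
    by_contra! h
    exact hxS (mem_sumSub_of_slice hJ hK h)
  obtain ⟨QA, _, p, hp0, -, hp⟩ := hJ.exists_quotient
  obtain ⟨QB, _, q, hq0, -, hq⟩ := hK.exists_quotient
  have hr : 0 < ‖p (R x)‖ ^ 2 := by
    have := norm_pos_iff.2 fun h => hRx ((hp0 _).1 h)
    positivity
  set ε := ‖p (R x)‖ ^ 2 / 17 with hε
  obtain ⟨d, d', b, hd, hd', hdd, ⟨i, hi, hib⟩, hgb⟩ := exists_excised_tmul hI hIS hp0 hp hR hg1 hR1
    (map_lmul_id_mem hI (star (R x)) hx) (slice_map_lmul hR _ _) hRx (ε := ε) (by positivity)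
  have hqb : 16 * ε ≤ ‖q b‖ := by
    have h1 := norm_apply_le_of_vanish hq0 hq hg hg1 b
    have h2 := norm_sub_norm_le (((‖p (R x)‖ ^ 2 : ℝ) : ℂ)) (g b)
    rw [norm_sub_rev, Complex.norm_real, Real.norm_of_nonneg hr.le] at h2
    linarith
  obtain ⟨k, hk, hkI⟩ := exists_tmul_mem_of_close hI hIS hq0 hq hd hdd
    (fun a j hj => hJ.mul_left a hj) hi (by positivity) hib hqb
  exact ⟨d', k, hd', hk, hkI⟩

end CStarProjTensor

end RightExcision

section PrimeIdeals

open Filter Topology Pointwise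

lemma exists_norm_sub_mul_lt {D : Type*} [NonUnitalCStarAlgebra D] (x : D) (ε : ℝ) (hε : 0 < ε) :
    ∃ e, ‖x - e * x‖ < ε := by
  obtain ⟨u, v, -, -, h⟩ := exists_approximate_unit {x} hε
  exact ⟨u, (h x (Finset.mem_singleton_self x)).2⟩

/-- Elementwise characterization of closed prime ideals in the presence of approximate units. -/
lemma TwoSidedIdeal.IsPrimeTS.mem_or_mem {R : Type*} [NonUnitalNormedRing R]
    (hR : ∀ (x : R) (ε : ℝ), 0 < ε → ∃ e, ‖x - e * x‖ < ε) {J : TwoSidedIdeal R}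
    (hJ : IsClosed (J : Set R)) (hp : J.IsPrimeTS) {x y : R} (h : ∀ a, x * a * y ∈ J) :
    x ∈ J ∨ y ∈ J := by
  let I₁ : TwoSidedIdeal R := .mk' {z | ∀ a, z * a * y ∈ J}
    (fun a => by simpa only [zero_mul] using J.zero_mem)
    (fun {u v} hu hv a => by rw [add_mul, add_mul]; exact J.add_mem (hu a) (hv a))
    (fun {u} hu a => by rw [neg_mul, neg_mul]; exact J.neg_mem (hu a))
    (fun {r u} hu a => by rw [mul_assoc r, mul_assoc r]; exact J.mul_mem_left _ _ (hu a))
    (fun {u r} hu a => by rw [mul_assoc u]; exact hu _)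
  have h₁ : ∀ z, z ∈ I₁ ↔ ∀ a, z * a * y ∈ J := TwoSidedIdeal.mem_mk' _ _ _ _ _ _
  let I₂ : TwoSidedIdeal R := .mk' {w | ∀ z ∈ I₁, ∀ a, z * a * w ∈ J}
    (fun z _ a => by simpa only [mul_zero] using J.zero_mem)
    (fun {u v} hu hv z hz a => by rw [mul_add]; exact J.add_mem (hu z hz a) (hv z hz a))
    (fun {u} hu z hz a => by rw [mul_neg]; exact J.neg_mem (hu z hz a))
    (fun {r u} hu z hz a => by rw [← mul_assoc, mul_assoc z]; exact hu z hz _)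
    (fun {u r} hu z hz a => by rw [← mul_assoc]; exact J.mul_mem_right _ _ (hu z hz a))
  have h₂ : ∀ w, w ∈ I₂ ↔ ∀ z ∈ I₁, ∀ a, z * a * w ∈ J := TwoSidedIdeal.mem_mk' _ _ _ _ _ _
  refine (hp I₁ I₂ fun z hz w hw => ?_).imp (fun hle => hle ((h₁ x).2 h))
    fun hle => hle ((h₂ y).2 fun z hz a => (h₁ z).1 hz a)
  refine hJ.closure_subset (Metric.mem_closure_iff.2 fun ε hε => ?_)
  obtain ⟨e, he⟩ := hR w (ε / (‖z‖ + 1)) (by positivity)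
  refine ⟨z * e * w, (h₂ w).1 hw z hz e, ?_⟩
  rw [dist_eq_norm, mul_assoc, ← mul_sub]
  calc _ ≤ ‖z‖ * ‖w - e * w‖ := norm_mul_le _ _
    _ ≤ (‖z‖ + 1) * ‖w - e * w‖ := by gcongr; linarith
    _ < (‖z‖ + 1) * (ε / (‖z‖ + 1)) := by gcongr
    _ = ε := mul_div_cancel₀ _ (by positivity)

namespace IsClosedIdeal

variable {R : Type*} [NonUnitalNormedRing R] [NormedSpace ℂ R] {S : Submodule ℂ R}

/-- A closed ideal as a two-sided ring ideal. -/
def toTwoSidedIdeal (hS : IsClosedIdeal S) : TwoSidedIdeal R :=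
  .mk' (S : Set R) S.zero_mem S.add_mem S.neg_mem (hS.mul_left _) (hS.mul_right _)

lemma coe_toTwoSidedIdeal (hS : IsClosedIdeal S) : (hS.toTwoSidedIdeal : Set R) = S :=
  TwoSidedIdeal.coe_mk' _ _ _ _ _ _

lemma mem_toTwoSidedIdeal (hS : IsClosedIdeal S) {x : R} : x ∈ hS.toTwoSidedIdeal ↔ x ∈ S :=
  TwoSidedIdeal.mem_mk' _ _ _ _ _ _ x

variable [IsScalarTower ℂ R R] [SMulCommClass ℂ R R]

/-- Ideals with product in a closed ideal are contained in closed ideals with the same property,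
which moreover contain the given closed ideal. -/
lemma exists_le_of_mul_mem (hS : IsClosedIdeal S) {I₁ I₂ : TwoSidedIdeal R}
    (h : ∀ x ∈ I₁, ∀ y ∈ I₂, x * y ∈ S) : ∃ H₁ H₂ : Submodule ℂ R, IsClosedIdeal H₁ ∧
      IsClosedIdeal H₂ ∧ S ≤ H₁ ∧ S ≤ H₂ ∧ (∀ x ∈ I₁, x ∈ H₁) ∧ (∀ y ∈ I₂, y ∈ H₂) ∧
      ∀ x ∈ H₁, ∀ y ∈ H₂, x * y ∈ S := by
  let H₁ : Submodule ℂ R :=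
    { carrier := {x | ∀ y ∈ I₂, x * y ∈ S}
      add_mem' := fun hu hv y hy => by rw [add_mul]; exact S.add_mem (hu y hy) (hv y hy)
      zero_mem' := fun y _ => by rw [zero_mul]; exact S.zero_mem
      smul_mem' := fun c u hu y hy => by rw [smul_mul_assoc]; exact S.smul_mem c (hu y hy) }
  let H₂ : Submodule ℂ R :=
    { carrier := {y | ∀ x ∈ H₁, x * y ∈ S}
      add_mem' := fun hu hv x hx => by rw [mul_add]; exact S.add_mem (hu x hx) (hv x hx)
      zero_mem' := fun x _ => by rw [mul_zero]; exact S.zero_mem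
      smul_mem' := fun c u hu x hx => by rw [mul_smul_comm]; exact S.smul_mem c (hu x hx) }
  have hH₁ : IsClosedIdeal H₁ := by
    refine ⟨?_, fun r x hx y hy => ?_, fun r x hx y hy => ?_⟩
    · have : (H₁ : Set R) = ⋂ y ∈ I₂, (fun x => x * y) ⁻¹' (S : Set R) := by ext; simp [H₁]
      rw [this]
      exact isClosed_biInter fun y _ => hS.isClosed.preimage (continuous_mul_const y)
    · rw [mul_assoc]; exact hS.mul_left r (hx y hy)
    · rw [mul_assoc]; exact hx _ (I₂.mul_mem_left r y hy)
  have hH₂ : IsClosedIdeal H₂ := by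
    refine ⟨?_, fun r y hy x hx => ?_, fun r y hy x hx => ?_⟩
    · have : (H₂ : Set R) = ⋂ x ∈ H₁, (fun y => x * y) ⁻¹' (S : Set R) := by ext; simp [H₂]
      rw [this]
      exact isClosed_biInter fun x _ => hS.isClosed.preimage (continuous_const_mul x)
    · rw [← mul_assoc]; exact hy _ (hH₁.mul_right r hx)
    · rw [← mul_assoc]; exact hS.mul_right r (hy x hx)
  exact ⟨H₁, H₂, hH₁, hH₂, fun x hx y _ => hS.mul_right y hx, fun y hy x _ => hS.mul_left x hy,
    h, fun y hy x hx => hx y hy, fun x hx y hy => hy x hx⟩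

end IsClosedIdeal

namespace CStarProjTensor

variable {A B : Type u} [NonUnitalCStarAlgebra A] [NonUnitalCStarAlgebra B]
  {P : CStarProjTensor A B}

/-- The elements `a` with `a ⊙ B ⊆ I`. -/
def leftPart (I : Submodule ℂ P.T) : Submodule ℂ A where
  carrier := {a | ∀ b, P.tmul a b ∈ I}
  add_mem' := fun hx hy b => by
    rw [map_add, LinearMap.add_apply]; exact I.add_mem (hx b) (hy b)
  zero_mem' := fun b => by rw [map_zero, LinearMap.zero_apply]; exact I.zero_mem
  smul_mem' := fun c x hx b => by
    rw [map_smul, LinearMap.smul_apply]; exact I.smul_mem c (hx b)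

/-- The elements `b` with `A ⊙ b ⊆ I`. -/
def rightPart (I : Submodule ℂ P.T) : Submodule ℂ B where
  carrier := {b | ∀ a, P.tmul a b ∈ I}
  add_mem' := fun hx hy a => by rw [map_add]; exact I.add_mem (hx a) (hy a)
  zero_mem' := fun a => by rw [map_zero]; exact I.zero_mem
  smul_mem' := fun c x hx a => by rw [map_smul]; exact I.smul_mem c (hx a)

variable {I : Submodule ℂ P.T} {J : Submodule ℂ A} {K : Submodule ℂ B}

lemma isClosedIdeal_leftPart (hI : IsClosedIdeal I) : IsClosedIdeal (leftPart I) := by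
  refine ⟨?_, fun r x hx b => ?_, fun r x hx b => ?_⟩
  · have : (leftPart I : Set A) = ⋂ b, (fun a => P.tmulL a b) ⁻¹' (I : Set P.T) := by
      ext; simp [leftPart]
    rw [this]
    exact isClosed_iInter fun b => hI.isClosed.preimage (by fun_prop)
  · simpa using map_lmul_id_mem hI r (hx b)
  · simpa using map_rmul_id_mem hI r (hx b)

lemma isClosedIdeal_rightPart (hI : IsClosedIdeal I) : IsClosedIdeal (rightPart I) := by
  refine ⟨?_, fun r x hx a => ?_, fun r x hx a => ?_⟩
  · have : (rightPart I : Set B) = ⋂ a, (fun b => P.tmulL a b) ⁻¹' (I : Set P.T) := by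
      ext; simp [rightPart]
    rw [this]
    exact isClosed_iInter fun a => hI.isClosed.preimage (by fun_prop)
  · simpa using map_id_lmul_mem hI r (hx a)
  · simpa using map_id_rmul_mem hI r (hx a)

lemma mul_mul_mem_of_tmul_mem (hI : IsClosedIdeal I) {x y : P.T}
    (h : ∀ a b, x * P.tmul a b * y ∈ I) (t : P.T) : x * t * y ∈ I :=
  P.dense_induction (p := fun t => x * t * y ∈ I) t
    (hI.isClosed.preimage ((continuous_const.mul continuous_id).mul continuous_const))
    (by rw [mul_zero, zero_mul]; exact I.zero_mem)
    (fun u v hu hv => by rw [mul_add, add_mul]; exact I.add_mem hu hv) h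

lemma isPrimeTS_leftPart (hI : IsClosedIdeal I)
    (hp : ∀ x y : P.T, (∀ t, x * t * y ∈ I) → x ∈ I ∨ y ∈ I) :
    (isClosedIdeal_leftPart hI).toTwoSidedIdeal.IsPrimeTS := by
  intro I₁ I₂ h
  simp only [IsClosedIdeal.mem_toTwoSidedIdeal] at h
  by_contra! hcon
  obtain ⟨⟨x, hx, hxJ⟩, ⟨y, hy, hyJ⟩⟩ := hcon.imp SetLike.not_le_iff_exists.1
    SetLike.not_le_iff_exists.1
  rw [IsClosedIdeal.mem_toTwoSidedIdeal] at hxJ hyJ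
  obtain ⟨b, hb⟩ := not_forall.1 hxJ
  obtain ⟨d, hd⟩ := not_forall.1 hyJ
  refine (hp _ _ (mul_mul_mem_of_tmul_mem hI fun a c => ?_)).elim hb hd
  rw [P.tmul_mul, P.tmul_mul]
  exact h _ (I₁.mul_mem_right _ _ hx) _ hy _

lemma isPrimeTS_rightPart (hI : IsClosedIdeal I)
    (hp : ∀ x y : P.T, (∀ t, x * t * y ∈ I) → x ∈ I ∨ y ∈ I) :
    (isClosedIdeal_rightPart hI).toTwoSidedIdeal.IsPrimeTS := by
  intro I₁ I₂ h
  simp only [IsClosedIdeal.mem_toTwoSidedIdeal] at h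
  by_contra! hcon
  obtain ⟨⟨x, hx, hxJ⟩, ⟨y, hy, hyJ⟩⟩ := hcon.imp SetLike.not_le_iff_exists.1
    SetLike.not_le_iff_exists.1
  rw [IsClosedIdeal.mem_toTwoSidedIdeal] at hxJ hyJ
  obtain ⟨b, hb⟩ := not_forall.1 hxJ
  obtain ⟨d, hd⟩ := not_forall.1 hyJ
  refine (hp _ _ (mul_mul_mem_of_tmul_mem hI fun a c => ?_)).elim hb hd
  rw [P.tmul_mul, P.tmul_mul]
  exact h _ (I₁.mul_mem_right _ _ hx) _ hy _

lemma eq_sumSub_of_prime (hI : IsClosedIdeal I)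
    (hp : ∀ x y : P.T, (∀ t, x * t * y ∈ I) → x ∈ I ∨ y ∈ I) :
    I = P.sumSub (leftPart I) (rightPart I) := by
  have hle : P.sumSub (leftPart I) (rightPart I) ≤ I :=
    sumSub_le hI.isClosed (fun a ha b => ha b) fun a b hb => hb a
  refine le_antisymm (fun x hx => ?_) hle
  by_contra hxS
  obtain ⟨e, d, he, hd, hed⟩ := exists_tmul_mem (isClosedIdeal_leftPart hI)
    (isClosedIdeal_rightPart hI) hI hle hx hxS
  obtain ⟨b, hb⟩ := not_forall.1 he
  obtain ⟨a, ha⟩ := not_forall.1 hd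
  refine (hp _ _ (mul_mul_mem_of_tmul_mem hI fun a' b' => ?_)).elim hb ha
  rw [P.tmul_mul, P.tmul_mul, mul_assoc]
  simpa using map_id_lmul_mem hI (b * b') (map_rmul_id_mem hI (a' * a) hed)

lemma isPrimeTS_sumSub (hJ : IsClosedIdeal J) (hK : IsClosedIdeal K)
    (hJp : ∀ x y, (∀ a, x * a * y ∈ J) → x ∈ J ∨ y ∈ J)
    (hKp : ∀ x y, (∀ b, x * b * y ∈ K) → x ∈ K ∨ y ∈ K) :
    (isClosedIdeal_sumSub (P := P) hJ hK).toTwoSidedIdeal.IsPrimeTS := by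
  intro I₁ I₂ h
  simp only [IsClosedIdeal.mem_toTwoSidedIdeal] at h
  by_contra! hcon
  obtain ⟨⟨x, hx, hxS⟩, ⟨y, hy, hyS⟩⟩ := hcon.imp SetLike.not_le_iff_exists.1
    SetLike.not_le_iff_exists.1
  rw [IsClosedIdeal.mem_toTwoSidedIdeal] at hxS hyS
  obtain ⟨H₁, H₂, hH₁, hH₂, hS₁, hS₂, h₁, h₂, hH⟩ :=
    (isClosedIdeal_sumSub hJ hK).exists_le_of_mul_mem h
  obtain ⟨e, d, he, hd, hed⟩ := exists_tmul_mem hJ hK hH₁ hS₁ (h₁ x hx) hxS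
  obtain ⟨e', d', he', hd', hed'⟩ := exists_tmul_mem hJ hK hH₂ hS₂ (h₂ y hy) hyS
  have hmem : ∀ a b, e * a * e' ∈ J ∨ d * b * d' ∈ K := fun a b =>
    mem_or_mem_of_tmul_mem_sumSub (P := P) hJ.isClosed hK.isClosed (by
      rw [← P.tmul_mul, ← P.tmul_mul]
      exact hH _ (hH₁.mul_right _ hed) _ hed')
  by_cases hall : ∀ a, e * a * e' ∈ J
  · exact (hJp _ _ hall).elim he he'
  · obtain ⟨a, ha⟩ := not_forall.1 hall
    exact (hKp _ _ fun b => (hmem a b).resolve_left ha).elim hd hd'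

end CStarProjTensor

end PrimeIdeals

section

variable {A B : Type u} [NonUnitalCStarAlgebra A] [NonUnitalCStarAlgebra B]
  (P : CStarProjTensor A B)

/-- Let `I ⊆ A ⊗̂ B` be a closed prime two-sided ideal and set
`J = {a : a ⊙ B ⊆ I}` and `K = {b : A ⊙ b ⊆ I}`.  Then `J` and `K` are closed prime
two-sided ideals of `A` and `B` respectively, and `I = (J ⊗̂ B) + (A ⊗̂ K)`.
Conversely, for closed prime two-sided ideals `J ⊆ A` and `K ⊆ B`, the subset
`(J ⊗̂ B) + (A ⊗̂ K)` is a closed prime two-sided ideal of `A ⊗̂ B`. -/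
theorem prime_ideals_projTensor :
    (∀ I : TwoSidedIdeal P.T, IsClosed (I : Set P.T) → I.IsPrimeTS →
      (∃ J : TwoSidedIdeal A, (J : Set A) = {a : A | ∀ b : B, P.tmul a b ∈ I} ∧
          IsClosed (J : Set A) ∧ J.IsPrimeTS) ∧
      (∃ K : TwoSidedIdeal B, (K : Set B) = {b : B | ∀ a : A, P.tmul a b ∈ I} ∧
          IsClosed (K : Set B) ∧ K.IsPrimeTS) ∧
      (I : Set P.T) =
        leftTensorIdeal P {a : A | ∀ b : B, P.tmul a b ∈ I} +
          rightTensorIdeal P {b : B | ∀ a : A, P.tmul a b ∈ I}) ∧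
    (∀ (J : TwoSidedIdeal A) (K : TwoSidedIdeal B),
      IsClosed (J : Set A) → IsClosed (K : Set B) → J.IsPrimeTS → K.IsPrimeTS →
      ∃ I : TwoSidedIdeal P.T,
        (I : Set P.T) = leftTensorIdeal P (J : Set A) + rightTensorIdeal P (K : Set B) ∧
        IsClosed (I : Set P.T) ∧ I.IsPrimeTS) := by
  refine ⟨fun I hI hp => ?_, fun J K hJ hK hJp hKp => ?_⟩
  · obtain ⟨I', hII', hI'⟩ := IsClosedIdeal.exists_submodule_eq P.exists_left_unit I hI
    have hmem : ∀ x, x ∈ I' ↔ x ∈ I := fun x => Set.ext_iff.1 hII' x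
    have hp' : ∀ x y : P.T, (∀ t, x * t * y ∈ I') → x ∈ I' ∨ y ∈ I' := fun x y h => by
      simp only [hmem] at h ⊢
      exact hp.mem_or_mem P.exists_left_unit hI h
    have hl : (CStarProjTensor.leftPart I' : Set A) = {a : A | ∀ b : B, P.tmul a b ∈ I} :=
      Set.ext fun a => forall_congr' fun b => hmem _
    have hr : (CStarProjTensor.rightPart I' : Set B) = {b : B | ∀ a : A, P.tmul a b ∈ I} :=
      Set.ext fun b => forall_congr' fun a => hmem _
    have hJ := CStarProjTensor.isClosedIdeal_leftPart hI'
    have hK := CStarProjTensor.isClosedIdeal_rightPart hI'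
    refine ⟨⟨hJ.toTwoSidedIdeal, hJ.coe_toTwoSidedIdeal.trans hl, ?_,
      CStarProjTensor.isPrimeTS_leftPart hI' hp'⟩, ⟨hK.toTwoSidedIdeal,
      hK.coe_toTwoSidedIdeal.trans hr, ?_, CStarProjTensor.isPrimeTS_rightPart hI' hp'⟩, ?_⟩
    · rw [hJ.coe_toTwoSidedIdeal]; exact hJ.isClosed
    · rw [hK.coe_toTwoSidedIdeal]; exact hK.isClosed
    · rw [← hl, ← hr, ← P.coe_sumSub, ← CStarProjTensor.eq_sumSub_of_prime hI' hp', hII']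
  · obtain ⟨J', hJJ', hJ'⟩ := IsClosedIdeal.exists_submodule_eq exists_norm_sub_mul_lt J hJ
    obtain ⟨K', hKK', hK'⟩ := IsClosedIdeal.exists_submodule_eq exists_norm_sub_mul_lt K hK
    have hmJ : ∀ x, x ∈ J' ↔ x ∈ J := fun x => Set.ext_iff.1 hJJ' x
    have hmK : ∀ x, x ∈ K' ↔ x ∈ K := fun x => Set.ext_iff.1 hKK' x
    have hS := CStarProjTensor.isClosedIdeal_sumSub (P := P) hJ' hK'
    refine ⟨hS.toTwoSidedIdeal, ?_, ?_, CStarProjTensor.isPrimeTS_sumSub hJ' hK' ?_ ?_⟩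
    · rw [hS.coe_toTwoSidedIdeal, P.coe_sumSub, hJJ', hKK']
    · rw [hS.coe_toTwoSidedIdeal]; exact hS.isClosed
    · intro x y h
      simp only [hmJ] at h ⊢
      exact hJp.mem_or_mem exists_norm_sub_mul_lt hJ h
    · intro x y h
      simp only [hmK] at h ⊢
      exact hKp.mem_or_mem exists_norm_sub_mul_lt hK h

end
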